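/- Uniqueness theorem for Inverse Problem 1: consider two boundary value problems B and B̃ with the same T, N, nodes b_j, and the same coefficients α, β, γ_j (with αβγ_j ≠ 0), one with data (p, q, h', h, η'_j, η_j) and one with data (p̃, q̃, h̃', h̃, η̃'_j, η̃_j); assume z_0^± := α(1 ∓ h') + β ≠ 0, z̃_0^± := α(1 ∓ h̃') + β ≠ 0, ξ_j^± := (γ_j + γ_j^{−1})/2 ∓ η'_j/2 ≠ 0 and ξ̃_j^± ≠ 0. Define φ(x,ρ) = C(x,ρ) + (iρh' + h)S(x,ρ), a(ρ) = αφ(T,ρ) + βS'(T,ρ) − (1 + αβ), d(ρ) = S(T,ρ), d_1(ρ) = C(T,ρ), Q(ρ) = αφ(T,ρ) − βS'(T,ρ), and similarly for the tilde problem. Suppose (1) a(ρ) = ã(ρ) for all ρ, (2) d(ρ) = d̃(ρ) for all ρ, and (3) the Ω-sequences coincide, meaning: for every zero ν of d, the sign datum ω(ν) equals ω̃(ν), where ω(ν) = 0 if Q(ν) = 0, ω(ν) = +1 if Q(ν) ≠ 0 and arg Q(ν) ∈ [0,π), and ω(ν) = −1 if Q(ν) ≠ 0 and arg Q(ν) ∈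 [π,2π); and for every zero ν of d of multiplicity m > 1 with Q(ν) = 0, additionally d_1^{(j)}(ν) = d̃_1^{(j)}(ν) for j = 1,…,m−1. Then the two problems coincide: h' = h̃', h = h̃, p = p̃ a.e. on (0,T), q = q̃ a.e. on (0,T), and η'_j = η̃'_j, η_j = η̃_j for j = 1,…,N−1. -/

import Mathlib

open MeasureTheory Set Filter Complex intervalIntegral
open scoped Topology

noncomputable section

/-- `y` (with derivative `y'`) solves the pencil equation
`y'' + (ρ² + ρ p x + q x) y = 0` on the open interval `(c, d)`:
`y` is differentiable with derivative `y'` there, and `y'` is absolutely continuous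
with `y'' = -(ρ² + ρ p + q) y` almost everywhere, which is encoded by the
integral equation for `y'`. -/
def PencilSolOn (p q : ℝ → ℂ) (ρ : ℂ) (y y' : ℝ → ℂ) (c d : ℝ) : Prop :=
  (∀ x ∈ Set.Ioo c d, HasDerivAt y (y' x) x) ∧
  (∀ u ∈ Set.Ioo c d, ∀ v ∈ Set.Ioo c d,
    y' v - y' u = ∫ t in u..v, -((ρ ^ 2 + ρ * p t + q t) * y t))

/-- A solution with jumps of the pencil equation on `[b 0, b N]`, together with its
one-sided limits at the nodes `b j`.  The fields `yL j, yL' j` (resp. `yR j, yR' j`)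
are the one-sided limits `y (b j - 0), y' (b j - 0)` (resp. `y (b j + 0), y' (b j + 0)`).
The values of `y, y'` at the endpoints `b 0` and `b N` are understood as the
corresponding one-sided limits, and the jump conditions hold at the interior nodes
`b 1, …, b (N-1)`. -/
structure JumpSolution (N : ℕ) (b : ℕ → ℝ) (p q : ℝ → ℂ)
    (γ η' η : ℕ → ℂ) (ρ : ℂ) where
  y : ℝ → ℂ
  y' : ℝ → ℂ
  yL : ℕ → ℂ
  yL' : ℕ → ℂ
  yR : ℕ → ℂ
  yR' : ℕ → ℂ
  solves : ∀ j, 1 ≤ j → j ≤ N →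
    PencilSolOn p q ρ y y' (b (j - 1)) (b j)
  limL : ∀ j, 1 ≤ j → j ≤ N →
    Filter.Tendsto y (nhdsWithin (b j) (Set.Iio (b j))) (nhds (yL j)) ∧
    Filter.Tendsto y' (nhdsWithin (b j) (Set.Iio (b j))) (nhds (yL' j))
  limR : ∀ j, j + 1 ≤ N →
    Filter.Tendsto y (nhdsWithin (b j) (Set.Ioi (b j))) (nhds (yR j)) ∧
    Filter.Tendsto y' (nhdsWithin (b j) (Set.Ioi (b j))) (nhds (yR' j))
  jump : ∀ j, 1 ≤ j → j + 1 ≤ N →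
    yR j = γ j * yL j ∧
    yR' j = (γ j)⁻¹ * yL' j + (Complex.I * ρ * η' j + η j) * yL j
  left_end : y (b 0) = yR 0 ∧ y' (b 0) = yR' 0
  right_end : y (b N) = yL N ∧ y' (b N) = yL' N

/-- `p` is absolutely continuous on `[a, b]`. -/
def AbsCont (p : ℝ → ℂ) (a b : ℝ) : Prop :=
  ∃ p' : ℝ → ℂ, MeasureTheory.IntegrableOn p' (Set.Icc a b) ∧
    ∀ x ∈ Set.Icc a b, p x = p a + ∫ t in a..x, p' t

/-- The sign datum `ω` attached to a value `z = Q(ν)`: it is `0` if `z = 0`, `+1` if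
`z ≠ 0` and the argument of `z` taken in `[0, 2π)` lies in `[0, π)`, and `-1`
otherwise (argument in `[π, 2π)`).  In terms of `Complex.arg ∈ (-π, π]`, the
argument taken in `[0,2π)` lies in `[0,π)` iff `0 ≤ Complex.arg z < π`. -/
noncomputable def omegaSign (z : ℂ) : ℤ :=
  if z = 0 then 0
  else if 0 ≤ Complex.arg z ∧ Complex.arg z < Real.pi then 1
  else -1

section

/-! ### Indefinite integrals of integrable functions -/

theorem AbsolutelyContinuousOnInterval.of_dist_le {X Y : Type*} [PseudoMetricSpace X]
    [PseudoMetricSpace Y] {f : ℝ → X} {g : ℝ → Y} {a b K : ℝ}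
    (hg : AbsolutelyContinuousOnInterval g a b)
    (h : ∀ x ∈ uIcc a b, ∀ y ∈ uIcc a b, dist (f x) (f y) ≤ K * dist (g x) (g y)) :
    AbsolutelyContinuousOnInterval f a b := by
  unfold AbsolutelyContinuousOnInterval at hg ⊢
  have hK := hg.const_mul K
  rw [mul_zero] at hK
  refine squeeze_zero' (Eventually.of_forall fun E => Finset.sum_nonneg fun i _ => dist_nonneg)
    ?_ hK
  filter_upwards [mem_inf_of_right (mem_principal_self _)] with E hE
  rw [Finset.mul_sum]
  exact Finset.sum_le_sum fun i hi => h _ (hE.1 i hi).1 _ (hE.1 i hi).2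

/-- `f` is an indefinite integral on `[c, d]` of the integrable function `f'`. -/
structure IsPrimitiveOn {E : Type*} [NormedAddCommGroup E] [NormedSpace ℝ E]
    (f f' : ℝ → E) (c d : ℝ) : Prop where
  integrable : IntervalIntegrable f' volume c d
  eq_add_integral : ∀ x ∈ Icc c d, f x = f c + ∫ t in c..x, f' t

namespace IsPrimitiveOn

variable {E G : Type*} [NormedAddCommGroup E] [NormedSpace ℝ E]
  [NormedAddCommGroup G] [NormedSpace ℝ G] {f f' g g' : ℝ → E} {c d : ℝ}

theorem integrable_sub (hf : IsPrimitiveOn f f' c d) {x y : ℝ} (hx : x ∈ Icc c d)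
    (hy : y ∈ Icc c d) : IntervalIntegrable f' volume x y := by
  have hcd : c ≤ d := hx.1.trans hx.2
  refine hf.integrable.mono_set ?_
  rw [uIcc_of_le hcd]
  exact uIcc_subset_Icc hx hy

theorem sub_eq_integral (hf : IsPrimitiveOn f f' c d) {x y : ℝ} (hx : x ∈ Icc c d)
    (hy : y ∈ Icc c d) : f y - f x = ∫ t in x..y, f' t := by
  have hc : c ∈ Icc c d := left_mem_Icc.2 (hx.1.trans hx.2)
  rw [hf.eq_add_integral x hx, hf.eq_add_integral y hy, add_sub_add_left_eq_sub,
    intervalIntegral.integral_interval_sub_left (hf.integrable_sub hc hy)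
      (hf.integrable_sub hc hx)]

theorem mono (hf : IsPrimitiveOn f f' c d) {c' d' : ℝ} (hc : c' ∈ Icc c d) (hd : d' ∈ Icc c d)
    : IsPrimitiveOn f f' c' d' :=
  ⟨hf.integrable_sub hc hd, fun x hx => by
    rw [← hf.sub_eq_integral hc ⟨hc.1.trans hx.1, hx.2.trans hd.2⟩]; abel⟩

theorem continuousOn (hf : IsPrimitiveOn f f' c d) : ContinuousOn f (Icc c d) := by
  rcases le_or_gt c d with hcd | hcd
  · have h1 := intervalIntegral.continuousOn_primitive_interval' hf.integrable
      (left_mem_uIcc (a := c) (b := d))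
    rw [uIcc_of_le hcd] at h1
    exact (continuousOn_const.add h1).congr hf.eq_add_integral
  · simp [Icc_eq_empty (not_le.2 hcd)]

theorem ac (hf : IsPrimitiveOn f f' c d) (hcd : c ≤ d) :
    AbsolutelyContinuousOnInterval f c d := by
  have h1 := hf.integrable.norm.absolutelyContinuousOnInterval_intervalIntegral
    (left_mem_uIcc (a := c) (b := d))
  refine h1.of_dist_le (K := 1) fun x hx y hy => ?_
  rw [uIcc_of_le hcd] at hx hy
  have hc : c ∈ Icc c d := left_mem_Icc.2 hcd
  rw [dist_comm, dist_comm (∫ v in c..x, ‖f' v‖), dist_eq_norm, hf.sub_eq_integral hx hy, one_mul,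
    Real.dist_eq, intervalIntegral.integral_interval_sub_left
      (hf.integrable_sub hc hy).norm (hf.integrable_sub hc hx).norm]
  exact intervalIntegral.norm_integral_le_abs_integral_norm

theorem ae_hasDerivAt [CompleteSpace E] (hf : IsPrimitiveOn f f' c d) :
    ∀ᵐ x, x ∈ Ioo c d → HasDerivAt f (f' x) x := by
  filter_upwards [hf.integrable.ae_hasDerivAt_integral] with x hx hxm
  have hcd : c ≤ d := (hxm.1.trans hxm.2).le
  have h1 := hx (by rw [uIcc_of_le hcd]; exact Ioo_subset_Icc_self hxm) c left_mem_uIcc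
  refine (h1.const_add (f c)).congr_of_eventuallyEq ?_
  filter_upwards [Ioo_mem_nhds hxm.1 hxm.2] with y hy
  exact hf.eq_add_integral y (Ioo_subset_Icc_self hy)

theorem of_ac [CompleteSpace E] (hcd : c ≤ d) (hf : AbsolutelyContinuousOnInterval f c d)
    (hf' : IntervalIntegrable f' volume c d)
    (h : ∀ᵐ x, x ∈ Ioo c d → HasDerivAt f (f' x) x) : IsPrimitiveOn f f' c d := by
  refine ⟨hf', ?_⟩
  have h0 : IsPrimitiveOn (fun x => ∫ t in c..x, f' t) f' c d :=
    ⟨hf', fun x _ => by simp⟩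
  have h1 := hf.fun_sub (h0.ac hcd)
  obtain ⟨C, hC⟩ := h1.const_of_ae_hasDerivAt_zero (by
    have hc : ∀ᵐ x : ℝ, x ≠ c := by simp [ae_iff, measure_singleton]
    have hd : ∀ᵐ x : ℝ, x ≠ d := by simp [ae_iff, measure_singleton]
    filter_upwards [h, h0.ae_hasDerivAt, hc, hd] with x hx1 hx2 hxc hxd hxm
    rw [uIcc_of_le hcd] at hxm
    have hxm' : x ∈ Ioo c d := ⟨lt_of_le_of_ne hxm.1 (Ne.symm hxc), lt_of_le_of_ne hxm.2 hxd⟩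
    simpa using (hx1 hxm').fun_sub (hx2 hxm'))
  rw [uIcc_of_le hcd] at hC
  intro x hx
  have e1 := hC x hx
  have e2 := hC c (left_mem_Icc.2 hcd)
  simp only [integral_same, sub_zero] at e1 e2
  rw [e2, ← e1]; abel

theorem comp [CompleteSpace G] [FiniteDimensional ℝ E] [CompleteSpace E]
    (hf : IsPrimitiveOn f f' c d) (hcd : c ≤ d)
    {φ : E → G} (hφ : ContDiff ℝ 1 φ) :
    IsPrimitiveOn (fun x => φ (f x)) (fun x => fderiv ℝ φ (f x) (f' x)) c d := by
  have := FiniteDimensional.proper ℝ E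
  obtain ⟨M, hM⟩ := isCompact_Icc.exists_bound_of_continuousOn hf.continuousOn
  obtain ⟨K, hK⟩ := (hφ.contDiffOn (s := Metric.closedBall (0 : E) M)).exists_lipschitzOnWith
    (by decide) (convex_closedBall _ _) (isCompact_closedBall _ _)
  have hcont : ContinuousOn (fun x => fderiv ℝ φ (f x)) (Icc c d) :=
    (hφ.continuous_fderiv (by decide)).comp_continuousOn hf.continuousOn
  refine of_ac hcd ?_ ?_ ?_
  · refine (hf.ac hcd).of_dist_le (K := K) fun x hx y hy => ?_
    rw [uIcc_of_le hcd] at hx hy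
    exact hK.dist_le_mul _ (by simpa using hM x hx) _ (by simpa using hM y hy)
  · obtain ⟨B, hB⟩ := isCompact_Icc.exists_bound_of_continuousOn hcont
    have hi := hf.integrable
    rw [intervalIntegrable_iff_integrableOn_Icc_of_le hcd] at hi ⊢
    refine Integrable.mono' (hi.norm.const_mul B) ?_ ?_
    · exact (ContinuousLinearMap.aestronglyMeasurable_comp₂ (.id ℝ (E →L[ℝ] G))
        (hcont.aestronglyMeasurable measurableSet_Icc) hi.aestronglyMeasurable)
    · filter_upwards [ae_restrict_mem measurableSet_Icc] with x hx
      exact (ContinuousLinearMap.le_opNorm _ _).trans (by gcongr; exact hB x hx)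
  · filter_upwards [hf.ae_hasDerivAt] with x hx hxm
    exact ((hφ.differentiable (by decide)).differentiableAt.hasFDerivAt).comp_hasDerivAt x (hx hxm)

theorem complex_exp {f f' : ℝ → ℂ} (hf : IsPrimitiveOn f f' c d) (hcd : c ≤ d) :
    IsPrimitiveOn (fun x => Complex.exp (f x)) (fun x => f' x * Complex.exp (f x)) c d := by
  have h := hf.comp hcd (φ := Complex.exp) Complex.contDiff_exp
  refine ⟨?_, ?_⟩ <;> [have h1 := h.1; have h1 := h.2] <;>
  · convert h1 using 3
    simp [((Complex.hasDerivAt_exp _).hasFDerivAt.restrictScalars ℝ).fderiv]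

theorem real_exp {f f' : ℝ → ℝ} (hf : IsPrimitiveOn f f' c d) (hcd : c ≤ d) :
    IsPrimitiveOn (fun x => Real.exp (f x)) (fun x => f' x * Real.exp (f x)) c d := by
  have h := hf.comp hcd (φ := Real.exp) Real.contDiff_exp
  refine ⟨?_, ?_⟩ <;> [have h1 := h.1; have h1 := h.2] <;>
  · convert h1 using 3; simp

theorem mul {𝕜 : Type*} [RCLike 𝕜] {f f' g g' : ℝ → 𝕜} (hf : IsPrimitiveOn f f' c d)
    (hg : IsPrimitiveOn g g' c d) (hcd : c ≤ d) :
    IsPrimitiveOn (fun x => f x * g x) (fun x => f' x * g x + f x * g' x) c d := by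
  refine of_ac hcd ((hf.ac hcd).fun_smul (hg.ac hcd)) ?_ ?_
  · have h1 := hf.continuousOn
    have h2 := hg.continuousOn
    rw [← uIcc_of_le hcd] at h1 h2
    exact (hf.integrable.mul_continuousOn h2).add (hg.integrable.continuousOn_mul h1)
  · filter_upwards [hf.ae_hasDerivAt, hg.ae_hasDerivAt] with x hx hy hxm
    exact (hx hxm).mul (hy hxm)

theorem add (hf : IsPrimitiveOn f f' c d) (hg : IsPrimitiveOn g g' c d) :
    IsPrimitiveOn (fun x => f x + g x) (fun x => f' x + g' x) c d := by
  refine ⟨hf.integrable.add hg.integrable, fun x hx => ?_⟩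
  have hc : c ∈ Icc c d := left_mem_Icc.2 (hx.1.trans hx.2)
  rw [intervalIntegral.integral_add (hf.integrable_sub hc hx) (hg.integrable_sub hc hx),
    hf.eq_add_integral x hx, hg.eq_add_integral x hx]
  abel

theorem const_mul {𝕜 : Type*} [RCLike 𝕜] {f f' : ℝ → 𝕜} (hf : IsPrimitiveOn f f' c d) (k : 𝕜) :
    IsPrimitiveOn (fun x => k * f x) (fun x => k * f' x) c d := by
  refine ⟨hf.integrable.const_mul k, fun x hx => ?_⟩
  rw [intervalIntegral.integral_const_mul, hf.eq_add_integral x hx]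
  ring

theorem congr_deriv (hf : IsPrimitiveOn f f' c d) (h : ∀ x, f' x = g' x) :
    IsPrimitiveOn f g' c d := by
  rwa [← funext h]

theorem integral_self (hf : IntervalIntegrable f' volume c d) :
    IsPrimitiveOn (fun x => ∫ t in c..x, f' t) f' c d :=
  ⟨hf, fun x _ => by simp⟩

end IsPrimitiveOn

/-- **Grönwall's inequality** with an integrable coefficient. -/
theorem gronwall_of_integrable {c d : ℝ} (hcd : c ≤ d) {u k : ℝ → ℝ} {K : ℝ}
    (hu : ContinuousOn u (Icc c d)) (hk : IntervalIntegrable k volume c d) (hk0 : ∀ x, 0 ≤ k x)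
    (h : ∀ x ∈ Icc c d, u x ≤ K + ∫ t in c..x, k t * u t) :
    ∀ x ∈ Icc c d, u x ≤ K * Real.exp (∫ t in c..x, k t) := by
  have hA := (IsPrimitiveOn.integral_self hk)
  have hE := (hA.const_mul (-1)).real_exp hcd
  have huI : ContinuousOn u (uIcc c d) := by rwa [uIcc_of_le hcd]
  have hV : IsPrimitiveOn (fun x => K + ∫ t in c..x, k t * u t) (fun t => k t * u t) c d :=
    ⟨hk.mul_continuousOn huI, fun x _ => by simp⟩
  have hW := hV.mul hE hcd
  intro x hx
  have hle := hW.sub_eq_integral (left_mem_Icc.2 hcd) hx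
  have hneg : (∫ t in c..x, (k t * u t * Real.exp (-1 * ∫ s in c..t, k s) +
      (K + ∫ s in c..t, k s * u s) * (-1 * k t * Real.exp (-1 * ∫ s in c..t, k s)))) ≤ 0 := by
    rw [← neg_nonneg, ← intervalIntegral.integral_neg]
    refine intervalIntegral.integral_nonneg hx.1 fun t ht => ?_
    have h1 := h t ⟨ht.1, ht.2.trans hx.2⟩
    have h2 : 0 ≤ k t * Real.exp (-1 * ∫ s in c..t, k s) :=
      mul_nonneg (hk0 t) (Real.exp_pos _).le
    nlinarith [mul_le_mul_of_nonneg_left h1 h2]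
  rw [← hle] at hneg
  simp only [integral_same, mul_zero, add_zero, Real.exp_zero, mul_one] at hneg
  have h3 : (K + ∫ t in c..x, k t * u t) * Real.exp (-1 * ∫ s in c..x, k s) ≤ K := by linarith
  refine (h x hx).trans ?_
  calc (K + ∫ t in c..x, k t * u t)
      = (K + ∫ t in c..x, k t * u t) * Real.exp (-1 * ∫ s in c..x, k s)
        * Real.exp (∫ t in c..x, k t) := by
        rw [mul_assoc, ← Real.exp_add]; simp
    _ ≤ _ := by gcongr
end

section

/-! ### Entire functions of exponential type -/

/-- A function on the complex plane of at most exponential growth. -/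
def ExpType (f : ℂ → ℂ) : Prop := ∃ K : ℝ, ∀ z, ‖f z‖ ≤ Real.exp (K * (1 + ‖z‖))

/-- Integration over a disk by means of averages over concentric circles. -/
theorem setIntegral_ball_eq_integral_circleAverage {g : ℂ → ℝ} (hg : Continuous g) (c : ℂ)
    {R : ℝ} (hR : 0 ≤ R) :
    ∫ z in Metric.ball c R, g z = ∫ r in 0..R, 2 * Real.pi * r * Real.circleAverage g c r := by
  have h1 : ∫ z in Metric.ball c R, g z
      = ∫ z, (Metric.ball (0 : ℂ) R).indicator (fun z => g (z + c)) z := by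
    rw [← MeasureTheory.integral_indicator Metric.isOpen_ball.measurableSet,
      ← MeasureTheory.integral_add_right_eq_self _ c]
    congr 1; ext z
    by_cases hz : z ∈ Metric.ball (0 : ℂ) R
    · rw [indicator_of_mem hz, indicator_of_mem]
      simpa using hz
    · rw [indicator_of_notMem hz, indicator_of_notMem]
      simpa using hz
  rw [h1, ← Complex.integral_comp_polarCoord_symm]
  have h2 : ∀ r : ℝ, 0 ≤ r → ∀ θ : ℝ, Complex.polarCoord.symm (r, θ) = circleMap 0 r θ := by
    intro r _ θ
    rw [Complex.polarCoord_symm_apply, circleMap, Complex.exp_mul_I]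
    simp
  have h3 : ∫ p in _root_.polarCoord.target, p.1 • (Metric.ball (0 : ℂ) R).indicator
        (fun z => g (z + c)) (Complex.polarCoord.symm p)
      = ∫ p in Ioo (0 : ℝ) R ×ˢ Ioo (-Real.pi) Real.pi, p.1 * g (circleMap c p.1 p.2) := by
    rw [← MeasureTheory.integral_indicator _root_.polarCoord.open_target.measurableSet,
      ← MeasureTheory.integral_indicator (measurableSet_Ioo.prod measurableSet_Ioo)]
    congr 1; ext ⟨r, θ⟩
    by_cases hr : (r, θ) ∈ Ioo (0 : ℝ) R ×ˢ Ioo (-Real.pi) Real.pi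
    · have hr' := hr
      simp only [mem_prod, mem_Ioo] at hr
      rw [indicator_of_mem hr', indicator_of_mem (by simp [polarCoord, hr]), h2 r hr.1.1.le,
        indicator_of_mem]
      · simp [circleMap, add_comm]
      · simp [abs_of_pos hr.1.1, hr.1.2]
    · rw [indicator_of_notMem hr]
      by_cases ht : (r, θ) ∈ _root_.polarCoord.target
      · rw [indicator_of_mem ht]
        simp only [polarCoord_target, mem_prod, mem_Ioi, mem_Ioo] at ht hr
        rw [h2 r ht.1.le, indicator_of_notMem, smul_zero]
        simp only [mem_ball_zero_iff, norm_circleMap_zero, abs_of_pos ht.1]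
        tauto
      · rw [indicator_of_notMem ht]
  have hcont : Continuous fun p : ℝ × ℝ => p.1 * g (circleMap c p.1 p.2) := by
    unfold circleMap; fun_prop
  rw [h3, Measure.volume_eq_prod, setIntegral_prod, intervalIntegral.integral_of_le hR,
    ← integral_Ioc_eq_integral_Ioo]
  · refine setIntegral_congr_fun measurableSet_Ioc fun r hr => ?_
    simp only
    rw [← integral_Ioc_eq_integral_Ioo, ← intervalIntegral.integral_of_le
      (by linarith [Real.pi_pos]), intervalIntegral.integral_const_mul,
      Real.circleAverage_eq_integral_add (-Real.pi),
      intervalIntegral.integral_comp_add_right (fun θ => g (circleMap c r θ))]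
    have : 2 * Real.pi + -Real.pi = Real.pi := by ring
    rw [zero_add, this, smul_eq_mul]
    field_simp
  · rw [← Measure.volume_eq_prod]
    refine (hcont.continuousOn.integrableOn_compact
      (K := Icc (0 : ℝ) R ×ˢ Icc (-Real.pi) Real.pi) (isCompact_Icc.prod isCompact_Icc)).mono_set ?_
    exact prod_mono Ioo_subset_Icc_self Ioo_subset_Icc_self

theorem log_norm_le_circleAverage {f : ℂ → ℂ} (hf : Differentiable ℂ f) {c : ℂ} (hfc : f c ≠ 0)
    {R : ℝ} (hR : R ≠ 0) :
    Real.log ‖f c‖ ≤ Real.circleAverage (fun z => Real.log ‖f z‖) c R := by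
  have han : AnalyticOnNhd ℂ f (Metric.closedBall c |R|) := fun z _ => hf.analyticAt z
  rw [AnalyticOnNhd.circleAverage_log_norm hR han hfc]
  have h2 : 0 ≤ ∑ᶠ u, (MeromorphicOn.divisor f (Metric.closedBall c |R|) u : ℝ)
      * Real.log (R * ‖c - u‖⁻¹) := by
    refine finsum_nonneg fun u => ?_
    by_cases hu : u ∈ Metric.closedBall c |R|
    · refine mul_nonneg
        (by exact_mod_cast MeromorphicOn.AnalyticOnNhd.divisor_nonneg han u) ?_
      rw [← Real.log_abs, abs_mul, abs_inv, abs_norm]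
      rcases eq_or_ne u c with rfl | hne
      · simp
      · have hpos : 0 < ‖c - u‖ := norm_pos_iff.2 (sub_ne_zero.2 hne.symm)
        refine Real.log_nonneg ?_
        rw [← div_eq_mul_inv, le_div_iff₀ hpos, one_mul, ← dist_eq_norm, dist_comm]
        exact hu
    · simp [hu]
  linarith

theorem posLog_norm_le_circleAverage {f : ℂ → ℂ} (hf : Differentiable ℂ f) (c : ℂ) {R : ℝ}
    (hR : R ≠ 0) : Real.posLog ‖f c‖ ≤ Real.circleAverage (fun z => Real.posLog ‖f z‖) c R := by
  have hcont : Continuous fun z => Real.posLog ‖f z‖ :=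
    Real.continuous_posLog.comp hf.continuous.norm
  have hmer : ∀ U, MeromorphicOn f U := fun U z _ => (hf.analyticAt z).meromorphicAt
  have h0 : 0 ≤ Real.circleAverage (fun z => Real.posLog ‖f z‖) c R :=
    Real.circleAverage_nonneg_of_nonneg fun z _ => Real.posLog_nonneg
  rw [Real.posLog_apply]
  refine max_le h0 ?_
  by_cases hfc : f c = 0
  · simpa [hfc] using h0
  exact (log_norm_le_circleAverage hf hfc hR).trans
    (Real.circleAverage_mono (MeromorphicOn.circleIntegrable_log_norm (hmer _))
      hcont.continuousOn.circleIntegrable' fun z _ => le_max_right _ _)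

theorem circleAverage_posLog_norm_le {f : ℂ → ℂ} (hf : Differentiable ℂ f) {K : ℝ} (hK0 : 0 ≤ K)
    (hK : ∀ z, ‖f z‖ ≤ Real.exp (K * (1 + ‖z‖))) (c : ℂ) {r : ℝ} (hr : 0 ≤ r) :
    Real.circleAverage (fun z => Real.posLog ‖f z‖) c r ≤ K * (1 + ‖c‖ + r) := by
  have hcont : Continuous fun z => Real.posLog ‖f z‖ :=
    Real.continuous_posLog.comp hf.continuous.norm
  refine Real.circleAverage_mono_on_of_le_circle hcont.continuousOn.circleIntegrable'
    fun z hz => ?_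
  have hz' : ‖z‖ ≤ ‖c‖ + r := by
    rw [abs_of_nonneg hr, mem_sphere_iff_norm] at hz
    calc ‖z‖ = ‖c + (z - c)‖ := by congr 1; ring
      _ ≤ _ := by rw [← hz]; exact norm_add_le _ _
  have h1 : Real.posLog ‖f z‖ ≤ Real.posLog (Real.exp (K * (1 + ‖z‖))) :=
    Real.posLog_le_posLog (norm_nonneg _) (hK z)
  rw [Real.posLog_eq_log (x := Real.exp _) (by
    rw [abs_of_pos (Real.exp_pos _)]; exact Real.one_le_exp (by positivity)),
    Real.log_exp] at h1
  refine h1.trans ?_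
  exact mul_le_mul_of_nonneg_left (by linarith) hK0

theorem ExpType.nonneg {f : ℂ → ℂ} (hf : ExpType f) :
    ∃ K : ℝ, 0 ≤ K ∧ ∀ z, ‖f z‖ ≤ Real.exp (K * (1 + ‖z‖)) := by
  obtain ⟨K, hK⟩ := hf
  exact ⟨|K|, abs_nonneg _, fun z => (hK z).trans (by gcongr; exact le_abs_self K)⟩

/-- If the product of two entire functions and one of the factors are of exponential type, then
so is the other factor. -/
theorem ExpType.of_mul {f s : ℂ → ℂ} (hf : Differentiable ℂ f) (hs : Differentiable ℂ s)
    (hse : ExpType s) (hfs : ExpType fun z => f z * s z) {c : ℂ} (hc : s c ≠ 0) : ExpType f := by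
  obtain ⟨K, hK0, hK⟩ := hse.nonneg
  obtain ⟨M, hM0, hM⟩ := hfs.nonneg
  have hcont : Continuous fun z => Real.posLog ‖f z‖ :=
    Real.continuous_posLog.comp hf.continuous.norm
  have hcontS : Continuous fun z => Real.posLog ‖s z‖ :=
    Real.continuous_posLog.comp hs.continuous.norm
  have hcontP : Continuous fun z => Real.posLog ‖f z * s z‖ :=
    Real.continuous_posLog.comp (hf.continuous.mul hs.continuous).norm
  set L : ℝ := |Real.log ‖s c‖| with hL
  have havg : ∀ r : ℝ, 0 < r → Real.circleAverage (fun z => Real.posLog ‖f z‖) c r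
      ≤ (M + K) * (1 + ‖c‖ + r) + L := by
    intro r hr
    have hmer : ∀ U, MeromorphicOn s U := fun U z _ => (hs.analyticAt z).meromorphicAt
    set v : ℂ → ℝ := fun z => Real.posLog ‖f z * s z‖ + Real.posLog ‖s z‖ - Real.log ‖s z‖ with hv
    set u : ℂ → ℝ := fun z => if s z = 0 then Real.posLog ‖f z‖ else v z with hu
    have hloc : CircleIntegrable (fun z => Real.log ‖s z‖) c r :=
      MeromorphicOn.circleIntegrable_log_norm (hmer _)
    have hvi : CircleIntegrable v c r :=
      (hcontP.continuousOn.circleIntegrable'.add hcontS.continuousOn.circleIntegrable').sub hloc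
    have hcod : v =ᶠ[codiscreteWithin (Metric.sphere c |r|)] u := by
      have h1 : {z | s z ≠ 0} ∈ codiscrete ℂ := by
        have h2 := AnalyticOnNhd.preimage_zero_mem_codiscrete (f := s)
          (fun z _ => hs.analyticAt z) hc
        filter_upwards [h2] with z hz
        simpa using hz
      have h3 := codiscreteWithin_mono (subset_univ (Metric.sphere c |r|)) h1
      filter_upwards [h3] with z hz
      simp only [hu]; rw [if_neg hz]
    have hui : CircleIntegrable u c r := hvi.congr_codiscreteWithin hcod
    have h4 : Real.circleAverage (fun z => Real.posLog ‖f z‖) c r ≤ Real.circleAverage u c r := by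
      refine Real.circleAverage_mono hcont.continuousOn.circleIntegrable' hui fun z _ => ?_
      simp only [hu, hv]
      split_ifs with hz
      · exact le_rfl
      · have h5 : Real.posLog ‖f z‖ ≤ Real.posLog ‖f z * s z‖ + Real.posLog ‖s z‖⁻¹ := by
          have : ‖f z‖ = ‖f z * s z‖ * ‖s z‖⁻¹ := by
            rw [norm_mul]; field_simp [norm_ne_zero_iff.2 hz]
          conv_lhs => rw [this]
          exact Real.posLog_mul
        have h6 := Real.posLog_sub_posLog_inv (x := ‖s z‖)
        linarith
    rw [← Real.circleAverage_congr_codiscreteWithin hcod hr.ne'] at h4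
    refine h4.trans ?_
    rw [hv, Real.circleAverage_fun_sub (f₁ := fun z => Real.posLog ‖f z * s z‖ + Real.posLog ‖s z‖)
      (hcontP.continuousOn.circleIntegrable'.add hcontS.continuousOn.circleIntegrable') hloc,
      Real.circleAverage_fun_add hcontP.continuousOn.circleIntegrable'
        hcontS.continuousOn.circleIntegrable']
    have h7 := circleAverage_posLog_norm_le (hf.mul hs) hM0 hM c hr.le
    have h8 := circleAverage_posLog_norm_le hs hK0 hK c hr.le
    have h9 := log_norm_le_circleAverage hs hc hr.ne'
    have h10 := neg_abs_le (Real.log ‖s c‖)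
    simp only [Pi.mul_apply] at h7
    have h7' : Real.circleAverage (fun z => Real.posLog ‖f z * s z‖) c r ≤ M * (1 + ‖c‖ + r) := h7
    nlinarith
  -- compare disks centred at `z` and at `c`
  have hpt : ∀ z, Real.posLog ‖f z‖ ≤ 4 * ((M + K) * (1 + ‖c‖ + (2 * (‖z - c‖ + 1))) + L) := by
    intro z
    set R : ℝ := ‖z - c‖ + 1 with hRdef
    have hR : 0 < R := by positivity
    have hsub : Metric.ball z R ⊆ Metric.ball c (2 * R) := by
      refine Metric.ball_subset_ball' ?_
      rw [dist_eq_norm]; linarith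
    have hInt : IntegrableOn (fun w => Real.posLog ‖f w‖) (Metric.ball c (2 * R)) :=
      (hcont.continuousOn.integrableOn_compact (isCompact_closedBall c (2 * R))).mono_set
        Metric.ball_subset_closedBall
    have h1 : ∫ w in Metric.ball z R, Real.posLog ‖f w‖
        ≤ ∫ w in Metric.ball c (2 * R), Real.posLog ‖f w‖ :=
      setIntegral_mono_set hInt (Eventually.of_forall fun _ => Real.posLog_nonneg)
        hsub.eventuallyLE
    rw [setIntegral_ball_eq_integral_circleAverage hcont _ hR.le,
      setIntegral_ball_eq_integral_circleAverage hcont _ (by positivity)] at h1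
    have hca : ∀ c', Continuous fun r : ℝ => 2 * Real.pi * r *
        Real.circleAverage (fun w => Real.posLog ‖f w‖) c' r := fun c' =>
      (continuous_const.mul continuous_id).mul (Real.Continuous.circleAverage hcont)
    have h2 : ∫ r in 0..R, 2 * Real.pi * r * Real.posLog ‖f z‖ ≤
        ∫ r in 0..R, 2 * Real.pi * r *
          Real.circleAverage (fun w => Real.posLog ‖f w‖) z r := by
      refine intervalIntegral.integral_mono_on hR.le
        (Continuous.intervalIntegrable (by fun_prop) _ _) ((hca z).intervalIntegrable _ _)
        fun r hr => ?_
      rcases hr.1.eq_or_lt with h0 | h0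
      · simp [← h0]
      · exact mul_le_mul_of_nonneg_left (posLog_norm_le_circleAverage hf z h0.ne')
          (by have := Real.pi_pos; positivity)
    have h3 : ∫ r in 0..2 * R, 2 * Real.pi * r *
          Real.circleAverage (fun w => Real.posLog ‖f w‖) c r ≤
        ∫ r in 0..2 * R, 2 * Real.pi * r * ((M + K) * (1 + ‖c‖ + 2 * R) + L) := by
      refine intervalIntegral.integral_mono_on (by positivity) ((hca c).intervalIntegrable _ _)
        (Continuous.intervalIntegrable (by fun_prop) _ _) fun r hr => ?_
      rcases hr.1.eq_or_lt with h0 | h0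
      · simp [← h0]
      · refine mul_le_mul_of_nonneg_left ((havg r h0).trans ?_)
          (by have := Real.pi_pos; positivity)
        have := hr.2
        gcongr
    have e1 : ∀ A B : ℝ, ∫ r in 0..A, 2 * Real.pi * r * B = Real.pi * A ^ 2 * B := by
      intro A B
      rw [intervalIntegral.integral_mul_const, intervalIntegral.integral_const_mul, integral_id]
      ring
    rw [e1] at h2 h3
    have h4 := h2.trans (h1.trans h3)
    have hp : 0 < Real.pi * R ^ 2 := by have := Real.pi_pos; positivity
    refine le_of_mul_le_mul_left ?_ hp
    calc _ ≤ _ := h4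
      _ = _ := by ring
  refine ⟨4 * ((M + K) * (3 + 3 * ‖c‖) + L), fun z => ?_⟩
  have h1 : ‖f z‖ ≤ Real.exp (Real.posLog ‖f z‖) := by
    rcases eq_or_ne (f z) 0 with h0 | h0
    · simp [h0]
    · calc ‖f z‖ = Real.exp (Real.log ‖f z‖) := (Real.exp_log (norm_pos_iff.2 h0)).symm
        _ ≤ _ := Real.exp_le_exp.2 (le_max_right _ _)
  refine h1.trans (Real.exp_le_exp.2 ((hpt z).trans ?_))
  have h2 : ‖z - c‖ ≤ ‖z‖ + ‖c‖ := norm_sub_le _ _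
  have h3 : 0 ≤ ‖z‖ := norm_nonneg _
  have h4 : 0 ≤ ‖c‖ := norm_nonneg _
  have h5 : 0 ≤ L := abs_nonneg _
  have h6 : (1 + ‖c‖ + 2 * (‖z - c‖ + 1)) ≤ (3 + 3 * ‖c‖) * (1 + ‖z‖) := by nlinarith
  have h7 : 0 ≤ M + K := by positivity
  nlinarith [mul_le_mul_of_nonneg_left h6 h7, mul_nonneg h5 h3]
end

section

theorem exists_bound_on_ray {f : ℂ → ℂ} (hf : Continuous f) (e : ℂ)
    (h : ∃ K, ∀ᶠ τ : ℝ in atTop, ‖f (τ * e)‖ ≤ K) : ∃ K, ∀ τ : ℝ, 0 ≤ τ → ‖f (τ * e)‖ ≤ K := by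
  obtain ⟨K, hK⟩ := h
  obtain ⟨τ₀, hτ₀⟩ := eventually_atTop.1 hK
  obtain ⟨M, hM⟩ := isCompact_Icc.exists_bound_of_continuousOn (s := Icc (0 : ℝ) τ₀)
    (f := fun τ : ℝ => f (τ * e)) (by fun_prop)
  refine ⟨max K M, fun τ hτ => ?_⟩
  rcases le_total τ₀ τ with h1 | h1
  · exact (hτ₀ τ h1).trans (le_max_left _ _)
  · exact (hM τ ⟨hτ, h1⟩).trans (le_max_right _ _)

/-- An entire function of exponential type that is bounded on every nonreal ray is constant. -/
theorem ExpType.eq_of_bounded_on_rays {f : ℂ → ℂ} (hf : Differentiable ℂ f) (he : ExpType f)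
    (h : ∀ e : ℂ, e.im ≠ 0 → ∃ K, ∀ᶠ τ : ℝ in atTop, ‖f (τ * e)‖ ≤ K) (z w : ℂ) : f z = f w := by
  have hray : ∀ e : ℂ, e.im ≠ 0 → ∃ K, ∀ τ : ℝ, 0 ≤ τ → ‖f (τ * e)‖ ≤ K := fun e hi =>
    exists_bound_on_ray hf.continuous e (h e hi)
  obtain ⟨K₁, h1⟩ := hray (1 + I) (by simp)
  obtain ⟨K₂, h2⟩ := hray (-1 + I) (by simp)
  obtain ⟨K₃, h3⟩ := hray (-1 - I) (by simp)
  obtain ⟨K₄, h4⟩ := hray (1 - I) (by simp)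
  set C : ℝ := max (max K₁ K₂) (max K₃ K₄) with hC
  set g : ℂ → ℂ := fun z => f ((1 + I) * z) with hg
  have hgd : Differentiable ℂ g := hf.comp (differentiable_id.const_mul _)
  have re_pos : ∀ x : ℝ, 0 ≤ x → ‖g x‖ ≤ C := fun x hx => by
    have := h1 x hx
    rw [mul_comm] at this
    exact this.trans ((le_max_left _ _).trans (le_max_left _ _))
  have re_neg : ∀ x : ℝ, x ≤ 0 → ‖g x‖ ≤ C := fun x hx => by
    have := h3 (-x) (by linarith)
    have e : ((-x : ℝ) : ℂ) * (-1 - I) = (1 + I) * x := by push_cast; ring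
    rw [e] at this
    exact this.trans ((le_max_left _ _).trans (le_max_right _ _))
  have im_pos : ∀ x : ℝ, 0 ≤ x → ‖g (x * I)‖ ≤ C := fun x hx => by
    have := h2 x hx
    have e : (x : ℂ) * (-1 + I) = (1 + I) * (x * I) := by linear_combination (-x : ℂ) * I_mul_I
    rw [e] at this
    exact this.trans ((le_max_right _ _).trans (le_max_left _ _))
  have im_neg : ∀ x : ℝ, x ≤ 0 → ‖g (x * I)‖ ≤ C := fun x hx => by
    have := h4 (-x) (by linarith)
    have e : ((-x : ℝ) : ℂ) * (1 - I) = (1 + I) * (x * I) := by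
      push_cast; linear_combination (-x : ℂ) * I_mul_I
    rw [e] at this
    exact this.trans ((le_max_right _ _).trans (le_max_right _ _))
  obtain ⟨K, hK0, hK⟩ := he.nonneg
  have hB : ∀ U : Set ℂ, ∃ c < (2 : ℝ), ∃ B, g =O[Bornology.cobounded ℂ ⊓ 𝓟 U]
      fun z => Real.exp (B * ‖z‖ ^ c) := by
    intro U
    refine ⟨1, by norm_num, K * ‖(1 + I : ℂ)‖, ?_⟩
    refine Asymptotics.IsBigO.of_bound (Real.exp K) (Eventually.of_forall fun z => ?_)
    rw [Real.norm_of_nonneg (Real.exp_pos _).le, ← Real.exp_add]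
    refine (hK _).trans (Real.exp_le_exp.2 ?_)
    rw [norm_mul, Real.rpow_one]
    exact le_of_eq (by ring)
  have hdc : ∀ U : Set ℂ, DiffContOnCl ℂ g U := fun U => hgd.diffContOnCl
  have hbd : ∀ z, ‖g z‖ ≤ C := by
    intro z
    rcases le_total 0 z.re with hr | hr <;> rcases le_total 0 z.im with hi | hi
    · exact PhragmenLindelof.quadrant_I (hdc _) (hB _) re_pos im_pos hr hi
    · exact PhragmenLindelof.quadrant_IV (hdc _) (hB _) re_pos im_neg hr hi
    · exact PhragmenLindelof.quadrant_II (hdc _) (hB _) re_neg im_pos hr hi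
    · exact PhragmenLindelof.quadrant_III (hdc _) (hB _) re_neg im_neg hr hi
  have hne : (1 + I : ℂ) ≠ 0 := fun h0 => by simpa using congrArg Complex.im h0
  have hconst : ∀ z w, g z = g w := fun z w =>
    hgd.apply_eq_apply_of_bounded (isBounded_iff_forall_norm_le.2
      ⟨C, by rintro _ ⟨u, rfl⟩; exact hbd u⟩) z w
  have := hconst (z / (1 + I)) (w / (1 + I))
  simpa only [hg, mul_div_cancel₀ _ hne] using this

/-- An entire function of exponential type tending to zero along every nonreal ray vanishes. -/
theorem ExpType.eq_zero_of_tendsto_on_rays {f : ℂ → ℂ} (hf : Differentiable ℂ f) (he : ExpType f)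
    (h : ∀ e : ℂ, e.im ≠ 0 → Tendsto (fun τ : ℝ => f (τ * e)) atTop (𝓝 0)) (z : ℂ) : f z = 0 := by
  have hb := he.eq_of_bounded_on_rays hf (fun e hi => ⟨1, by
    filter_upwards [(h e hi).norm.eventually_le_const (by simp : ‖(0 : ℂ)‖ < 1)] with τ hτ
    exact hτ⟩)
  refine tendsto_nhds_unique (f := fun τ : ℝ => f (τ * I)) (l := atTop) ?_ (h I (by simp))
  exact tendsto_const_nhds.congr fun τ => hb z _

/-- Division of entire functions. -/
theorem exists_entire_mul_eq {f s : ℂ → ℂ} (hf : Differentiable ℂ f) (hs : Differentiable ℂ s)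
    {c : ℂ} (hc : s c ≠ 0) (h : ∀ z, analyticOrderAt s z ≤ analyticOrderAt f z) :
    ∃ g : ℂ → ℂ, Differentiable ℂ g ∧ ∀ z, g z * s z = f z := by
  have htop : ∀ z, analyticOrderAt s z ≠ ⊤ := by
    intro z hz
    have h1 : ∀ᶠ w in 𝓝 z, s w = 0 := analyticOrderAt_eq_top.1 hz
    have h2 : AnalyticOnNhd ℂ s univ := fun w _ => hs.analyticAt w
    exact hc (h2.eqOn_zero_of_preconnected_of_eventuallyEq_zero isPreconnected_univ
      (mem_univ z) h1 (mem_univ c))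
  have hmer : MeromorphicOn (fun z => f z / s z) univ := fun z _ =>
    (hf.analyticAt z).meromorphicAt.div (hs.analyticAt z).meromorphicAt
  set g := toMeromorphicNFOn (fun z => f z / s z) univ with hg
  have hne : ∀ z, ∀ᶠ w in 𝓝[≠] z, s w ≠ 0 := fun z => by
    rcases (hs.analyticAt z).eventually_eq_zero_or_eventually_ne_zero with h0 | h0
    · exact absurd (analyticOrderAt_eq_top.2 h0) (htop z)
    · exact h0
  have hgan : ∀ z, AnalyticAt ℂ g z := by
    intro z
    have hnf := meromorphicNFOn_toMeromorphicNFOn (fun z => f z / s z) univ (mem_univ z)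
    refine hnf.meromorphicOrderAt_nonneg_iff_analyticAt.1 ?_
    obtain ⟨n, hn⟩ := ENat.ne_top_iff_exists.1 (htop z)
    obtain ⟨k, hk, hk0, hke⟩ := ((hs.analyticAt z).analyticOrderAt_eq_natCast (n := n)).1 hn.symm
    obtain ⟨l, hl, hle⟩ := (natCast_le_analyticOrderAt (hf.analyticAt z) (n := n)).1
      (hn.le.trans (h z))
    have hcongr : g =ᶠ[𝓝[≠] z] fun w => l w / k w := by
      filter_upwards [hmer.toMeromorphicNFOn_eq_self_on_nhdsNE (mem_univ z),
        nhdsWithin_le_nhds hke, nhdsWithin_le_nhds hle, self_mem_nhdsWithin] with w h1 h2 h3 h4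
      rw [hg, h1, h2, h3, smul_eq_mul, smul_eq_mul,
        mul_div_mul_left _ _ (pow_ne_zero _ (sub_ne_zero.2 h4))]
    rw [meromorphicOrderAt_congr hcongr]
    exact (hl.div hk hk0).meromorphicOrderAt_nonneg
  refine ⟨g, fun z => (hgan z).differentiableAt, fun z => ?_⟩
  have hev : (fun w => g w * s w) =ᶠ[𝓝[≠] z] f := by
    filter_upwards [hmer.toMeromorphicNFOn_eq_self_on_nhdsNE (mem_univ z), hne z] with w h1 h2
    rw [hg, h1, div_mul_cancel₀ _ h2]
  exact tendsto_nhds_unique_of_eventuallyEq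
    (((hgan z).continuousAt.mul hs.continuous.continuousAt).tendsto.mono_left nhdsWithin_le_nhds)
    (hf.continuous.continuousAt.tendsto.mono_left nhdsWithin_le_nhds) hev
end

section

theorem ExpType.add {f g : ℂ → ℂ} (hf : ExpType f) (hg : ExpType g) :
    ExpType fun z => f z + g z := by
  obtain ⟨K, hK0, hK⟩ := hf.nonneg
  obtain ⟨M, hM0, hM⟩ := hg.nonneg
  refine ⟨K + M + 1, fun z => ?_⟩
  have hz : 0 ≤ ‖z‖ := norm_nonneg z
  have h1 : Real.exp (K * (1 + ‖z‖)) ≤ Real.exp ((K + M) * (1 + ‖z‖)) :=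
    Real.exp_le_exp.2 (by nlinarith)
  have h2 : Real.exp (M * (1 + ‖z‖)) ≤ Real.exp ((K + M) * (1 + ‖z‖)) :=
    Real.exp_le_exp.2 (by nlinarith)
  have h3 : 2 ≤ Real.exp (1 + ‖z‖) := by linarith [Real.add_one_le_exp (1 + ‖z‖)]
  calc ‖f z + g z‖ ≤ ‖f z‖ + ‖g z‖ := norm_add_le _ _
    _ ≤ 2 * Real.exp ((K + M) * (1 + ‖z‖)) := by linarith [hK z, hM z]
    _ ≤ Real.exp (1 + ‖z‖) * Real.exp ((K + M) * (1 + ‖z‖)) := by gcongr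
    _ = _ := by rw [← Real.exp_add]; ring_nf

theorem ExpType.mul {f g : ℂ → ℂ} (hf : ExpType f) (hg : ExpType g) :
    ExpType fun z => f z * g z := by
  obtain ⟨K, hK⟩ := hf
  obtain ⟨M, hM⟩ := hg
  refine ⟨K + M, fun z => ?_⟩
  rw [norm_mul, add_mul, Real.exp_add]
  exact mul_le_mul (hK z) (hM z) (norm_nonneg _) (Real.exp_pos _).le

theorem ExpType.const (k : ℂ) : ExpType fun _ => k := by
  refine ⟨‖k‖, fun z => ?_⟩
  have h1 := Real.add_one_le_exp (‖k‖ * (1 + ‖z‖))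
  nlinarith [norm_nonneg k, norm_nonneg z, mul_nonneg (norm_nonneg k) (norm_nonneg z)]

theorem ExpType.sub {f g : ℂ → ℂ} (hf : ExpType f) (hg : ExpType g) :
    ExpType fun z => f z - g z := by
  simpa [sub_eq_add_neg] using hf.add ((ExpType.const (-1)).mul hg)

/-! ### Solutions of the pencil equation on a closed interval -/

/-- `y`, with derivative `y'`, solves the pencil equation on the closed interval `[c, d]`. -/
structure IsSol (p q : ℝ → ℂ) (ρ : ℂ) (y y' : ℝ → ℂ) (c d : ℝ) : Prop where
  prim : IsPrimitiveOn y y' c d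
  prim' : IsPrimitiveOn y' (fun t => -((ρ ^ 2 + ρ * p t + q t) * y t)) c d

/-- The continuous extension of a function on `(c, d)` by its limits `l` and `r`. -/
def extendByLimits (f : ℝ → ℂ) (l r : ℂ) (c d : ℝ) (x : ℝ) : ℂ :=
  if x ≤ c then l else if d ≤ x then r else f x

theorem extendByLimits_of_mem_Ioo {f : ℝ → ℂ} {l r : ℂ} {c d x : ℝ} (hx : x ∈ Ioo c d) :
    extendByLimits f l r c d x = f x := by
  simp [extendByLimits, not_le.2 hx.1, not_le.2 hx.2]

theorem extendByLimits_left {f : ℝ → ℂ} {l r : ℂ} {c d : ℝ} :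
    extendByLimits f l r c d c = l := by
  simp [extendByLimits]

theorem extendByLimits_right {f : ℝ → ℂ} {l r : ℂ} {c d : ℝ} (hcd : c < d) :
    extendByLimits f l r c d d = r := by
  simp [extendByLimits, not_le.2 hcd]

theorem continuousOn_extendByLimits {f : ℝ → ℂ} {l r : ℂ} {c d : ℝ} (hcd : c < d)
    (hf : ContinuousOn f (Ioo c d)) (hl : Tendsto f (𝓝[>] c) (𝓝 l))
    (hr : Tendsto f (𝓝[<] d) (𝓝 r)) : ContinuousOn (extendByLimits f l r c d) (Icc c d) := by
  refine (continuousOn_Icc_extendFrom_Ioo hf hl hr).congr fun x hx => ?_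
  rcases hx.1.eq_or_lt with rfl | h1
  · rw [extendByLimits_left, eq_lim_at_left_extendFrom_Ioo hcd hl]
  rcases hx.2.eq_or_lt with rfl | h2
  · rw [extendByLimits_right hcd, eq_lim_at_right_extendFrom_Ioo hcd hr]
  · rw [extendByLimits_of_mem_Ioo ⟨h1, h2⟩]
    exact (extendFrom_extends hf x ⟨h1, h2⟩).symm

theorem PencilSolOn.isSol {p q : ℝ → ℂ} {ρ : ℂ} {y y' : ℝ → ℂ} {c d : ℝ} {l l' r r' : ℂ}
    (hcd : c < d) (h : PencilSolOn p q ρ y y' c d) (hp : ContinuousOn p (Icc c d))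
    (hq : IntervalIntegrable q volume c d)
    (hl : Tendsto y (𝓝[>] c) (𝓝 l)) (hl' : Tendsto y' (𝓝[>] c) (𝓝 l'))
    (hr : Tendsto y (𝓝[<] d) (𝓝 r)) (hr' : Tendsto y' (𝓝[<] d) (𝓝 r')) :
    IsSol p q ρ (extendByLimits y l r c d) (extendByLimits y' l' r' c d) c d := by
  have hyc : ContinuousOn (extendByLimits y l r c d) (Icc c d) :=
    continuousOn_extendByLimits hcd (fun x hx => (h.1 x hx).continuousAt.continuousWithinAt) hl hr
  have hInt : ∀ {g : ℝ → ℂ}, ContinuousOn g (Icc c d) → IntervalIntegrable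
      (fun t => -((ρ ^ 2 + ρ * p t + q t) * g t)) volume c d := fun {g} hg => by
    rw [← uIcc_of_le hcd.le] at hg hp
    exact ((((continuousOn_const.add (continuousOn_const.mul hp)).intervalIntegrable).add
      hq).mul_continuousOn hg).neg
  have hF := hInt hyc
  set F : ℝ → ℂ := fun t => -((ρ ^ 2 + ρ * p t + q t) * extendByLimits y l r c d t) with hFdef
  have hFp : IsPrimitiveOn (fun x => ∫ t in c..x, F t) F c d := IsPrimitiveOn.integral_self hF
  have hdiff : ∀ u ∈ Ioo c d, ∀ v ∈ Ioo c d, y' v - y' u = ∫ t in u..v, F t := by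
    intro u hu v hv
    rw [h.2 u hu v hv]
    refine intervalIntegral.integral_congr fun t ht => ?_
    have : t ∈ Ioo c d := (ordConnected_Ioo.uIcc_subset hu hv) ht
    simp only [hFdef, extendByLimits_of_mem_Ioo this]
  have hy'c : ContinuousOn (extendByLimits y' l' r' c d) (Icc c d) := by
    refine continuousOn_extendByLimits hcd ?_ hl' hr'
    obtain ⟨m, hm⟩ := nonempty_Ioo.2 hcd
    have h1 : ContinuousOn (fun x => y' m - (∫ t in c..m, F t) + ∫ t in c..x, F t) (Ioo c d) :=
      continuousOn_const.add (hFp.continuousOn.mono Ioo_subset_Icc_self)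
    refine h1.congr fun x hx => ?_
    have h2 := hdiff m hm x hx
    have h3 := hFp.sub_eq_integral (Ioo_subset_Icc_self hm) (Ioo_subset_Icc_self hx)
    linear_combination h2 - h3
  refine ⟨⟨?_, fun x hx => ?_⟩, ⟨hF, ?_⟩⟩
  · exact ContinuousOn.intervalIntegrable_of_Icc hcd.le hy'c
  · have h1 := intervalIntegral.integral_eq_sub_of_hasDerivAt_of_le
      (f := extendByLimits y l r c d) (f' := extendByLimits y' l' r' c d) hx.1
      (hyc.mono (Icc_subset_Icc_right hx.2)) (fun t ht => ?_)
      (ContinuousOn.intervalIntegrable_of_Icc hx.1 (hy'c.mono (Icc_subset_Icc_right hx.2)))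
    · rw [h1]; ring
    · have ht' : t ∈ Ioo c d := ⟨ht.1, ht.2.trans_le hx.2⟩
      rw [extendByLimits_of_mem_Ioo ht']
      refine (h.1 t ht').congr_of_eventuallyEq ?_
      filter_upwards [Ioo_mem_nhds ht'.1 ht'.2] with s hs
      exact extendByLimits_of_mem_Ioo hs
  · obtain ⟨m, hm⟩ := nonempty_Ioo.2 hcd
    have h1 : EqOn (fun x => extendByLimits y' l' r' c d x - ∫ t in c..x, F t)
        (fun _ => y' m - ∫ t in c..m, F t) (Ioo c d) := fun x hx => by
      have h2 := hdiff m hm x hx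
      have h3 := hFp.sub_eq_integral (Ioo_subset_Icc_self hm) (Ioo_subset_Icc_self hx)
      simp only [extendByLimits_of_mem_Ioo hx]
      linear_combination h2 - h3
    have h4 := h1.of_subset_closure (hy'c.sub hFp.continuousOn) continuousOn_const
      Ioo_subset_Icc_self (by rw [closure_Ioo hcd.ne])
    intro x hx
    have h5 := h4 hx
    have h6 := h4 (left_mem_Icc.2 hcd.le)
    simp only [integral_same, sub_zero] at h5 h6
    rw [h6, ← h5]; ring

namespace IsSol

variable {p q : ℝ → ℂ} {ρ : ℂ} {y y' z z' : ℝ → ℂ} {c d : ℝ}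

theorem add (h : IsSol p q ρ y y' c d) (hz : IsSol p q ρ z z' c d) :
    IsSol p q ρ (fun x => y x + z x) (fun x => y' x + z' x) c d :=
  ⟨h.prim.add hz.prim, (h.prim'.add hz.prim').congr_deriv fun x => by ring⟩

theorem const_mul (h : IsSol p q ρ y y' c d) (k : ℂ) :
    IsSol p q ρ (fun x => k * y x) (fun x => k * y' x) c d :=
  ⟨h.prim.const_mul k, (h.prim'.const_mul k).congr_deriv fun x => by ring⟩

/-- The derivative of the Wronskian of solutions of two pencil equations. -/
theorem wronskian_prim {pt qt : ℝ → ℂ} {σ : ℂ} (h : IsSol p q ρ y y' c d)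
    (hz : IsSol pt qt σ z z' c d) (hcd : c ≤ d) :
    IsPrimitiveOn (fun x => y x * z' x - y' x * z x)
      (fun x => ((ρ ^ 2 + ρ * p x + q x) - (σ ^ 2 + σ * pt x + qt x)) * (y x * z x)) c d := by
  have h1 := (h.prim.mul hz.prim' hcd).add ((h.prim'.mul hz.prim hcd).const_mul (-1))
  refine ⟨?_, ?_⟩
  · convert h1.integrable using 2; ring
  · intro x hx
    have h2 := h1.eq_add_integral x hx
    rw [intervalIntegral.integral_congr (g := fun x =>
      ((ρ ^ 2 + ρ * p x + q x) - (σ ^ 2 + σ * pt x + qt x)) * (y x * z x))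
      (fun t _ => by simp only; ring)] at h2
    linear_combination h2

theorem wronskian_eq (h : IsSol p q ρ y y' c d) (hz : IsSol p q ρ z z' c d) {x : ℝ}
    (hx : x ∈ Icc c d) : y x * z' x - y' x * z x = y c * z' c - y' c * z c := by
  have h1 := (h.wronskian_prim hz (hx.1.trans hx.2)).eq_add_integral x hx
  simpa using h1

theorem norm_le (h : IsSol p q ρ y y' c d) (hp : IntervalIntegrable p volume c d)
    (hq : IntervalIntegrable q volume c d) {x : ℝ} (hx : x ∈ Icc c d) :
    (1 + ‖ρ‖) * ‖y x‖ + ‖y' x‖ ≤ ((1 + ‖ρ‖) * ‖y c‖ + ‖y' c‖) *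
      Real.exp (∫ t in c..x, ((1 + ‖ρ‖) + ‖p t‖ + ‖q t‖)) := by
  have hcd : c ≤ d := hx.1.trans hx.2
  have hk : IntervalIntegrable (fun t => (1 + ‖ρ‖) + ‖p t‖ + ‖q t‖) volume c d :=
    (intervalIntegrable_const.add hp.norm).add hq.norm
  have hu : ContinuousOn (fun x => (1 + ‖ρ‖) * ‖y x‖ + ‖y' x‖) (Icc c d) :=
    (continuousOn_const.mul h.prim.continuousOn.norm).add h.prim'.continuousOn.norm
  refine gronwall_of_integrable hcd hu hk (fun t => by positivity) (fun x hx => ?_) x hx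
  have hc : c ∈ Icc c d := left_mem_Icc.2 hcd
  have hy := h.prim.eq_add_integral x hx
  have hy' := h.prim'.eq_add_integral x hx
  have i1 := (h.prim.integrable_sub hc hx).norm
  have i2 := (h.prim'.integrable_sub hc hx).norm
  have b1 : ‖y x‖ ≤ ‖y c‖ + ∫ t in c..x, ‖y' t‖ := by
    rw [hy]
    exact (norm_add_le _ _).trans (by
      gcongr; exact intervalIntegral.norm_integral_le_integral_norm hx.1)
  have b2 : ‖y' x‖ ≤ ‖y' c‖ + ∫ t in c..x, ‖-((ρ ^ 2 + ρ * p t + q t) * y t)‖ := by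
    rw [hy']
    exact (norm_add_le _ _).trans (by
      gcongr; exact intervalIntegral.norm_integral_le_integral_norm hx.1)
  have hu' : ContinuousOn (fun x => (1 + ‖ρ‖) * ‖y x‖ + ‖y' x‖) (uIcc c x) := by
    rw [uIcc_of_le hx.1]; exact hu.mono (Icc_subset_Icc_right hx.2)
  have hk' : IntervalIntegrable (fun t => (1 + ‖ρ‖) + ‖p t‖ + ‖q t‖) volume c x :=
    hk.mono_set (by rw [uIcc_of_le hx.1, uIcc_of_le hcd]; exact Icc_subset_Icc_right hx.2)
  have b3 : (∫ t in c..x, (1 + ‖ρ‖) * ‖y' t‖) +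
      (∫ t in c..x, ‖-((ρ ^ 2 + ρ * p t + q t) * y t)‖) ≤
      ∫ t in c..x, ((1 + ‖ρ‖) + ‖p t‖ + ‖q t‖) * ((1 + ‖ρ‖) * ‖y t‖ + ‖y' t‖) := by
    rw [← intervalIntegral.integral_add (i1.const_mul _) i2]
    refine intervalIntegral.integral_mono_on hx.1 ((i1.const_mul _).add i2)
      (hk'.mul_continuousOn hu') fun t _ => ?_
    have e1 : ‖-((ρ ^ 2 + ρ * p t + q t) * y t)‖ ≤
        (‖ρ‖ ^ 2 + ‖ρ‖ * ‖p t‖ + ‖q t‖) * ‖y t‖ := by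
      rw [norm_neg, norm_mul]
      gcongr
      refine (norm_add_le _ _).trans ?_
      gcongr
      refine (norm_add_le _ _).trans ?_
      rw [norm_pow, norm_mul]
    have r0 := norm_nonneg ρ
    have p0 := norm_nonneg (p t)
    have q0 := norm_nonneg (q t)
    have y0 := norm_nonneg (y t)
    have z0 := norm_nonneg (y' t)
    have e2 : (‖ρ‖ ^ 2 + ‖ρ‖ * ‖p t‖ + ‖q t‖) * ‖y t‖ ≤
        ((1 + ‖ρ‖) + ‖p t‖ + ‖q t‖) * ((1 + ‖ρ‖) * ‖y t‖) := by
      rw [← mul_assoc]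
      gcongr
      nlinarith [mul_nonneg r0 q0, mul_nonneg r0 p0]
    nlinarith [mul_nonneg p0 z0, mul_nonneg q0 z0]
  rw [intervalIntegral.integral_const_mul] at b3
  have r0 : 0 ≤ 1 + ‖ρ‖ := by positivity
  nlinarith [mul_le_mul_of_nonneg_left b1 r0]

end IsSol
end

section

namespace IsSol

variable {p q : ℝ → ℂ} {c d : ℝ}

/-- A family of solutions is locally bounded in the spectral parameter, uniformly in `x`. -/
theorem exists_eventually_norm_le {y y' : ℂ → ℝ → ℂ} {ρ₀ : ℂ}
    (h : ∀ ρ, IsSol p q ρ (y ρ) (y' ρ) c d) (hp : IntervalIntegrable p volume c d)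
    (hq : IntervalIntegrable q volume c d) (hc : ContinuousAt (fun ρ => y ρ c) ρ₀)
    (hc' : ContinuousAt (fun ρ => y' ρ c) ρ₀) :
    ∃ K, ∀ᶠ ρ in 𝓝 ρ₀, ∀ x ∈ Icc c d, ‖y ρ x‖ ≤ K := by
  set A : ℂ → ℝ := fun ρ => ((1 + ‖ρ‖) * ‖y ρ c‖ + ‖y' ρ c‖) *
      Real.exp (∫ t in c..d, ((1 + ‖ρ‖) + ‖p t‖ + ‖q t‖)) with hA
  have hInt : ∀ ρ : ℂ, ∫ t in c..d, ((1 + ‖ρ‖) + ‖p t‖ + ‖q t‖) =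
      (d - c) * (1 + ‖ρ‖) + ∫ t in c..d, (‖p t‖ + ‖q t‖) := fun ρ => by
    simp only [add_assoc (1 + ‖ρ‖)]
    rw [intervalIntegral.integral_add intervalIntegrable_const (hp.norm.add hq.norm)]
    simp only [intervalIntegral.integral_const, smul_eq_mul]
  have hAc : ContinuousAt A ρ₀ := by
    simp only [hA, hInt]
    fun_prop
  refine ⟨A ρ₀ + 1, ?_⟩
  filter_upwards [hAc.eventually_lt continuousAt_const (show A ρ₀ < A ρ₀ + 1 by linarith)]
    with ρ hρ x hx
  have hk : IntervalIntegrable (fun t => (1 + ‖ρ‖) + ‖p t‖ + ‖q t‖) volume c d :=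
    (intervalIntegrable_const.add hp.norm).add hq.norm
  have h1 := (h ρ).norm_le hp hq hx
  have h2 : ∫ t in c..x, ((1 + ‖ρ‖) + ‖p t‖ + ‖q t‖) ≤
      ∫ t in c..d, ((1 + ‖ρ‖) + ‖p t‖ + ‖q t‖) :=
    intervalIntegral.integral_mono_interval le_rfl hx.1 hx.2
      (Eventually.of_forall fun t => by positivity) hk
  have h3 : ((1 + ‖ρ‖) * ‖y ρ c‖ + ‖y' ρ c‖) *
      Real.exp (∫ t in c..x, ((1 + ‖ρ‖) + ‖p t‖ + ‖q t‖)) ≤ A ρ := by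
    simp only [hA]; gcongr
  have := norm_nonneg (y' ρ x)
  nlinarith [mul_nonneg (norm_nonneg ρ) (norm_nonneg (y ρ x))]

/-- A family of solutions depends analytically on the spectral parameter as soon as its initial
values do. -/
theorem differentiableAt_param {y y' : ℂ → ℝ → ℂ} {u u' v v' : ℝ → ℂ} {ρ₀ : ℂ}
    (h : ∀ ρ, IsSol p q ρ (y ρ) (y' ρ) c d) (hu : IsSol p q ρ₀ u u' c d)
    (hv : IsSol p q ρ₀ v v' c d) (huv : u c * v' c - u' c * v c = 1)
    (hp : ContinuousOn p (Icc c d)) (hq : IntervalIntegrable q volume c d)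
    (hc : DifferentiableAt ℂ (fun ρ => y ρ c) ρ₀)
    (hc' : DifferentiableAt ℂ (fun ρ => y' ρ c) ρ₀) {x : ℝ} (hx : x ∈ Icc c d) :
    DifferentiableAt ℂ (fun ρ => y ρ x) ρ₀ ∧ DifferentiableAt ℂ (fun ρ => y' ρ x) ρ₀ := by
  have hcd : c ≤ d := hx.1.trans hx.2
  have hpi : IntervalIntegrable p volume c d := hp.intervalIntegrable_of_Icc hcd
  obtain ⟨K, hK⟩ := exists_eventually_norm_le h hpi hq hc.continuousAt hc'.continuousAt
  obtain ⟨M, hM⟩ := isCompact_Icc.exists_bound_of_continuousOn hp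
  let W : (ℝ → ℂ) → (ℝ → ℂ) → ℂ → ℝ → ℂ := fun z z' ρ x => z x * y' ρ x - z' x * y ρ x
  let J : (ℝ → ℂ) → ℂ → ℝ → ℂ := fun z ρ x => ∫ t in c..x, (ρ + ρ₀ + p t) * (z t * y ρ t)
  have hWJ : ∀ z z', IsSol p q ρ₀ z z' c d → ∀ ρ, ∀ t ∈ Icc c d,
      W z z' ρ t = W z z' ρ c - (ρ - ρ₀) * J z ρ t := fun z z' hz ρ t ht => by
    have h1 := (hz.wronskian_prim (h ρ) hcd).eq_add_integral t ht
    rw [intervalIntegral.integral_congr (g := fun t =>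
      -(ρ - ρ₀) * ((ρ + ρ₀ + p t) * (z t * y ρ t))) (fun s _ => by simp only; ring),
      intervalIntegral.integral_const_mul] at h1
    simp only [W, J]
    linear_combination h1
  have hWc : ∀ z z', DifferentiableAt ℂ (fun ρ => W z z' ρ c) ρ₀ := fun z z' =>
    (hc'.const_mul _).sub (hc.const_mul _)
  have hnear : ∀ᶠ ρ in 𝓝 ρ₀, ‖ρ‖ ≤ ‖ρ₀‖ + 1 :=
    (continuous_norm.continuousAt.eventually_lt continuousAt_const (by simp)).mono fun _ => le_of_lt
  have hbd : ∀ z z', IsSol p q ρ₀ z z' c d → ∃ B, ∀ᶠ ρ in 𝓝 ρ₀, ∀ t ∈ Icc c d,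
      ‖(ρ + ρ₀ + p t) * (z t * y ρ t)‖ ≤ B := fun z z' hz => by
    obtain ⟨Z, hZ⟩ := isCompact_Icc.exists_bound_of_continuousOn hz.prim.continuousOn
    refine ⟨(‖ρ₀‖ + 1 + ‖ρ₀‖ + M) * (Z * K), ?_⟩
    filter_upwards [hK, hnear] with ρ h1 h2 t ht
    have hM0 : 0 ≤ M := (norm_nonneg _).trans (hM t ht)
    have hZ0 : 0 ≤ Z := (norm_nonneg _).trans (hZ t ht)
    rw [norm_mul, norm_mul]
    refine mul_le_mul ?_ (mul_le_mul (hZ t ht) (h1 t ht) (norm_nonneg _) hZ0) (by positivity)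
      (by positivity)
    refine (norm_add_le _ _).trans (add_le_add ((norm_add_le _ _).trans ?_) (hM t ht))
    gcongr
  have hWcont : ∀ z z', IsSol p q ρ₀ z z' c d → ∀ t ∈ Icc c d,
      ContinuousAt (fun ρ => W z z' ρ t) ρ₀ := fun z z' hz t ht => by
    obtain ⟨B, hB⟩ := hbd z z' hz
    have h1 : Tendsto (fun ρ => (ρ - ρ₀) * J z ρ t) (𝓝 ρ₀) (𝓝 0) := by
      refine squeeze_zero_norm' (a := fun ρ => ‖ρ - ρ₀‖ * (B * |t - c|)) ?_ ?_
      · filter_upwards [hB] with ρ hρ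
        rw [norm_mul]
        gcongr
        refine intervalIntegral.norm_integral_le_of_norm_le_const fun s hs => hρ s ?_
        rw [uIoc_of_le ht.1] at hs
        exact ⟨hs.1.le, hs.2.trans ht.2⟩
      · have : ContinuousAt (fun ρ => ‖ρ - ρ₀‖ * (B * |t - c|)) ρ₀ := by fun_prop
        simpa [ContinuousAt] using this
    have h2 : Tendsto (fun ρ => W z z' ρ c - (ρ - ρ₀) * J z ρ t) (𝓝 ρ₀)
        (𝓝 (W z z' ρ₀ t)) := by
      rw [hWJ z z' hz ρ₀ t ht, sub_self, zero_mul]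
      exact (hWc z z').continuousAt.tendsto.sub h1
    exact h2.congr fun ρ => (hWJ z z' hz ρ t ht).symm
  have hone : ∀ t ∈ Icc c d, u t * v' t - u' t * v t = 1 := fun t ht =>
    (hu.wronskian_eq hv ht).trans huv
  have hyW : ∀ t ∈ Icc c d, ∀ ρ, y ρ t = v t * W u u' ρ t - u t * W v v' ρ t :=
    fun t ht ρ => by
      simp only [W]; linear_combination (-y ρ t) * hone t ht
  have hyW' : ∀ t ∈ Icc c d, ∀ ρ, y' ρ t = v' t * W u u' ρ t - u' t * W v v' ρ t :=
    fun t ht ρ => by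
      simp only [W]; linear_combination (-y' ρ t) * hone t ht
  have hycont : ∀ t ∈ Icc c d, ContinuousAt (fun ρ => y ρ t) ρ₀ := fun t ht => by
    simp only [hyW t ht]
    exact (continuousAt_const.mul (hWcont u u' hu t ht)).sub
      (continuousAt_const.mul (hWcont v v' hv t ht))
  have hJcont : ∀ z z', IsSol p q ρ₀ z z' c d → ContinuousAt (fun ρ => J z ρ x) ρ₀ :=
    fun z z' hz => by
    obtain ⟨B, hB⟩ := hbd z z' hz
    have hsub : ∀ t ∈ uIoc c x, t ∈ Icc c d := fun t ht => by
      rw [uIoc_of_le hx.1] at ht; exact ⟨ht.1.le, ht.2.trans hx.2⟩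
    refine intervalIntegral.continuousAt_of_dominated_interval (bound := fun _ => B) ?_ ?_
      intervalIntegrable_const ?_
    · refine Eventually.of_forall fun ρ => ?_
      have h1 : ContinuousOn (fun t => (ρ + ρ₀ + p t) * (z t * y ρ t)) (Icc c d) :=
        (continuousOn_const.add hp).mul (hz.prim.continuousOn.mul (h ρ).prim.continuousOn)
      exact (h1.mono hsub).aestronglyMeasurable measurableSet_uIoc
    · filter_upwards [hB] with ρ hρ
      exact Eventually.of_forall fun t ht => hρ t (hsub t ht)
    · refine Eventually.of_forall fun t ht => ?_
      exact ((continuousAt_id.add continuousAt_const).add continuousAt_const).mul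
        (continuousAt_const.mul (hycont t (hsub t ht)))
  have hWd : ∀ z z', IsSol p q ρ₀ z z' c d → DifferentiableAt ℂ (fun ρ => W z z' ρ x) ρ₀ :=
    fun z z' hz => by
    have h1 : DifferentiableAt ℂ (fun ρ => (ρ - ρ₀) * J z ρ x) ρ₀ := by
      suffices h2 : HasDerivAt (fun ρ => (ρ - ρ₀) * J z ρ x) (J z ρ₀ x) ρ₀ from
        h2.differentiableAt
      rw [hasDerivAt_iff_tendsto_slope]
      refine ((hJcont z z' hz).tendsto.mono_left nhdsWithin_le_nhds).congr' ?_
      filter_upwards [self_mem_nhdsWithin] with ρ hρ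
      have : ρ - ρ₀ ≠ 0 := sub_ne_zero.2 hρ
      rw [slope_def_field]
      field_simp
      ring
    simp only [hWJ z z' hz _ x hx]
    exact (hWc z z').sub h1
  constructor
  · simp only [hyW x hx]
    exact ((hWd u u' hu).const_mul _).sub ((hWd v v' hv).const_mul _)
  · simp only [hyW' x hx]
    exact ((hWd u u' hu).const_mul _).sub ((hWd v v' hv).const_mul _)

end IsSol
end

section

/-! ### Asymptotics on one interval -/

/-- The amplitude `y' + σ i (ρ + p / 2) y` of the exponential wave of sign `σ = ±1`. -/
def waveAmp (p : ℝ → ℂ) (ρ σ : ℂ) (y y' : ℝ → ℂ) (x : ℝ) : ℂ :=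
  y' x + σ * I * (ρ + p x / 2) * y x

/-- The potential which couples the two wave amplitudes. -/
def wavePot (p dp q : ℝ → ℂ) (σ : ℂ) (x : ℝ) : ℂ :=
  p x ^ 2 / 4 - q x + σ * I * dp x / 2

/-- The exponential wave `exp (i ∫ₜˣ (ρ + p / 2))`. -/
def wave (p : ℝ → ℂ) (ρ : ℂ) (t x : ℝ) : ℂ :=
  Complex.exp (I * ∫ s in t..x, (ρ + p s / 2))

theorem wave_ne_zero (p : ℝ → ℂ) (ρ : ℂ) (t x : ℝ) : wave p ρ t x ≠ 0 := Complex.exp_ne_zero _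

theorem wave_self (p : ℝ → ℂ) (ρ : ℂ) (t : ℝ) : wave p ρ t t = 1 := by simp [wave]

section

variable {p dp q y y' : ℝ → ℂ} {ρ : ℂ} {c d M κ : ℝ}

theorem intervalIntegrable_wave (hp : ContinuousOn p (Icc c d)) {t x : ℝ} (ht : t ∈ Icc c d)
    (hx : x ∈ Icc c d) : IntervalIntegrable (fun s => ρ + p s / 2) volume t x := by
  refine ContinuousOn.intervalIntegrable ?_
  exact (continuousOn_const.add (hp.div_const 2)).mono (ordConnected_Icc.uIcc_subset ht hx)

theorem wave_mul (hp : ContinuousOn p (Icc c d)) {r t x : ℝ} (hr : r ∈ Icc c d)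
    (ht : t ∈ Icc c d) (hx : x ∈ Icc c d) : wave p ρ r t * wave p ρ t x = wave p ρ r x := by
  rw [wave, wave, wave, ← Complex.exp_add, ← mul_add,
    intervalIntegral.integral_add_adjacent_intervals (intervalIntegrable_wave hp hr ht)
      (intervalIntegrable_wave hp ht hx)]

theorem norm_wave_bounds (hp : ContinuousOn p (Icc c d)) (hM : ∀ x ∈ Icc c d, ‖p x‖ ≤ M)
    {t x : ℝ} (ht : t ∈ Icc c d) (hx : x ∈ Icc c d) (htx : t ≤ x) :
    Real.exp (-((ρ.im + M / 2) * (x - t))) ≤ ‖wave p ρ t x‖ ∧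
      ‖wave p ρ t x‖ ≤ Real.exp (-((ρ.im - M / 2) * (x - t))) := by
  have hpi : IntervalIntegrable (fun s => p s / 2) volume t x :=
    ((hp.div_const 2).mono (ordConnected_Icc.uIcc_subset ht hx)).intervalIntegrable
  have h1 : ∫ s in t..x, (ρ + p s / 2) = (x - t : ℝ) * ρ + ∫ s in t..x, p s / 2 := by
    rw [intervalIntegral.integral_add intervalIntegrable_const hpi]
    simp
  have h2 : ‖∫ s in t..x, p s / 2‖ ≤ M / 2 * |x - t| := by
    refine intervalIntegral.norm_integral_le_of_norm_le_const fun s hs => ?_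
    rw [uIoc_of_le htx] at hs
    have := hM s ⟨ht.1.trans hs.1.le, hs.2.trans hx.2⟩
    rw [norm_div]
    simpa using by linarith
  rw [abs_of_nonneg (sub_nonneg.2 htx)] at h2
  have h3 := (abs_le.1 ((Complex.abs_im_le_norm _).trans h2))
  have h4 : (I * ∫ s in t..x, (ρ + p s / 2)).re =
      -((x - t) * ρ.im + (∫ s in t..x, p s / 2).im) := by
    rw [h1]; simp [Complex.mul_re]
  rw [wave, Complex.norm_exp, h4, Real.exp_le_exp, Real.exp_le_exp]
  constructor <;> linarith [h3.1, h3.2]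

theorem continuousOn_wave (hp : ContinuousOn p (Icc c d)) (hcd : c ≤ d) :
    ContinuousOn (fun x => wave p ρ c x) (Icc c d) :=
  ((IsPrimitiveOn.integral_self (intervalIntegrable_wave (ρ := ρ) hp (left_mem_Icc.2 hcd)
    (right_mem_Icc.2 hcd))).const_mul I |>.complex_exp hcd).continuousOn

namespace IsSol

theorem waveAmp_sub (x : ℝ) :
    waveAmp p ρ 1 y y' x - waveAmp p ρ (-1) y y' x = 2 * I * (ρ + p x / 2) * y x := by
  simp only [waveAmp]; ring

theorem norm_le_waveAmp (hM : ∀ x ∈ Icc c d, ‖p x‖ ≤ M) (hκ : 0 < κ)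
    (hρ : κ + M / 2 ≤ ρ.im) {x : ℝ} (hx : x ∈ Icc c d) :
    ‖y x‖ ≤ (‖waveAmp p ρ 1 y y' x‖ + ‖waveAmp p ρ (-1) y y' x‖) / (2 * κ) := by
  have h1 : ‖2 * I * (ρ + p x / 2) * y x‖ ≤
      ‖waveAmp p ρ 1 y y' x‖ + ‖waveAmp p ρ (-1) y y' x‖ := by
    rw [← waveAmp_sub (y' := y') x]; exact norm_sub_le _ _
  have h2 : κ ≤ ‖ρ + p x / 2‖ := by
    have e1 := (Complex.abs_im_le_norm (p x)).trans (hM x hx)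
    have e2 : (ρ + p x / 2).im = ρ.im + (p x).im / 2 := by simp
    have e3 := (le_abs_self _).trans (Complex.abs_im_le_norm (ρ + p x / 2))
    rw [e2] at e3
    linarith [(abs_le.1 e1).1]
  rw [le_div_iff₀ (by positivity)]
  have h3 : ‖2 * I * (ρ + p x / 2) * y x‖ = 2 * ‖ρ + p x / 2‖ * ‖y x‖ := by simp
  nlinarith [mul_le_mul_of_nonneg_right h2 (norm_nonneg (y x))]

theorem waveAmp_prim (hp : IsPrimitiveOn p dp c d) (h : IsSol p q ρ y y' c d) (hcd : c ≤ d)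
    {σ : ℂ} (hσ : σ ^ 2 = 1) :
    IsPrimitiveOn (fun x => Complex.exp (-σ * (I * ∫ s in c..x, (ρ + p s / 2))) *
        waveAmp p ρ σ y y' x)
      (fun x => Complex.exp (-σ * (I * ∫ s in c..x, (ρ + p s / 2))) *
        (wavePot p dp q σ x * y x)) c d := by
  have hθ : IsPrimitiveOn (fun x => -σ * (I * ∫ s in c..x, (ρ + p s / 2)))
      (fun x => -σ * (I * (ρ + p x / 2))) c d :=
    ((IsPrimitiveOn.integral_self (intervalIntegrable_wave hp.continuousOn (left_mem_Icc.2 hcd)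
      (right_mem_Icc.2 hcd))).const_mul I).const_mul (-σ)
  have hk : IsPrimitiveOn (fun _ : ℝ => σ * I * ρ) (fun _ => (0 : ℂ)) c d :=
    ⟨intervalIntegrable_const, fun x _ => by simp⟩
  have hU := h.prim'.add ((hk.add (hp.const_mul (σ * I / 2))).mul h.prim hcd)
  have hfun : (fun x => y' x + (σ * I * ρ + σ * I / 2 * p x) * y x) = waveAmp p ρ σ y y' := by
    ext x; simp only [waveAmp]; ring
  rw [hfun] at hU
  refine ((hθ.complex_exp hcd).mul hU hcd).congr_deriv fun x => ?_
  simp only [waveAmp, wavePot]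
  have hI : I ^ 2 = -1 := Complex.I_sq
  generalize Complex.exp (-σ * (I * ∫ s in c..x, (ρ + p s / 2))) = E
  linear_combination (-(E * (ρ + p x / 2) ^ 2 * y x * I ^ 2)) * hσ -
    (E * (ρ + p x / 2) ^ 2 * y x) * hI

theorem intervalIntegrable_wavePot (hp : IsPrimitiveOn p dp c d) (hcd : c ≤ d)
    (hq : IntervalIntegrable q volume c d) (σ : ℂ) :
    IntervalIntegrable (wavePot p dp q σ) volume c d := by
  have h1 := ((hp.continuousOn.pow 2).div_const 4).intervalIntegrable_of_Icc (μ := volume) hcd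
  exact (h1.sub hq).add ((hp.integrable.const_mul (σ * I)).div_const 2)

/-- Forward estimates of the wave amplitudes in the upper half plane. -/
theorem wave_forward (hp : IsPrimitiveOn p dp c d) (hq : IntervalIntegrable q volume c d)
    (h : IsSol p q ρ y y' c d) (hcd : c ≤ d) (hM : ∀ x ∈ Icc c d, ‖p x‖ ≤ M) (hκ : 0 < κ)
    (hρ : κ + M / 2 ≤ ρ.im) {A B : ℝ}
    (hA : A = ∫ t in c..d, (‖wavePot p dp q 1 t‖ + ‖wavePot p dp q (-1) t‖))
    (hB : B = (‖waveAmp p ρ 1 y y' c‖ + ‖waveAmp p ρ (-1) y y' c‖) * Real.exp (A / (2 * κ))) :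
    (∀ x ∈ Icc c d, ‖wave p ρ c x‖ *
      (‖waveAmp p ρ 1 y y' x‖ + ‖waveAmp p ρ (-1) y y' x‖) ≤ B) ∧
    ‖wave p ρ c d * waveAmp p ρ (-1) y y' d - waveAmp p ρ (-1) y y' c‖ ≤ A * B / (2 * κ) ∧
    ‖wave p ρ c d * waveAmp p ρ 1 y y' d‖ ≤
      ‖waveAmp p ρ 1 y y' c‖ * Real.exp (-(2 * κ * (d - c))) +
      B / (2 * κ) * ∫ t in c..d, Real.exp (-(2 * κ * (d - t))) * ‖wavePot p dp q 1 t‖ := by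
  have hpc := hp.continuousOn
  have hcm : c ∈ Icc c d := left_mem_Icc.2 hcd
  have hdm : d ∈ Icc c d := right_mem_Icc.2 hcd
  set U := waveAmp p ρ 1 y y' with hU
  set V := waveAmp p ρ (-1) y y' with hV
  set D := wave p ρ c with hD
  have hDc : ContinuousOn D (Icc c d) := continuousOn_wave hpc hcd
  have hUc : ContinuousOn U (Icc c d) := h.prim'.continuousOn.add
    ((continuousOn_const.mul (continuousOn_const.add (hpc.div_const 2))).mul h.prim.continuousOn)
  have hVc : ContinuousOn V (Icc c d) := h.prim'.continuousOn.add
    ((continuousOn_const.mul (continuousOn_const.add (hpc.div_const 2))).mul h.prim.continuousOn)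
  have hs1 := intervalIntegrable_wavePot hp hcd hq 1
  have hs2 := intervalIntegrable_wavePot hp hcd hq (-1)
  have hmono : ∀ {f : ℝ → ℝ}, IntervalIntegrable f volume c d → ∀ {x}, x ∈ Icc c d →
      IntervalIntegrable f volume c x := fun hf x hx =>
    hf.mono_set (by rw [uIcc_of_le hx.1, uIcc_of_le hcd]; exact Icc_subset_Icc_right hx.2)
  have hcont : ∀ {f : ℝ → ℝ}, ContinuousOn f (Icc c d) → ∀ {x}, x ∈ Icc c d →
      ContinuousOn f (uIcc c x) := fun hf x hx => by
    rw [uIcc_of_le hx.1]; exact hf.mono (Icc_subset_Icc_right hx.2)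
  have hy : ∀ x ∈ Icc c d, ‖y x‖ ≤ (‖U x‖ + ‖V x‖) / (2 * κ) := fun x hx =>
    norm_le_waveAmp hM hκ hρ hx
  -- integral equations
  have hVeq : ∀ x ∈ Icc c d, D x * V x = V c + ∫ t in c..x, D t * (wavePot p dp q (-1) t * y t) :=
    fun x hx => by
      have h1 := (waveAmp_prim hp h hcd (σ := -1) (by norm_num)).eq_add_integral x hx
      simpa [hD, wave, hV] using h1
  have hUeq : ∀ x ∈ Icc c d, D x * U x = D x ^ 2 * U c +
      ∫ t in c..x, wave p ρ t x ^ 2 * (D t * (wavePot p dp q 1 t * y t)) := fun x hx => by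
    have h1 := (waveAmp_prim hp h hcd (σ := 1) (by norm_num)).eq_add_integral x hx
    have h2 : ∀ t, Complex.exp (-1 * (I * ∫ s in c..t, (ρ + p s / 2))) = (D t)⁻¹ := fun t => by
      rw [hD, wave, ← Complex.exp_neg]; ring_nf
    simp only [h2, ← hU] at h1
    have h3 : D c = 1 := wave_self _ _ _
    have h0 : D x ≠ 0 := wave_ne_zero _ _ _ _
    have h4 : D x * U x = D x ^ 2 * U c +
        D x ^ 2 * ∫ t in c..x, (D t)⁻¹ * (wavePot p dp q 1 t * y t) := by
      rw [h3, inv_one, one_mul] at h1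
      rw [← mul_add, ← h1]; field_simp
    rw [h4, ← intervalIntegral.integral_const_mul]
    congr 1
    refine intervalIntegral.integral_congr fun t ht => ?_
    rw [uIcc_of_le hx.1] at ht
    have ht' : t ∈ Icc c d := ⟨ht.1, ht.2.trans hx.2⟩
    have h5 : D t * wave p ρ t x = D x := wave_mul hpc hcm ht' hx
    have h6 : D t ≠ 0 := wave_ne_zero _ _ _ _
    rw [← h5]; field_simp
  have hw2 : ∀ t ∈ Icc c d, ∀ x ∈ Icc c d, t ≤ x →
      ‖wave p ρ t x ^ 2‖ ≤ Real.exp (-(2 * κ * (x - t))) := fun t ht x hx htx => by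
    rw [norm_pow, show -(2 * κ * (x - t)) = (2 : ℕ) * (-(κ * (x - t))) by push_cast; ring,
      Real.exp_nat_mul]
    have h1 := (norm_wave_bounds (ρ := ρ) hpc hM ht hx htx).2
    refine pow_le_pow_left₀ (norm_nonneg _) (h1.trans (Real.exp_le_exp.2 ?_)) 2
    nlinarith
  have hw1 : ∀ t ∈ Icc c d, ∀ x ∈ Icc c d, t ≤ x → ‖wave p ρ t x ^ 2‖ ≤ 1 :=
    fun t ht x hx htx => (hw2 t ht x hx htx).trans (Real.exp_le_one_iff.2 (by
      have := sub_nonneg.2 htx; have : 0 ≤ 2 * κ * (x - t) := by positivity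
      linarith))
  set k : ℝ → ℝ := fun t => (‖wavePot p dp q 1 t‖ + ‖wavePot p dp q (-1) t‖) / (2 * κ) with hk
  have hki : IntervalIntegrable k volume c d := (hs1.norm.add hs2.norm).div_const _
  set u : ℝ → ℝ := fun x => ‖D x‖ * (‖U x‖ + ‖V x‖) with hu
  have huc : ContinuousOn u (Icc c d) := hDc.norm.mul (hUc.norm.add hVc.norm)
  have hDy : ∀ σ, ∀ t ∈ Icc c d, ‖D t * (wavePot p dp q σ t * y t)‖ ≤
      ‖wavePot p dp q σ t‖ / (2 * κ) * u t := fun σ t ht => by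
    rw [norm_mul, norm_mul]
    have := mul_le_mul_of_nonneg_left (hy t ht)
      (mul_nonneg (norm_nonneg (D t)) (norm_nonneg (wavePot p dp q σ t)))
    calc _ = ‖D t‖ * ‖wavePot p dp q σ t‖ * ‖y t‖ := by ring
      _ ≤ _ := this
      _ = _ := by simp only [hu]; ring
  have hDc1 : D c = 1 := wave_self _ _ _
  have hσint : ∀ σ, IntervalIntegrable (fun t => ‖wavePot p dp q σ t‖ / (2 * κ)) volume c d :=
    fun σ => (intervalIntegrable_wavePot hp hcd hq σ).norm.div_const _
  have hVint : ∀ x ∈ Icc c d, ‖∫ t in c..x, D t * (wavePot p dp q (-1) t * y t)‖ ≤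
      ∫ t in c..x, ‖wavePot p dp q (-1) t‖ / (2 * κ) * u t := fun x hx => by
    refine intervalIntegral.norm_integral_le_of_norm_le hx.1
      (Eventually.of_forall fun t ht => hDy _ t ⟨ht.1.le, ht.2.trans hx.2⟩)
      ((hmono (hσint (-1)) hx).mul_continuousOn (hcont huc hx))
  have hUint : ∀ x ∈ Icc c d,
      ‖∫ t in c..x, wave p ρ t x ^ 2 * (D t * (wavePot p dp q 1 t * y t))‖ ≤
      ∫ t in c..x, ‖wavePot p dp q 1 t‖ / (2 * κ) * u t := fun x hx => by
    refine intervalIntegral.norm_integral_le_of_norm_le hx.1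
      (Eventually.of_forall fun t ht => ?_)
      ((hmono (hσint 1) hx).mul_continuousOn (hcont huc hx))
    have ht' : t ∈ Icc c d := ⟨ht.1.le, ht.2.trans hx.2⟩
    rw [norm_mul]
    calc _ ≤ 1 * ‖D t * (wavePot p dp q 1 t * y t)‖ := by
          gcongr; exact hw1 t ht' x hx ht.2
      _ ≤ _ := by rw [one_mul]; exact hDy _ t ht'
  have hkint : ∀ x ∈ Icc c d, ∫ t in c..x, k t ≤ A / (2 * κ) := fun x hx => by
    rw [hA, ← intervalIntegral.integral_div]
    exact intervalIntegral.integral_mono_interval le_rfl hx.1 hx.2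
      (Eventually.of_forall fun t => by positivity) hki
  have huB : ∀ x ∈ Icc c d, u x ≤ B := fun x hx => by
    have h1 := gronwall_of_integrable hcd huc hki (K := ‖U c‖ + ‖V c‖)
      (fun t => by positivity) (fun x hx => ?_) x hx
    · refine h1.trans ?_
      rw [hB]
      gcongr
      exact hkint x hx
    · have e1 : ‖D x * V x‖ ≤ ‖V c‖ + ∫ t in c..x, ‖wavePot p dp q (-1) t‖ / (2 * κ) * u t := by
        rw [hVeq x hx]
        exact (norm_add_le _ _).trans (by gcongr; exact hVint x hx)
      have e2 : ‖D x * U x‖ ≤ ‖U c‖ + ∫ t in c..x, ‖wavePot p dp q 1 t‖ / (2 * κ) * u t := by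
        rw [hUeq x hx]
        refine (norm_add_le _ _).trans (add_le_add ?_ (hUint x hx))
        rw [norm_mul]
        exact mul_le_of_le_one_left (norm_nonneg _) (hw1 c hcm x hx hx.1)
      have e3 : ∫ t in c..x, k t * u t = (∫ t in c..x, ‖wavePot p dp q 1 t‖ / (2 * κ) * u t) +
          ∫ t in c..x, ‖wavePot p dp q (-1) t‖ / (2 * κ) * u t := by
        rw [← intervalIntegral.integral_add
          ((hmono (hσint 1) hx).mul_continuousOn (hcont huc hx))
          ((hmono (hσint (-1)) hx).mul_continuousOn (hcont huc hx))]
        refine intervalIntegral.integral_congr fun t _ => ?_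
        simp only [hk]; ring
      rw [e3]
      have e4 : u x = ‖D x * U x‖ + ‖D x * V x‖ := by simp only [hu, norm_mul]; ring
      linarith
  have hB0 : 0 ≤ B := by rw [hB]; positivity
  have hA2 : ∫ t in c..d, ‖wavePot p dp q (-1) t‖ ≤ A := by
    rw [hA]
    exact intervalIntegral.integral_mono_on hcd hs2.norm (hs1.norm.add hs2.norm) fun t _ => by
      simp
  refine ⟨huB, ?_, ?_⟩
  · rw [hVeq d hdm, add_sub_cancel_left]
    refine (hVint d hdm).trans ?_
    calc _ ≤ ∫ t in c..d, ‖wavePot p dp q (-1) t‖ / (2 * κ) * B :=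
          intervalIntegral.integral_mono_on hcd
            ((hσint (-1)).mul_continuousOn (hcont huc hdm)) ((hσint (-1)).mul_const _)
            fun t ht => by gcongr; exact huB t ht
      _ = (∫ t in c..d, ‖wavePot p dp q (-1) t‖) * B / (2 * κ) := by
          rw [intervalIntegral.integral_mul_const, intervalIntegral.integral_div]; ring
      _ ≤ _ := by gcongr
  · rw [hUeq d hdm]
    refine (norm_add_le _ _).trans (add_le_add ?_ ?_)
    · rw [norm_mul, mul_comm]
      gcongr
      exact hw2 c hcm d hdm hcd
    · rw [← intervalIntegral.integral_const_mul]
      have hexpc : ContinuousOn (fun t => Real.exp (-(2 * κ * (d - t)))) (uIcc c d) := by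
        fun_prop
      refine intervalIntegral.norm_integral_le_of_norm_le hcd
        (Eventually.of_forall fun t ht => ?_) ((hs1.norm.continuousOn_mul hexpc).const_mul _)
      have ht' : t ∈ Icc c d := ⟨ht.1.le, ht.2⟩
      rw [norm_mul]
      calc _ ≤ Real.exp (-(2 * κ * (d - t))) * (‖wavePot p dp q 1 t‖ / (2 * κ) * u t) :=
            mul_le_mul (hw2 t ht' d hdm ht.2) (hDy _ t ht') (norm_nonneg _) (Real.exp_pos _).le
        _ ≤ Real.exp (-(2 * κ * (d - t))) * (‖wavePot p dp q 1 t‖ / (2 * κ) * B) := by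
            gcongr; exact huB t ht'
        _ = _ := by ring

end IsSol
end
end

section

theorem IsPrimitiveOn.reflect {f f' : ℝ → ℂ} {c d : ℝ} (hf : IsPrimitiveOn f f' c d)
    (hcd : c ≤ d) :
    IsPrimitiveOn (fun x => f (c + d - x)) (fun x => -f' (c + d - x)) c d := by
  constructor
  · have h1 : IntervalIntegrable (fun x => f' (c + d - x)) volume c d := by
      simpa using (hf.integrable.comp_sub_left (c + d)).symm
    exact h1.neg
  · intro x hx
    rw [intervalIntegral.integral_neg, intervalIntegral.integral_comp_sub_left,
      add_sub_cancel_left, ← hf.sub_eq_integral (x := c + d - x) (y := d)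
      ⟨by linarith [hx.2], by linarith [hx.1]⟩ (right_mem_Icc.2 hcd)]
    ring

namespace IsSol

variable {p dp q y y' : ℝ → ℂ} {ρ : ℂ} {c d M κ : ℝ}

theorem reflect (h : IsSol p q ρ y y' c d) (hcd : c ≤ d) :
    IsSol (fun x => p (c + d - x)) (fun x => q (c + d - x)) ρ (fun x => y (c + d - x))
      (fun x => -y' (c + d - x)) c d := by
  refine ⟨h.prim.reflect hcd, ?_⟩
  have h1 := (h.prim'.reflect hcd).const_mul (-1)
  simp only [neg_one_mul] at h1
  exact h1.congr_deriv fun x => by ring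

/-- Backward estimates of the wave amplitudes in the upper half plane. -/
theorem wave_backward (hp : IsPrimitiveOn p dp c d) (hq : IntervalIntegrable q volume c d)
    (h : IsSol p q ρ y y' c d) (hcd : c ≤ d) (hM : ∀ x ∈ Icc c d, ‖p x‖ ≤ M) (hκ : 0 < κ)
    (hρ : κ + M / 2 ≤ ρ.im) {A B : ℝ}
    (hA : A = ∫ t in c..d, (‖wavePot p dp q 1 t‖ + ‖wavePot p dp q (-1) t‖))
    (hB : B = (‖waveAmp p ρ 1 y y' d‖ + ‖waveAmp p ρ (-1) y y' d‖) * Real.exp (A / (2 * κ))) :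
    (∀ x ∈ Icc c d, ‖wave p ρ x d‖ *
      (‖waveAmp p ρ 1 y y' x‖ + ‖waveAmp p ρ (-1) y y' x‖) ≤ B) ∧
    ‖wave p ρ c d * waveAmp p ρ 1 y y' c - waveAmp p ρ 1 y y' d‖ ≤ A * B / (2 * κ) ∧
    ‖wave p ρ c d * waveAmp p ρ (-1) y y' c‖ ≤
      ‖waveAmp p ρ (-1) y y' d‖ * Real.exp (-(2 * κ * (d - c))) +
      B / (2 * κ) * ∫ t in c..d, Real.exp (-(2 * κ * (t - c))) * ‖wavePot p dp q (-1) t‖ := by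
  have hmem : ∀ x ∈ Icc c d, c + d - x ∈ Icc c d := fun x hx =>
    ⟨by linarith [hx.2], by linarith [hx.1]⟩
  have hq' : IntervalIntegrable (fun x => q (c + d - x)) volume c d := by
    simpa using (hq.comp_sub_left (c + d)).symm
  have hamp : ∀ σ x, waveAmp (fun x => p (c + d - x)) ρ σ (fun x => y (c + d - x))
      (fun x => -y' (c + d - x)) x = -waveAmp p ρ (-σ) y y' (c + d - x) := fun σ x => by
    simp only [waveAmp]; ring
  have hpot : ∀ σ x, wavePot (fun x => p (c + d - x)) (fun x => -dp (c + d - x))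
      (fun x => q (c + d - x)) σ x = wavePot p dp q (-σ) (c + d - x) := fun σ x => by
    simp only [wavePot]; ring
  have hwave : ∀ x, wave (fun x => p (c + d - x)) ρ c x = wave p ρ (c + d - x) d := fun x => by
    rw [wave, wave, intervalIntegral.integral_comp_sub_left (fun s => ρ + p s / 2),
      add_sub_cancel_left]
  have key := wave_forward (hp.reflect hcd) hq' (h.reflect hcd) hcd
    (fun x hx => hM _ (hmem x hx)) hκ hρ (A := A) (B := B) ?_ ?_
  · simp only [hamp, hpot, hwave, neg_neg, norm_neg, add_sub_cancel_left, add_sub_cancel_right]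
      at key
    refine ⟨fun x hx => ?_, ?_, ?_⟩
    · have := key.1 _ (hmem x hx)
      rw [sub_sub_cancel] at this
      linarith
    · have := key.2.1
      rwa [mul_neg, neg_sub_neg, norm_sub_rev] at this
    · have := key.2.2
      rw [mul_neg, norm_neg] at this
      refine this.trans (le_of_eq ?_)
      congr 2
      have h1 := intervalIntegral.integral_comp_sub_left (a := c) (b := d)
        (fun t => Real.exp (-(2 * κ * (t - c))) * ‖wavePot p dp q (-1) t‖) (c + d)
      simp only [add_sub_cancel_left, add_sub_cancel_right] at h1
      rw [← h1]
      refine intervalIntegral.integral_congr fun t _ => ?_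
      rw [show c + d - t - c = d - t by ring]
  · rw [hA]
    simp only [hpot, neg_neg]
    have h1 := intervalIntegral.integral_comp_sub_left (a := c) (b := d)
      (fun t => ‖wavePot p dp q (-1) t‖ + ‖wavePot p dp q 1 t‖) (c + d)
    simp only [add_sub_cancel_left, add_sub_cancel_right] at h1
    rw [h1]
    simp only [add_comm]
  · simp only [hamp, neg_neg, norm_neg, add_sub_cancel_left]
    rw [hB, add_comm ‖waveAmp p ρ 1 y y' d‖]

end IsSol

/-- Boundary values whose decaying wave amplitude dominates along the ray `τ e`. -/
structure Outgoing (e : ℂ) (v v' : ℝ → ℂ) : Prop where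
  ne : ∀ᶠ τ : ℝ in atTop, v' τ + I * (τ * e) * v τ ≠ 0
  bound : ∃ K, ∀ᶠ τ : ℝ in atTop, ‖v' τ‖ + τ * ‖v τ‖ ≤ K * ‖v' τ + I * (τ * e) * v τ‖

/-- A family of solutions which decays like `exp (i τ e x)` on `[c, d]` along the ray `τ e`. -/
structure WeylDecay (p : ℝ → ℂ) (e : ℂ) (y y' : ℝ → ℝ → ℂ) (c d : ℝ) : Prop where
  ne : ∀ᶠ τ : ℝ in atTop, y τ c ≠ 0
  lim : Tendsto (fun τ : ℝ => y' τ c / y τ c - I * (τ * e)) atTop (𝓝 (I * p c / 2))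
  decay : ∃ K, ∀ᶠ τ : ℝ in atTop, ∀ x ∈ Icc c d,
    ‖y τ x‖ ≤ K * ‖y τ c‖ * Real.exp (-(τ * e.im * (x - c)))

theorem tendsto_integral_exp_neg_mul {f : ℝ → ℝ} {c d k : ℝ} (hcd : c ≤ d) (hk : 0 < k)
    (hf : IntervalIntegrable f volume c d) :
    Tendsto (fun τ : ℝ => ∫ t in c..d, Real.exp (-(τ * k * (t - c))) * f t) atTop (𝓝 0) := by
  have h0 : (0 : ℝ) = ∫ t in c..d, (0 : ℝ) := by simp
  rw [h0]
  refine intervalIntegral.tendsto_integral_filter_of_dominated_convergence (fun t => ‖f t‖)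
    ?_ ?_ hf.norm ?_
  · refine Eventually.of_forall fun τ => ?_
    have hc : ContinuousOn (fun t => Real.exp (-(τ * k * (t - c)))) (uIcc c d) := by fun_prop
    have := (hf.continuousOn_mul hc).aestronglyMeasurable
    rwa [uIoc_of_le hcd]
  · filter_upwards [eventually_ge_atTop 0] with τ hτ
    refine Eventually.of_forall fun t ht => ?_
    rw [uIoc_of_le hcd] at ht
    rw [norm_mul, Real.norm_eq_abs, Real.abs_exp]
    refine mul_le_of_le_one_left (norm_nonneg _) (Real.exp_le_one_iff.2 ?_)
    have := mul_nonneg (mul_nonneg hτ hk.le) (sub_nonneg.2 ht.1.le)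
    linarith
  · refine Eventually.of_forall fun t ht => ?_
    rw [uIoc_of_le hcd] at ht
    have h1 : Tendsto (fun τ : ℝ => Real.exp (-(τ * k * (t - c)))) atTop (𝓝 0) := by
      refine Real.tendsto_exp_atBot.comp (tendsto_neg_atTop_atBot.comp ?_)
      exact (tendsto_id.atTop_mul_const hk).atTop_mul_const (sub_pos.2 ht.1)
    simpa using h1.mul_const (f t)

end

section

theorem tendsto_mul_exp_neg_mul {k : ℝ} (hk : 0 < k) :
    Tendsto (fun τ : ℝ => τ * Real.exp (-(τ * k))) atTop (𝓝 0) := by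
  have h1 := (Real.tendsto_pow_mul_exp_neg_atTop_nhds_zero 1).comp
    (tendsto_id.atTop_mul_const hk)
  have h2 := h1.const_mul k⁻¹
  rw [mul_zero] at h2
  refine h2.congr fun τ => ?_
  simp only [Function.comp, id, pow_one]
  field_simp

/-- Comparison of the two wave amplitudes at the right end of an outgoing family. -/
theorem Outgoing.eventually_waveAmp {p : ℝ → ℂ} {e : ℂ} {y y' : ℝ → ℝ → ℂ} {d : ℝ}
    (ho : Outgoing e (fun τ => y τ d) (fun τ => y' τ d)) :
    ∃ K, 0 < K ∧ ∀ᶠ τ : ℝ in atTop, waveAmp p (τ * e) 1 (y τ) (y' τ) d ≠ 0 ∧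
      ‖waveAmp p (τ * e) 1 (y τ) (y' τ) d‖ + ‖waveAmp p (τ * e) (-1) (y τ) (y' τ) d‖ ≤
        K * ‖waveAmp p (τ * e) 1 (y τ) (y' τ) d‖ := by
  obtain ⟨K₀, hK₀⟩ := ho.bound
  set K := max K₀ 1 with hKdef
  have hK1 : 1 ≤ K := le_max_right _ _
  set M := ‖p d‖ with hM
  have hM0 : 0 ≤ M := norm_nonneg _
  refine ⟨2 * K * (1 + ‖e‖) + 2, by positivity, ?_⟩
  filter_upwards [hK₀, ho.ne, eventually_ge_atTop (M * K), eventually_ge_atTop 1]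
    with τ h1 h2 h3 h4
  set R := y' τ d + I * (τ * e) * y τ d with hR
  set U := waveAmp p (τ * e) 1 (y τ) (y' τ) d with hU
  set V := waveAmp p (τ * e) (-1) (y τ) (y' τ) d with hV
  have hR0 : 0 < ‖R‖ := norm_pos_iff.2 h2
  have h1' : ‖y' τ d‖ + τ * ‖y τ d‖ ≤ K * ‖R‖ :=
    h1.trans (by gcongr; exact le_max_left _ _)
  have y0 := norm_nonneg (y τ d)
  have y0' := norm_nonneg (y' τ d)
  have hMy : M * ‖y τ d‖ ≤ ‖R‖ := by
    have : K * (M * ‖y τ d‖) ≤ K * ‖R‖ := by nlinarith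
    exact le_of_mul_le_mul_left this (by linarith)
  have hUR : ‖U - R‖ ≤ ‖R‖ / 2 := by
    have : U - R = I * (p d / 2) * y τ d := by simp only [hU, hR, waveAmp]; ring
    rw [this]; simp only [norm_mul, norm_div, Complex.norm_I, RCLike.norm_ofNat]
    linarith
  have hURb : ‖R‖ / 2 ≤ ‖U‖ := by
    have := norm_sub_norm_le R U
    rw [norm_sub_rev] at this
    linarith
  have hVb : ‖V‖ ≤ ‖y' τ d‖ + (τ * ‖e‖ + M / 2) * ‖y τ d‖ := by
    have : V = y' τ d - I * (τ * e + p d / 2) * y τ d := by simp only [hV, waveAmp]; ring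
    rw [this]
    refine (norm_sub_le _ _).trans ?_
    rw [norm_mul, norm_mul, Complex.norm_I, one_mul]
    gcongr
    refine (norm_add_le _ _).trans ?_
    rw [norm_mul, norm_div, Complex.norm_real, Real.norm_of_nonneg (by linarith)]
    simp [hM]
  refine ⟨norm_pos_iff.1 (by linarith), ?_⟩
  have e0 := norm_nonneg e
  have : τ * ‖y τ d‖ * ‖e‖ ≤ K * ‖R‖ * ‖e‖ :=
    mul_le_mul_of_nonneg_right (by linarith) e0
  have h5 : ‖V‖ ≤ (K * (1 + ‖e‖) + 1 / 2) * ‖R‖ := by nlinarith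
  have h6 : (K * (1 + ‖e‖) + 1 / 2) * ‖R‖ ≤ (K * (1 + ‖e‖) + 1 / 2) * (2 * ‖U‖) := by
    gcongr; linarith
  linarith

section

variable {p dp q : ℝ → ℂ} {e : ℂ} {y y' : ℝ → ℝ → ℂ} {c d : ℝ}

/-- Comparison of the two wave amplitudes at the left end of an outgoing family. -/
theorem Outgoing.eventually_waveAmp_left (he : 0 < e.im) (hcd : c < d)
    (hp : IsPrimitiveOn p dp c d) (hq : IntervalIntegrable q volume c d)
    (h : ∀ τ : ℝ, IsSol p q (τ * e) (y τ) (y' τ) c d)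
    (ho : Outgoing e (fun τ => y τ d) (fun τ => y' τ d)) :
    ∃ K, 0 < K ∧ ∃ ε : ℝ → ℝ, Tendsto (fun τ => τ * ε τ) atTop (𝓝 0) ∧ ∀ᶠ τ : ℝ in atTop,
      waveAmp p (τ * e) 1 (y τ) (y' τ) c ≠ 0 ∧
      ‖waveAmp p (τ * e) (-1) (y τ) (y' τ) c‖ ≤ ε τ * ‖waveAmp p (τ * e) 1 (y τ) (y' τ) c‖ ∧
      ∀ x ∈ Icc c d, ‖waveAmp p (τ * e) 1 (y τ) (y' τ) x‖ +
        ‖waveAmp p (τ * e) (-1) (y τ) (y' τ) x‖ ≤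
        K * ‖wave p (τ * e) c x‖ * ‖waveAmp p (τ * e) 1 (y τ) (y' τ) c‖ := by
  obtain ⟨M, hM⟩ := isCompact_Icc.exists_bound_of_continuousOn hp.continuousOn
  obtain ⟨K, hK0, hK⟩ := ho.eventually_waveAmp (p := p)
  set A := ∫ t in c..d, (‖wavePot p dp q 1 t‖ + ‖wavePot p dp q (-1) t‖) with hA
  have hA0 : 0 ≤ A := intervalIntegral.integral_nonneg hcd.le fun t _ => by positivity
  set L := K * Real.exp A with hL
  have hKL : K ≤ L := le_mul_of_one_le_right hK0.le (Real.one_le_exp hA0)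
  have hL0 : 0 < L := hK0.trans_le hKL
  set J : ℝ → ℝ := fun τ =>
    ∫ t in c..d, Real.exp (-(τ * e.im * (t - c))) * ‖wavePot p dp q (-1) t‖ with hJ
  have hJlim : Tendsto J atTop (𝓝 0) := tendsto_integral_exp_neg_mul hcd.le he
    (IsSol.intervalIntegrable_wavePot hp hcd.le hq (-1)).norm
  have hεlim : Tendsto (fun τ : ℝ => 2 * L * (τ * Real.exp (-(τ * (e.im * (d - c)))) +
      1 / e.im * J τ)) atTop (𝓝 0) := by
    have h1 := ((tendsto_mul_exp_neg_mul (mul_pos he (sub_pos.2 hcd))).add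
      (hJlim.const_mul (1 / e.im))).const_mul (2 * L)
    simpa using h1
  refine ⟨2 * L, by positivity, fun τ =>
    2 * L * (Real.exp (-(τ * e.im * (d - c))) + 1 / (τ * e.im) * J τ), ?_, ?_⟩
  · refine hεlim.congr' ?_
    filter_upwards [eventually_gt_atTop 0] with τ hτ
    rw [mul_assoc τ e.im]
    field_simp
  · filter_upwards [hK, eventually_gt_atTop 0,
      eventually_ge_atTop (M / e.im), eventually_ge_atTop (1 / e.im),
      eventually_ge_atTop (2 * A * L / e.im)] with τ h1 hτ h2 h3 h4
    set U := waveAmp p (τ * e) 1 (y τ) (y' τ) with hU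
    set V := waveAmp p (τ * e) (-1) (y τ) (y' τ) with hV
    set B := (‖U d‖ + ‖V d‖) * Real.exp (A / (2 * (τ * e.im / 2))) with hB
    rw [div_le_iff₀ he] at h2 h3 h4
    have hκ : 0 < τ * e.im / 2 := by positivity
    have key := (h τ).wave_backward hp hq hcd.le hM hκ (by simp; linarith) hA hB
    rw [mul_div_cancel₀ _ (two_ne_zero)] at key hB
    have hk0 : 0 < τ * e.im := by positivity
    have hUd : 0 < ‖U d‖ := norm_pos_iff.2 h1.1
    have hBL : B ≤ L * ‖U d‖ := by
      calc B ≤ (K * ‖U d‖) * Real.exp A := by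
            rw [hB]; gcongr
            · exact h1.2
            · exact div_le_self hA0 h3
        _ = _ := by rw [hL]; ring
    have hVd : ‖V d‖ ≤ L * ‖U d‖ := by
      have : K * ‖U d‖ ≤ L * ‖U d‖ := by gcongr
      linarith [h1.2]
    set D := wave p (τ * e) c d with hD
    have hD0 : 0 < ‖D‖ := norm_pos_iff.2 (wave_ne_zero _ _ _ _)
    have hDU : ‖D * U c - U d‖ ≤ ‖U d‖ / 2 := by
      refine key.2.1.trans ?_
      rw [div_le_iff₀ hk0]
      calc A * B ≤ A * (L * ‖U d‖) := by gcongr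
        _ = (2 * A * L) * (‖U d‖ / 2) := by ring
        _ ≤ (τ * e.im) * (‖U d‖ / 2) := by gcongr
        _ = _ := by ring
    have hUdc : ‖U d‖ ≤ 2 * (‖D‖ * ‖U c‖) := by
      have := norm_sub_norm_le (U d) (D * U c)
      rw [norm_sub_rev, norm_mul] at this
      linarith
    have hUc : 0 < ‖U c‖ := by
      by_contra hcon
      have : ‖U c‖ = 0 := le_antisymm (not_lt.1 hcon) (norm_nonneg _)
      rw [this] at hUdc; linarith
    have hJ0 : 0 ≤ J τ := intervalIntegral.integral_nonneg hcd.le fun t _ => by positivity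
    refine ⟨norm_pos_iff.1 hUc, ?_, fun x hx => ?_⟩
    · have h5 := key.2.2
      rw [norm_mul] at h5
      have h6 : ‖D‖ * ‖V c‖ ≤ ‖D‖ * (2 * L * (Real.exp (-(τ * e.im * (d - c))) +
          1 / (τ * e.im) * J τ) * ‖U c‖) := by
        calc ‖D‖ * ‖V c‖ ≤ _ := h5
          _ ≤ L * ‖U d‖ * Real.exp (-(τ * e.im * (d - c))) + L * ‖U d‖ / (τ * e.im) * J τ := by
              gcongr
          _ = L * (Real.exp (-(τ * e.im * (d - c))) + 1 / (τ * e.im) * J τ) * ‖U d‖ := by ring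
          _ ≤ L * (Real.exp (-(τ * e.im * (d - c))) + 1 / (τ * e.im) * J τ) *
              (2 * (‖D‖ * ‖U c‖)) := by gcongr
          _ = _ := by ring
      exact le_of_mul_le_mul_left h6 hD0
    · have h5 := (key.1 x hx).trans hBL
      have h6 : wave p (τ * e) c x * wave p (τ * e) x d = D :=
        wave_mul hp.continuousOn (left_mem_Icc.2 hcd.le) hx (right_mem_Icc.2 hcd.le)
      have h7 : 0 < ‖wave p (τ * e) x d‖ := norm_pos_iff.2 (wave_ne_zero _ _ _ _)
      refine le_of_mul_le_mul_left (h5.trans ?_) h7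
      calc L * ‖U d‖ ≤ L * (2 * (‖D‖ * ‖U c‖)) := by gcongr
        _ = _ := by rw [← h6, norm_mul]; ring

theorem Outgoing.weylDecay (he : 0 < e.im) (hcd : c < d)
    (hp : IsPrimitiveOn p dp c d) (hq : IntervalIntegrable q volume c d)
    (h : ∀ τ : ℝ, IsSol p q (τ * e) (y τ) (y' τ) c d)
    (ho : Outgoing e (fun τ => y τ d) (fun τ => y' τ d)) : WeylDecay p e y y' c d := by
  obtain ⟨M, hM⟩ := isCompact_Icc.exists_bound_of_continuousOn hp.continuousOn
  have hcm : c ∈ Icc c d := left_mem_Icc.2 hcd.le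
  have hM0 : 0 ≤ M := (norm_nonneg _).trans (hM c hcm)
  obtain ⟨K, hK0, ε, hε, hK⟩ := ho.eventually_waveAmp_left he hcd hp hq h
  set r : ℝ → ℂ := fun τ =>
    waveAmp p (τ * e) (-1) (y τ) (y' τ) c / waveAmp p (τ * e) 1 (y τ) (y' τ) c with hr
  have hrε : ∀ᶠ τ : ℝ in atTop, ‖r τ‖ ≤ ε τ := by
    filter_upwards [hK] with τ h1
    rw [hr]; simp only [norm_div]
    rw [div_le_iff₀ (norm_pos_iff.2 h1.1)]
    exact h1.2.1
  have hτr : Tendsto (fun τ : ℝ => (τ : ℂ) * r τ) atTop (𝓝 0) := by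
    refine squeeze_zero_norm' ?_ hε
    filter_upwards [hrε, eventually_ge_atTop 0] with τ h1 h2
    rw [norm_mul, Complex.norm_real, Real.norm_of_nonneg h2]
    gcongr
  have hr0 : Tendsto r atTop (𝓝 0) := by
    refine squeeze_zero_norm' (a := fun τ : ℝ => τ * ‖r τ‖) ?_ ?_
    · filter_upwards [eventually_ge_atTop 1] with τ h2
      exact le_mul_of_one_le_left (norm_nonneg _) h2
    · refine (tendsto_zero_iff_norm_tendsto_zero.1 hτr).congr' ?_
      filter_upwards [eventually_ge_atTop 0] with τ h2
      rw [norm_mul, Complex.norm_real, Real.norm_of_nonneg h2]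
  have hr2 : ∀ᶠ τ in atTop, ‖r τ‖ ≤ 1 / 2 :=
    (hr0.norm.eventually_lt_const (by simp)).mono fun _ => le_of_lt
  have hstruct : ∀ᶠ τ : ℝ in atTop, (1 - r τ) ≠ 0 ∧
      2 * I * (τ * e + p c / 2) * y τ c = waveAmp p (τ * e) 1 (y τ) (y' τ) c * (1 - r τ) ∧
      2 * y' τ c = waveAmp p (τ * e) 1 (y τ) (y' τ) c * (1 + r τ) ∧ y τ c ≠ 0 := by
    filter_upwards [hK, hr2] with τ h1 h2
    have h3 : (1 - r τ) ≠ 0 := by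
      intro h0
      rw [← sub_eq_zero.1 h0, norm_one] at h2
      norm_num at h2
    have h4 : waveAmp p (τ * e) (-1) (y τ) (y' τ) c =
        waveAmp p (τ * e) 1 (y τ) (y' τ) c * r τ := by
      rw [hr]; field_simp [h1.1]
    have h5 : 2 * I * (τ * e + p c / 2) * y τ c =
        waveAmp p (τ * e) 1 (y τ) (y' τ) c * (1 - r τ) := by
      rw [← IsSol.waveAmp_sub (y' := y' τ), h4]; ring
    refine ⟨h3, h5, ?_, fun h0 => ?_⟩
    · rw [mul_add, ← h4, waveAmp, waveAmp]; ring
    · rw [h0, mul_zero] at h5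
      exact mul_ne_zero h1.1 h3 h5.symm
  refine ⟨hstruct.mono fun τ h1 => h1.2.2.2, ?_, ?_⟩
  · have hlim : Tendsto (fun τ : ℝ => I * p c / 2 +
        2 * I * (e * (τ * r τ) + p c / 2 * r τ) / (1 - r τ)) atTop (𝓝 (I * p c / 2)) := by
      have h1 := ((((hτr.const_mul e).add (hr0.const_mul (p c / 2))).const_mul (2 * I)).div
        ((tendsto_const_nhds (x := (1 : ℂ))).sub hr0) (by simp)).const_add (I * p c / 2)
      simpa using h1
    refine hlim.congr' ?_
    filter_upwards [hstruct] with τ h1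
    obtain ⟨h2, h3, h4, h5⟩ := h1
    have h6 : y' τ c / y τ c = I * (τ * e + p c / 2) * (1 + r τ) / (1 - r τ) := by
      rw [div_eq_div_iff h5 h2]
      linear_combination (1 - r τ) / 2 * h4 - (1 + r τ) / 2 * h3
    rw [h6]; field_simp; ring
  · refine ⟨K * (4 * (‖e‖ + M)) / e.im * Real.exp (M / 2 * (d - c)), ?_⟩
    filter_upwards [hstruct, hK, hr2, eventually_ge_atTop 1, eventually_ge_atTop (M / e.im)]
      with τ h1 h2 h3 h4 h5 x hx
    rw [div_le_iff₀ he] at h5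
    have hτ : 0 < τ := by linarith
    have hk0 : 0 < τ * e.im := by positivity
    set U := waveAmp p (τ * e) 1 (y τ) (y' τ) with hU
    have h6 := IsSol.norm_le_waveAmp (p := p) (ρ := τ * e) (y := y τ) (y' := y' τ) hM
      (show 0 < τ * e.im / 2 by positivity) (by simp; linarith) hx
    rw [mul_div_cancel₀ _ (two_ne_zero)] at h6
    have h7 := h2.2.2 x hx
    have h8 : ‖U c‖ ≤ 4 * (‖e‖ + M) * τ * ‖y τ c‖ := by
      have e1 := congrArg norm h1.2.1
      have e2 : 1 / 2 ≤ ‖1 - r τ‖ := by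
        have := norm_sub_norm_le (1 : ℂ) (r τ)
        rw [norm_one] at this; linarith
      have e3 : ‖(τ : ℂ) * e + p c / 2‖ ≤ (‖e‖ + M) * τ := by
        refine (norm_add_le _ _).trans ?_
        rw [norm_mul, Complex.norm_real, Real.norm_of_nonneg hτ.le, norm_div]
        have := hM c hcm
        simp only [RCLike.norm_ofNat]
        nlinarith
      simp only [norm_mul, Complex.norm_I, RCLike.norm_ofNat, mul_one] at e1
      have e4 : ‖U c‖ * (1 / 2) ≤ 2 * ((‖e‖ + M) * τ) * ‖y τ c‖ := by
        calc ‖U c‖ * (1 / 2) ≤ ‖U c‖ * ‖1 - r τ‖ := by gcongr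
          _ = _ := e1.symm
          _ ≤ _ := by gcongr
      linarith
    have h9 := (norm_wave_bounds (ρ := τ * e) hp.continuousOn hM hcm hx hx.1).2
    have h10 : ‖wave p (τ * e) c x‖ ≤
        Real.exp (M / 2 * (d - c)) * Real.exp (-(τ * e.im * (x - c))) := by
      refine h9.trans ?_
      rw [← Real.exp_add, Real.exp_le_exp]
      have : (x - c) * (M / 2) ≤ (d - c) * (M / 2) := by gcongr; exact hx.2
      simp
      linarith
    refine h6.trans ?_
    rw [div_le_iff₀ hk0]
    calc _ ≤ _ := h7
      _ ≤ K * (Real.exp (M / 2 * (d - c)) * Real.exp (-(τ * e.im * (x - c)))) *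
          (4 * (‖e‖ + M) * τ * ‖y τ c‖) := by gcongr
      _ = _ := by field_simp

end
end

section

/-- The data of a pencil with jumps on the nodes `b 0 < … < b N`; the prime on `η'` marks the
coefficient of `iρ` in the jump condition. -/
structure JumpPencil (N : ℕ) (b : ℕ → ℝ) (γ : ℕ → ℂ) where
  p : ℝ → ℂ
  dp : ℝ → ℂ
  q : ℝ → ℂ
  η' : ℕ → ℂ
  η : ℕ → ℂ
  b_lt : ∀ j < N, b j < b (j + 1)
  p_prim : ∀ j < N, IsPrimitiveOn p dp (b j) (b (j + 1))
  q_int : ∀ j < N, IntervalIntegrable q volume (b j) (b (j + 1))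
  γ_ne : ∀ j, j + 1 < N → γ (j + 1) ≠ 0
  ξ_ne : ∀ j, j + 1 < N → (γ (j + 1) + (γ (j + 1))⁻¹) / 2 - η' (j + 1) / 2 ≠ 0 ∧
    (γ (j + 1) + (γ (j + 1))⁻¹) / 2 + η' (j + 1) / 2 ≠ 0

/-- A solution with jumps, given by its branches `y j` on `[b j, b (j + 1)]`. -/
structure IsJumpSol {N : ℕ} {b : ℕ → ℝ} {γ : ℕ → ℂ} (P : JumpPencil N b γ) (ρ : ℂ)
    (y y' : ℕ → ℝ → ℂ) : Prop where
  sol : ∀ j < N, IsSol P.p P.q ρ (y j) (y' j) (b j) (b (j + 1))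
  jump : ∀ j, j + 1 < N → y (j + 1) (b (j + 1)) = γ (j + 1) * y j (b (j + 1))
  jump' : ∀ j, j + 1 < N → y' (j + 1) (b (j + 1)) = (γ (j + 1))⁻¹ * y' j (b (j + 1)) +
    (I * ρ * P.η' (j + 1) + P.η (j + 1)) * y j (b (j + 1))

variable {N : ℕ} {b : ℕ → ℝ} {γ : ℕ → ℂ} {P : JumpPencil N b γ} {ρ : ℂ}
  {y y' z z' : ℕ → ℝ → ℂ}

namespace JumpPencil

/-- The pencil obtained by replacing `ρ` with `-ρ`. -/
def neg (P : JumpPencil N b γ) : JumpPencil N b γ where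
  p := fun x => -P.p x
  dp := fun x => -P.dp x
  q := P.q
  η' := fun j => -P.η' j
  η := P.η
  b_lt := P.b_lt
  p_prim := fun j hj => by
    have := (P.p_prim j hj).const_mul (-1)
    simpa using this
  q_int := P.q_int
  γ_ne := P.γ_ne
  ξ_ne := fun j hj => ⟨by simpa [neg_div] using (P.ξ_ne j hj).2,
    by simpa [neg_div, ← sub_eq_add_neg] using (P.ξ_ne j hj).1⟩

theorem left_mem (P : JumpPencil N b γ) {j : ℕ} (hj : j < N) : b j ∈ Icc (b j) (b (j + 1)) :=
  left_mem_Icc.2 (P.b_lt j hj).le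

theorem right_mem (P : JumpPencil N b γ) {j : ℕ} (hj : j < N) :
    b (j + 1) ∈ Icc (b j) (b (j + 1)) :=
  right_mem_Icc.2 (P.b_lt j hj).le

theorem p_cont (P : JumpPencil N b γ) {j : ℕ} (hj : j < N) :
    ContinuousOn P.p (Icc (b j) (b (j + 1))) :=
  (P.p_prim j hj).continuousOn

theorem p_int (P : JumpPencil N b γ) {j : ℕ} (hj : j < N) :
    IntervalIntegrable P.p volume (b j) (b (j + 1)) :=
  (P.p_cont hj).intervalIntegrable_of_Icc (P.b_lt j hj).le

end JumpPencil

namespace IsJumpSol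

theorem neg (h : IsJumpSol P ρ y y') : IsJumpSol P.neg (-ρ) y y' where
  sol := fun j hj => by
    obtain ⟨h1, h2⟩ := h.sol j hj
    exact ⟨h1, h2.congr_deriv fun x => by simp [JumpPencil.neg]⟩
  jump := h.jump
  jump' := fun j hj => by rw [h.jump' j hj]; simp [JumpPencil.neg]

theorem add (h : IsJumpSol P ρ y y') (hz : IsJumpSol P ρ z z') :
    IsJumpSol P ρ (fun j x => y j x + z j x) (fun j x => y' j x + z' j x) where
  sol := fun j hj => (h.sol j hj).add (hz.sol j hj)
  jump := fun j hj => by rw [h.jump j hj, hz.jump j hj]; ring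
  jump' := fun j hj => by rw [h.jump' j hj, hz.jump' j hj]; ring

theorem const_mul (h : IsJumpSol P ρ y y') (k : ℂ) :
    IsJumpSol P ρ (fun j x => k * y j x) (fun j x => k * y' j x) where
  sol := fun j hj => (h.sol j hj).const_mul k
  jump := fun j hj => by rw [h.jump j hj]; ring
  jump' := fun j hj => by rw [h.jump' j hj]; ring

/-- The Wronskian of two solutions with jumps is constant. -/
theorem wronskian_eq (h : IsJumpSol P ρ y y') (hz : IsJumpSol P ρ z z') {j : ℕ} (hj : j < N)
    {x : ℝ} (hx : x ∈ Icc (b j) (b (j + 1))) :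
    y j x * z' j x - y' j x * z j x =
      y 0 (b 0) * z' 0 (b 0) - y' 0 (b 0) * z 0 (b 0) := by
  induction j generalizing x with
  | zero => exact (h.sol 0 hj).wronskian_eq (hz.sol 0 hj) hx
  | succ j ih =>
    have hγ := P.γ_ne j hj
    rw [(h.sol _ hj).wronskian_eq (hz.sol _ hj) hx, ← ih (by lia) (P.right_mem (by lia)),
      h.jump j hj, h.jump' j hj, hz.jump j hj, hz.jump' j hj]
    field_simp
    ring

/-- Solutions with jumps whose initial values are of exponential type in `ρ` are of
exponential type. -/
theorem exists_norm_le {y y' : ℂ → ℕ → ℝ → ℂ} (h : ∀ ρ, IsJumpSol P ρ (y ρ) (y' ρ))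
    (h0 : ∃ K, ∀ ρ, ‖y ρ 0 (b 0)‖ + ‖y' ρ 0 (b 0)‖ ≤ Real.exp (K * (1 + ‖ρ‖))) {j : ℕ}
    (hj : j < N) :
    ∃ K, ∀ ρ, ∀ x ∈ Icc (b j) (b (j + 1)),
      ‖y ρ j x‖ + ‖y' ρ j x‖ ≤ Real.exp (K * (1 + ‖ρ‖)) := by
  have step : ∀ j < N, (∃ K, ∀ ρ, ‖y ρ j (b j)‖ + ‖y' ρ j (b j)‖ ≤ Real.exp (K * (1 + ‖ρ‖))) →
      ∃ K, ∀ ρ, ∀ x ∈ Icc (b j) (b (j + 1)),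
        ‖y ρ j x‖ + ‖y' ρ j x‖ ≤ Real.exp (K * (1 + ‖ρ‖)) := by
    rintro j hj ⟨K, hK⟩
    set A := ∫ t in b j..b (j + 1), (1 + ‖P.p t‖ + ‖P.q t‖) with hA
    refine ⟨1 + K + A + (b (j + 1) - b j), fun ρ x hx => ?_⟩
    have key := ((h ρ).sol j hj).norm_le (P.p_int hj) (P.q_int j hj) hx
    have hr := norm_nonneg ρ
    have n1 := norm_nonneg (y ρ j x)
    have n2 := norm_nonneg (y ρ j (b j))
    have n3 := norm_nonneg (y' ρ j (b j))
    have hsub : uIcc (b j) x ⊆ uIcc (b j) (b (j + 1)) := by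
      rw [uIcc_of_le hx.1, uIcc_of_le (P.b_lt j hj).le]; exact Icc_subset_Icc_right hx.2
    have hii : IntervalIntegrable (fun t => 1 + ‖P.p t‖ + ‖P.q t‖) volume (b j) (b (j + 1)) :=
      (intervalIntegrable_const.add (P.p_int hj).norm).add (P.q_int j hj).norm
    have hInt : ∫ t in b j..x, (1 + ‖ρ‖ + ‖P.p t‖ + ‖P.q t‖) ≤
        ‖ρ‖ * (b (j + 1) - b j) + A := by
      have e1 : ∫ t in b j..x, (1 + ‖ρ‖ + ‖P.p t‖ + ‖P.q t‖) =
          ∫ t in b j..x, (‖ρ‖ + (1 + ‖P.p t‖ + ‖P.q t‖)) := by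
        congr 1; ext t; ring
      rw [e1, intervalIntegral.integral_add intervalIntegrable_const (hii.mono_set hsub),
        intervalIntegral.integral_const, smul_eq_mul, mul_comm]
      gcongr
      · exact hx.2
      · rw [hA]
        refine intervalIntegral.integral_mono_interval le_rfl hx.1 hx.2 ?_ hii
        exact Eventually.of_forall fun t => by positivity
    have hA0 : 0 ≤ A := intervalIntegral.integral_nonneg (P.b_lt j hj).le fun t _ => by positivity
    have hb0 := (P.b_lt j hj).le
    calc ‖y ρ j x‖ + ‖y' ρ j x‖ ≤ (1 + ‖ρ‖) * ‖y ρ j x‖ + ‖y' ρ j x‖ := by nlinarith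
      _ ≤ _ := key
      _ ≤ ((1 + ‖ρ‖) * (‖y ρ j (b j)‖ + ‖y' ρ j (b j)‖)) *
          Real.exp (‖ρ‖ * (b (j + 1) - b j) + A) := by
        gcongr
        nlinarith
      _ ≤ (Real.exp (1 + ‖ρ‖) * Real.exp (K * (1 + ‖ρ‖))) *
          Real.exp ((1 + ‖ρ‖) * (b (j + 1) - b j) + A * (1 + ‖ρ‖)) := by
        gcongr
        · linarith [Real.add_one_le_exp (1 + ‖ρ‖)]
        · exact hK ρ
        · linarith
        · nlinarith
      _ = _ := by rw [← Real.exp_add, ← Real.exp_add]; congr 1; ring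
  induction j with
  | zero => exact step 0 hj h0
  | succ j ih =>
    obtain ⟨K, hK⟩ := ih (by lia)
    refine step (j + 1) hj ⟨‖γ (j + 1)‖ + ‖(γ (j + 1))⁻¹‖ + ‖P.η' (j + 1)‖ + ‖P.η (j + 1)‖ + K,
      fun ρ => ?_⟩
    rw [(h ρ).jump j hj, (h ρ).jump' j hj]
    have hKb := hK ρ _ (P.right_mem (by lia))
    have hr := norm_nonneg ρ
    set u := y ρ j (b (j + 1))
    set u' := y' ρ j (b (j + 1))
    have n1 := norm_nonneg u
    have n2 := norm_nonneg u'
    set G := ‖γ (j + 1)‖ + ‖(γ (j + 1))⁻¹‖ + ‖P.η' (j + 1)‖ + ‖P.η (j + 1)‖ with hG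
    have g1 := norm_nonneg (γ (j + 1))
    have g2 := norm_nonneg (γ (j + 1))⁻¹
    have g3 := norm_nonneg (P.η' (j + 1))
    have g4 := norm_nonneg (P.η (j + 1))
    have t1 : ‖I * ρ * P.η' (j + 1) + P.η (j + 1)‖ ≤ ‖ρ‖ * ‖P.η' (j + 1)‖ + ‖P.η (j + 1)‖ := by
      refine (norm_add_le _ _).trans ?_
      simp
    calc ‖γ (j + 1) * u‖ + ‖(γ (j + 1))⁻¹ * u' + (I * ρ * P.η' (j + 1) + P.η (j + 1)) * u‖
        ≤ ‖γ (j + 1)‖ * ‖u‖ + (‖(γ (j + 1))⁻¹‖ * ‖u'‖ +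
          (‖ρ‖ * ‖P.η' (j + 1)‖ + ‖P.η (j + 1)‖) * ‖u‖) := by
          rw [norm_mul]
          refine add_le_add_right ((norm_add_le _ _).trans ?_) _
          rw [norm_mul, norm_mul]
          gcongr
      _ ≤ (G * (1 + ‖ρ‖)) * (‖u‖ + ‖u'‖) := by
          have q1 := mul_nonneg g1 n2
          have q2 := mul_nonneg g2 n1
          have q3 := mul_nonneg g3 n1
          have q4 := mul_nonneg g4 n2
          have q5 := mul_nonneg g3 n2
          have r1 := mul_nonneg hr (mul_nonneg g1 n1)
          have r2 := mul_nonneg hr q1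
          have r3 := mul_nonneg hr q2
          have r4 := mul_nonneg hr (mul_nonneg g2 n2)
          have r5 := mul_nonneg hr q5
          have r6 := mul_nonneg hr q4
          have r7 := mul_nonneg hr (mul_nonneg g4 n1)
          rw [hG]
          linarith
      _ ≤ Real.exp (G * (1 + ‖ρ‖)) * Real.exp (K * (1 + ‖ρ‖)) := by
          gcongr
          linarith [Real.add_one_le_exp (G * (1 + ‖ρ‖))]
      _ = _ := by rw [← Real.exp_add]; congr 1; ring

end IsJumpSol

/-- The fundamental system `C, S` of the pencil, normalised at `b 0`. -/
structure FundSys (P : JumpPencil N b γ) (c c' s s' : ℂ → ℕ → ℝ → ℂ) : Prop where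
  hc : ∀ ρ, IsJumpSol P ρ (c ρ) (c' ρ)
  hs : ∀ ρ, IsJumpSol P ρ (s ρ) (s' ρ)
  c_init : ∀ ρ, c ρ 0 (b 0) = 1
  c_init' : ∀ ρ, c' ρ 0 (b 0) = 0
  s_init : ∀ ρ, s ρ 0 (b 0) = 0
  s_init' : ∀ ρ, s' ρ 0 (b 0) = 1

namespace FundSys

variable {c c' s s' : ℂ → ℕ → ℝ → ℂ} {j : ℕ} {x : ℝ}

theorem wronskian (h : FundSys P c c' s s') (ρ : ℂ) (hj : j < N)
    (hx : x ∈ Icc (b j) (b (j + 1))) : c ρ j x * s' ρ j x - c' ρ j x * s ρ j x = 1 := by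
  rw [(h.hc ρ).wronskian_eq (h.hs ρ) hj hx, h.c_init, h.c_init', h.s_init, h.s_init']
  ring

theorem differentiable (h : FundSys P c c' s s') {y y' : ℂ → ℕ → ℝ → ℂ}
    (hy : ∀ ρ, IsJumpSol P ρ (y ρ) (y' ρ)) (h0 : Differentiable ℂ fun ρ => y ρ 0 (b 0))
    (h0' : Differentiable ℂ fun ρ => y' ρ 0 (b 0)) (hj : j < N)
    (hx : x ∈ Icc (b j) (b (j + 1))) :
    Differentiable ℂ (fun ρ => y ρ j x) ∧ Differentiable ℂ (fun ρ => y' ρ j x) := by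
  have step : ∀ j < N, Differentiable ℂ (fun ρ => y ρ j (b j)) →
      Differentiable ℂ (fun ρ => y' ρ j (b j)) → ∀ x ∈ Icc (b j) (b (j + 1)),
      Differentiable ℂ (fun ρ => y ρ j x) ∧ Differentiable ℂ (fun ρ => y' ρ j x) := by
    intro j hj h1 h2 x hx
    have := fun ρ₀ => IsSol.differentiableAt_param (fun ρ => (hy ρ).sol j hj)
      ((h.hc ρ₀).sol j hj) ((h.hs ρ₀).sol j hj) (h.wronskian ρ₀ hj (P.left_mem hj))
      (P.p_cont hj) (P.q_int j hj) (h1 ρ₀) (h2 ρ₀) hx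
    exact ⟨fun ρ => (this ρ).1, fun ρ => (this ρ).2⟩
  induction j generalizing x with
  | zero => exact step 0 hj h0 h0' x hx
  | succ j ih =>
    obtain ⟨h1, h2⟩ := ih (by lia) (P.right_mem (by lia))
    refine step (j + 1) hj ?_ ?_ x hx
    · simp_rw [fun ρ => (hy ρ).jump j hj]
      fun_prop
    · simp_rw [fun ρ => (hy ρ).jump' j hj]
      fun_prop

theorem differentiable_c (h : FundSys P c c' s s') (hj : j < N)
    (hx : x ∈ Icc (b j) (b (j + 1))) :
    Differentiable ℂ (fun ρ => c ρ j x) ∧ Differentiable ℂ (fun ρ => c' ρ j x) :=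
  h.differentiable h.hc (by simp [h.c_init]) (by simp [h.c_init']) hj hx

theorem differentiable_s (h : FundSys P c c' s s') (hj : j < N)
    (hx : x ∈ Icc (b j) (b (j + 1))) :
    Differentiable ℂ (fun ρ => s ρ j x) ∧ Differentiable ℂ (fun ρ => s' ρ j x) :=
  h.differentiable h.hs (by simp [h.s_init]) (by simp [h.s_init']) hj hx

theorem expType_c (h : FundSys P c c' s s') (hj : j < N) (hx : x ∈ Icc (b j) (b (j + 1))) :
    ExpType (fun ρ => c ρ j x) ∧ ExpType (fun ρ => c' ρ j x) := by
  obtain ⟨K, hK⟩ := IsJumpSol.exists_norm_le h.hc ⟨0, by simp [h.c_init, h.c_init']⟩ hj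
  exact ⟨⟨K, fun ρ => (le_add_of_nonneg_right (norm_nonneg _)).trans (hK ρ x hx)⟩,
    ⟨K, fun ρ => (le_add_of_nonneg_left (norm_nonneg _)).trans (hK ρ x hx)⟩⟩

theorem expType_s (h : FundSys P c c' s s') (hj : j < N) (hx : x ∈ Icc (b j) (b (j + 1))) :
    ExpType (fun ρ => s ρ j x) ∧ ExpType (fun ρ => s' ρ j x) := by
  obtain ⟨K, hK⟩ := IsJumpSol.exists_norm_le h.hs ⟨0, by simp [h.s_init, h.s_init']⟩ hj
  exact ⟨⟨K, fun ρ => (le_add_of_nonneg_right (norm_nonneg _)).trans (hK ρ x hx)⟩,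
    ⟨K, fun ρ => (le_add_of_nonneg_left (norm_nonneg _)).trans (hK ρ x hx)⟩⟩

end FundSys

end

section

/-- The jump condition turns the Weyl asymptotics on the right of a node into the outgoing
condition on its left. -/
theorem outgoing_of_jump {e g a' a L : ℂ} {v v' u u' : ℝ → ℂ} (he : 0 < e.im) (hg : g ≠ 0)
    (hξ : (g + g⁻¹) / 2 - a' / 2 ≠ 0) (hu : ∀ τ, u τ = g * v τ)
    (hu' : ∀ τ : ℝ, u' τ = g⁻¹ * v' τ + (I * (τ * e) * a' + a) * v τ)
    (hne : ∀ᶠ τ in atTop, u τ ≠ 0)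
    (hlim : Tendsto (fun τ : ℝ => u' τ / u τ - I * (τ * e)) atTop (𝓝 L)) : Outgoing e v v' := by
  have he0 : e ≠ 0 := fun h => by simp [h] at he
  have hinv : Tendsto (fun τ : ℝ => ((τ : ℂ))⁻¹) atTop (𝓝 0) := by
    have := (continuous_ofReal.tendsto 0).comp tendsto_inv_atTop_zero
    simpa [Function.comp_def] using this
  have hw : Tendsto (fun τ : ℝ => v' τ / (τ * v τ)) atTop (𝓝 (I * e * (g ^ 2 - g * a'))) := by
    have h1 := (((hlim.const_mul (g ^ 2)).sub_const (g * a)).mul hinv).add_const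
      (I * e * (g ^ 2 - g * a'))
    rw [mul_zero, zero_add] at h1
    refine h1.congr' ?_
    filter_upwards [hne, eventually_gt_atTop 0] with τ h2 h3
    rw [hu] at h2
    have h4 : v τ ≠ 0 := right_ne_zero_of_mul h2
    have h5 : (τ : ℂ) ≠ 0 := by exact_mod_cast h3.ne'
    rw [hu, hu']
    field_simp
    ring
  have hw2 : Tendsto (fun τ : ℝ => v' τ / (τ * v τ) + I * e) atTop
      (𝓝 (I * e * (g ^ 2 - g * a') + I * e)) := hw.add_const _
  have hl0 : I * e * (g ^ 2 - g * a') + I * e ≠ 0 := by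
    have : I * e * (g ^ 2 - g * a') + I * e = 2 * I * e * g * ((g + g⁻¹) / 2 - a' / 2) := by
      field_simp; ring
    rw [this]
    exact mul_ne_zero (mul_ne_zero (mul_ne_zero (by simp) he0) hg) hξ
  have hne2 := hw2.eventually_ne hl0
  have hev : ∀ᶠ τ : ℝ in atTop, v τ ≠ 0 ∧ 0 < τ ∧ v' τ + I * (τ * e) * v τ =
      (τ * v τ) * (v' τ / (τ * v τ) + I * e) ∧ v' τ = (τ * v τ) * (v' τ / (τ * v τ)) := by
    filter_upwards [hne, eventually_gt_atTop 0] with τ h2 h3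
    rw [hu] at h2
    have h4 : v τ ≠ 0 := right_ne_zero_of_mul h2
    have h5 : (τ : ℂ) ≠ 0 := by exact_mod_cast h3.ne'
    exact ⟨h4, h3, by field_simp, by field_simp⟩
  refine ⟨?_, ?_⟩
  · filter_upwards [hev, hne2] with τ h1 h2
    rw [h1.2.2.1]
    exact mul_ne_zero (mul_ne_zero (by exact_mod_cast h1.2.1.ne') h1.1) h2
  · have hq := (hw.norm.add_const 1).div hw2.norm (norm_ne_zero_iff.2 hl0)
    obtain ⟨K₀, hK₀⟩ : ∃ K₀ : ℝ, ∀ᶠ τ : ℝ in atTop,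
        (‖v' τ / (τ * v τ)‖ + 1) / ‖v' τ / (τ * v τ) + I * e‖ ≤ K₀ :=
      ⟨_, hq.eventually_le_const (lt_add_one _)⟩
    refine ⟨K₀, ?_⟩
    filter_upwards [hev, hne2, hK₀] with τ h1 h2 h3
    obtain ⟨h4, h5, h6, h7⟩ := h1
    rw [div_le_iff₀ (norm_pos_iff.2 h2)] at h3
    rw [h6, norm_mul]
    conv_lhs => rw [h7]
    rw [norm_mul, norm_mul, Complex.norm_real, Real.norm_of_nonneg h5.le]
    calc _ = τ * ‖v τ‖ * (‖v' τ / (τ * v τ)‖ + 1) := by ring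
      _ ≤ _ := mul_le_mul_of_nonneg_left h3 (by positivity)
      _ = _ := by ring

/-- Growth of a family of solutions on a ray in the upper half plane. -/
theorem IsSol.eventually_forward_le {p dp q : ℝ → ℂ} {e : ℂ} {y y' : ℝ → ℝ → ℂ} {c d : ℝ}
    (he : 0 < e.im) (hcd : c < d) (hp : IsPrimitiveOn p dp c d)
    (hq : IntervalIntegrable q volume c d)
    (h : ∀ τ : ℝ, IsSol p q (τ * e) (y τ) (y' τ) c d) :
    ∃ K, 0 < K ∧ ∀ᶠ τ : ℝ in atTop, ∀ x ∈ Icc c d, τ * ‖y τ x‖ + ‖y' τ x‖ ≤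
      K * (τ * ‖y τ c‖ + ‖y' τ c‖) * Real.exp (τ * e.im * (x - c)) := by
  obtain ⟨M, hM⟩ := isCompact_Icc.exists_bound_of_continuousOn hp.continuousOn
  have hcm : c ∈ Icc c d := left_mem_Icc.2 hcd.le
  have hM0 : 0 ≤ M := (norm_nonneg _).trans (hM c hcm)
  set A := ∫ t in c..d, (‖wavePot p dp q 1 t‖ + ‖wavePot p dp q (-1) t‖) with hA
  have hA0 : 0 ≤ A := intervalIntegral.integral_nonneg hcd.le fun t _ => by positivity
  set G := 2 * (1 + ‖e‖ + M) with hG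
  have hG0 : 0 < G := by positivity
  refine ⟨(1 / e.im + 1) * (G * Real.exp A * Real.exp (M / 2 * (d - c))), by positivity, ?_⟩
  filter_upwards [eventually_ge_atTop 1, eventually_ge_atTop (M / e.im),
    eventually_ge_atTop (1 / e.im)] with τ h1 h2 h3 x hx
  rw [div_le_iff₀ he] at h2 h3
  have hτ : 0 < τ := by linarith
  have hk0 : 0 < τ * e.im := by positivity
  have hκ : 0 < τ * e.im / 2 := by positivity
  set U := waveAmp p (τ * e) 1 (y τ) (y' τ) with hU
  set V := waveAmp p (τ * e) (-1) (y τ) (y' τ) with hV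
  set B := (‖U c‖ + ‖V c‖) * Real.exp (A / (2 * (τ * e.im / 2))) with hB
  have hρ : τ * e.im / 2 + M / 2 ≤ ((τ : ℂ) * e).im := by simp; linarith
  have key := ((h τ).wave_forward hp hq hcd.le hM hκ hρ hA hB).1 x hx
  have h6 := IsSol.norm_le_waveAmp (p := p) (ρ := τ * e) (y := y τ) (y' := y' τ) hM hκ hρ hx
  rw [mul_div_cancel₀ _ (two_ne_zero)] at h6 hB
  have hy : τ * ‖y τ x‖ ≤ (‖U x‖ + ‖V x‖) / e.im := by
    rw [le_div_iff₀ he]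
    rw [le_div_iff₀ hk0] at h6
    linarith
  have hy' : ‖y' τ x‖ ≤ ‖U x‖ + ‖V x‖ := by
    have e1 : 2 * y' τ x = U x + V x := by simp only [hU, hV, waveAmp]; ring
    have e2 := congrArg norm e1
    rw [norm_mul, RCLike.norm_ofNat] at e2
    linarith [norm_add_le (U x) (V x), norm_nonneg (y' τ x)]
  have hamp : ∀ σ : ℂ, ‖σ‖ = 1 → ‖waveAmp p (τ * e) σ (y τ) (y' τ) c‖ ≤
      G / 2 * (τ * ‖y τ c‖ + ‖y' τ c‖) := by
    intro σ hσ
    refine (norm_add_le _ _).trans ?_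
    have e3 : ‖(τ : ℂ) * e + p c / 2‖ ≤ (‖e‖ + M) * τ := by
      refine (norm_add_le _ _).trans ?_
      rw [norm_mul, Complex.norm_real, Real.norm_of_nonneg hτ.le, norm_div]
      have := hM c hcm
      simp only [RCLike.norm_ofNat]
      nlinarith
    rw [norm_mul, norm_mul, norm_mul, hσ, Complex.norm_I, one_mul, one_mul]
    have n1 := norm_nonneg (y τ c)
    have n2 := norm_nonneg (y' τ c)
    have n3 := norm_nonneg e
    have e4 : ‖(τ : ℂ) * e + p c / 2‖ * ‖y τ c‖ ≤ (‖e‖ + M) * τ * ‖y τ c‖ := by gcongr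
    have e5 : 0 ≤ (‖e‖ + M) * ‖y' τ c‖ := by positivity
    have e6 : 0 ≤ τ * ‖y τ c‖ := by positivity
    rw [hG]
    linarith
  have hUV : ‖U c‖ + ‖V c‖ ≤ G * (τ * ‖y τ c‖ + ‖y' τ c‖) := by
    linarith [hamp 1 (by simp), hamp (-1) (by simp)]
  have hBb : B ≤ G * (τ * ‖y τ c‖ + ‖y' τ c‖) * Real.exp A := by
    rw [hB]; gcongr
    exact div_le_self hA0 h3
  have hw := (norm_wave_bounds (ρ := τ * e) hp.continuousOn hM hcm hx hx.1).1
  have hUVx : ‖U x‖ + ‖V x‖ ≤ G * Real.exp A * Real.exp (M / 2 * (d - c)) *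
      (τ * ‖y τ c‖ + ‖y' τ c‖) * Real.exp (τ * e.im * (x - c)) := by
    have e1 : Real.exp (-((((τ : ℂ) * e).im + M / 2) * (x - c))) * (‖U x‖ + ‖V x‖) ≤
        G * (τ * ‖y τ c‖ + ‖y' τ c‖) * Real.exp A :=
      (mul_le_mul_of_nonneg_right hw (by positivity)).trans (key.trans hBb)
    rw [Real.exp_neg, ← div_eq_inv_mul, div_le_iff₀ (Real.exp_pos _)] at e1
    refine e1.trans ?_
    have e2 : Real.exp ((((τ : ℂ) * e).im + M / 2) * (x - c)) ≤
        Real.exp (M / 2 * (d - c)) * Real.exp (τ * e.im * (x - c)) := by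
      rw [← Real.exp_add, Real.exp_le_exp]
      have : (x - c) * (M / 2) ≤ (d - c) * (M / 2) := by gcongr; exact hx.2
      simp
      linarith
    calc _ ≤ G * (τ * ‖y τ c‖ + ‖y' τ c‖) * Real.exp A *
        (Real.exp (M / 2 * (d - c)) * Real.exp (τ * e.im * (x - c))) := by gcongr
      _ = _ := by ring
  calc τ * ‖y τ x‖ + ‖y' τ x‖ ≤ (1 / e.im + 1) * (‖U x‖ + ‖V x‖) := by
        linarith [hy, hy', (by ring : (‖U x‖ + ‖V x‖) / e.im = 1 / e.im * (‖U x‖ + ‖V x‖))]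
    _ ≤ _ := mul_le_mul_of_nonneg_left hUVx (by positivity)
    _ = _ := by ring

namespace IsJumpSol

variable {N : ℕ} {b : ℕ → ℝ} {γ : ℕ → ℂ} {P : JumpPencil N b γ} {e : ℂ}
  {y y' : ℝ → ℕ → ℝ → ℂ}

/-- Asymptotics on every branch of a family of solutions with jumps that is outgoing at the
right end. -/
theorem weylDecay (he : 0 < e.im) (h : ∀ τ : ℝ, IsJumpSol P (τ * e) (y τ) (y' τ)) {n : ℕ}
    (hn : n + 1 = N) (ho : Outgoing e (fun τ => y τ n (b (n + 1))) fun τ => y' τ n (b (n + 1)))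
    {j : ℕ} (hj : j < N) :
    WeylDecay P.p e (fun τ => y τ j) (fun τ => y' τ j) (b j) (b (j + 1)) := by
  have step : ∀ j < N, Outgoing e (fun τ => y τ j (b (j + 1))) (fun τ => y' τ j (b (j + 1))) →
      WeylDecay P.p e (fun τ => y τ j) (fun τ => y' τ j) (b j) (b (j + 1)) := fun j hj ho =>
    ho.weylDecay he (P.b_lt j hj) (P.p_prim j hj) (P.q_int j hj) fun τ => (h τ).sol j hj
  have main : ∀ k j, j + k + 1 = N →
      WeylDecay P.p e (fun τ => y τ j) (fun τ => y' τ j) (b j) (b (j + 1)) := by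
    intro k
    induction k with
    | zero =>
      intro j hj
      obtain rfl : j = n := by lia
      exact step j (by lia) ho
    | succ k ih =>
      intro j hj
      have hj1 : j + 1 < N := by lia
      have hw := ih (j + 1) (by lia)
      exact step j (by lia) (outgoing_of_jump he (P.γ_ne j hj1) (P.ξ_ne j hj1).1
        (fun τ => (h τ).jump j hj1) (fun τ => (h τ).jump' j hj1) hw.ne hw.lim)
  exact main (N - 1 - j) j (by lia)

/-- Decay on every branch relative to the value at the left end. -/
theorem eventually_decay (h : ∀ τ : ℝ, IsJumpSol P (τ * e) (y τ) (y' τ))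
    (hw : ∀ j < N, WeylDecay P.p e (fun τ => y τ j) (fun τ => y' τ j) (b j) (b (j + 1)))
    {j : ℕ} (hj : j < N) :
    ∃ K, 0 < K ∧ ∀ᶠ τ : ℝ in atTop, ∀ x ∈ Icc (b j) (b (j + 1)),
      ‖y τ j x‖ ≤ K * ‖y τ 0 (b 0)‖ * Real.exp (-(τ * e.im * (x - b 0))) := by
  induction j with
  | zero =>
    obtain ⟨K, hK⟩ := (hw 0 hj).decay
    refine ⟨max K 1, by positivity, hK.mono fun τ h1 x hx => (h1 x hx).trans ?_⟩
    gcongr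
    exact le_max_left _ _
  | succ j ih =>
    obtain ⟨K, hK0, hK⟩ := ih (by lia)
    obtain ⟨K', hK'⟩ := (hw (j + 1) hj).decay
    refine ⟨max K' 1 * ‖γ (j + 1)‖ * K, ?_, ?_⟩
    · have := norm_pos_iff.2 (P.γ_ne j hj)
      positivity
    filter_upwards [hK, hK'] with τ h1 h2 x hx
    have h3 := h1 _ (P.right_mem (by lia))
    have h4 := h2 x hx
    rw [(h τ).jump j hj, norm_mul] at h4
    calc ‖y τ (j + 1) x‖ ≤ _ := h4
      _ ≤ max K' 1 * (‖γ (j + 1)‖ *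
          (K * ‖y τ 0 (b 0)‖ * Real.exp (-(τ * e.im * (b (j + 1) - b 0))))) *
          Real.exp (-(τ * e.im * (x - b (j + 1)))) := by
        gcongr
        exact le_max_left _ _
      _ = max K' 1 * ‖γ (j + 1)‖ * K * ‖y τ 0 (b 0)‖ *
          (Real.exp (-(τ * e.im * (b (j + 1) - b 0))) *
          Real.exp (-(τ * e.im * (x - b (j + 1))))) := by ring
      _ = _ := by rw [← Real.exp_add]; congr 2; ring

/-- Growth on every branch relative to the values at the left end. -/
theorem eventually_growth (he : 0 < e.im) (h : ∀ τ : ℝ, IsJumpSol P (τ * e) (y τ) (y' τ))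
    {j : ℕ} (hj : j < N) :
    ∃ K, 0 < K ∧ ∀ᶠ τ : ℝ in atTop, ∀ x ∈ Icc (b j) (b (j + 1)),
      τ * ‖y τ j x‖ + ‖y' τ j x‖ ≤
        K * (τ * ‖y τ 0 (b 0)‖ + ‖y' τ 0 (b 0)‖) * Real.exp (τ * e.im * (x - b 0)) := by
  have step := fun j (hj : j < N) => IsSol.eventually_forward_le he (P.b_lt j hj)
    (P.p_prim j hj) (P.q_int j hj) fun τ => (h τ).sol j hj
  induction j with
  | zero => exact step 0 hj
  | succ j ih =>
    obtain ⟨K, hK0, hK⟩ := ih (by lia)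
    obtain ⟨K', hK0', hK'⟩ := step (j + 1) hj
    set G := ‖γ (j + 1)‖ + ‖(γ (j + 1))⁻¹‖ + ‖e‖ * ‖P.η' (j + 1)‖ + ‖P.η (j + 1)‖ with hG
    have g1 := norm_pos_iff.2 (P.γ_ne j hj)
    refine ⟨K' * G * K, by positivity, ?_⟩
    filter_upwards [hK, hK', eventually_ge_atTop 1] with τ h1 h2 hτ x hx
    have h3 := h1 _ (P.right_mem (by lia))
    set u := y τ j (b (j + 1)) with hu
    set u' := y' τ j (b (j + 1)) with hu'
    have h4 : τ * ‖y τ (j + 1) (b (j + 1))‖ + ‖y' τ (j + 1) (b (j + 1))‖ ≤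
        G * (τ * ‖u‖ + ‖u'‖) := by
      rw [(h τ).jump j hj, (h τ).jump' j hj, norm_mul]
      have t1 : ‖I * (τ * e) * P.η' (j + 1) + P.η (j + 1)‖ ≤
          τ * (‖e‖ * ‖P.η' (j + 1)‖ + ‖P.η (j + 1)‖) := by
        refine (norm_add_le _ _).trans ?_
        rw [norm_mul, norm_mul, norm_mul, Complex.norm_I, Complex.norm_real,
          Real.norm_of_nonneg (by linarith)]
        have := norm_nonneg (P.η (j + 1))
        nlinarith
      have t2 : ‖(γ (j + 1))⁻¹ * u' + (I * (τ * e) * P.η' (j + 1) + P.η (j + 1)) * u‖ ≤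
          ‖(γ (j + 1))⁻¹‖ * ‖u'‖ + τ * (‖e‖ * ‖P.η' (j + 1)‖ + ‖P.η (j + 1)‖) * ‖u‖ := by
        refine (norm_add_le _ _).trans ?_
        rw [norm_mul, norm_mul]
        gcongr
      have q1 : 0 ≤ ‖γ (j + 1)‖ * ‖u'‖ := by positivity
      have q2 : 0 ≤ ‖(γ (j + 1))⁻¹‖ * (τ * ‖u‖) := by positivity
      have q3 : 0 ≤ (‖e‖ * ‖P.η' (j + 1)‖ + ‖P.η (j + 1)‖) * ‖u'‖ := by positivity
      rw [hG]
      linarith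
    calc _ ≤ _ := h2 x hx
      _ ≤ K' * (G * (K * (τ * ‖y τ 0 (b 0)‖ + ‖y' τ 0 (b 0)‖) *
          Real.exp (τ * e.im * (b (j + 1) - b 0)))) *
          Real.exp (τ * e.im * (x - b (j + 1))) := by
        gcongr
        exact h4.trans (by gcongr)
      _ = K' * G * K * (τ * ‖y τ 0 (b 0)‖ + ‖y' τ 0 (b 0)‖) *
          (Real.exp (τ * e.im * (b (j + 1) - b 0)) *
          Real.exp (τ * e.im * (x - b (j + 1)))) := by ring
      _ = _ := by rw [← Real.exp_add]; congr 2; ring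

end IsJumpSol

end

section

variable {N : ℕ} {b : ℕ → ℝ} {γ : ℕ → ℂ} {P : JumpPencil N b γ}
  {c c' s s' : ℂ → ℕ → ℝ → ℂ} {n : ℕ}

/-- The combination `C(T) v - S(T) u`; for `u, v = C, S` it is the solution vanishing at the
right end `T = b (n + 1)`. -/
def weylSol (b : ℕ → ℝ) (n : ℕ) (c s u v : ℂ → ℕ → ℝ → ℂ) (ρ : ℂ) (j : ℕ) (x : ℝ) : ℂ :=
  c ρ n (b (n + 1)) * v ρ j x - s ρ n (b (n + 1)) * u ρ j x

/-- Asymptotics of the fundamental system along the ray `τ e`, where `ε` is the sign of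
`Im e`. -/
structure RayAsymp (P : JumpPencil N b γ) (c c' s s' : ℂ → ℕ → ℝ → ℂ) (n : ℕ) (e ε : ℂ) :
    Prop where
  ne : ∀ j < N, ∀ᶠ τ : ℝ in atTop, weylSol b n c s c s (τ * e) j (b j) ≠ 0
  lim : ∀ j < N, Tendsto (fun τ : ℝ => weylSol b n c s c' s' (τ * e) j (b j) /
    weylSol b n c s c s (τ * e) j (b j) - ε * I * (τ * e)) atTop (𝓝 (ε * I * P.p (b j) / 2))
  decay : ∀ j < N, ∃ K, 0 < K ∧ ∀ᶠ τ : ℝ in atTop, ∀ x ∈ Icc (b j) (b (j + 1)),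
    ‖weylSol b n c s c s (τ * e) j x‖ ≤
      K * ‖s (τ * e) n (b (n + 1))‖ * Real.exp (-(τ * |e.im| * (x - b 0)))
  growth : ∀ j < N, ∃ K, 0 < K ∧ ∀ᶠ τ : ℝ in atTop, ∀ x ∈ Icc (b j) (b (j + 1)),
    τ * ‖s (τ * e) j x‖ ≤ K * Real.exp (τ * |e.im| * (x - b 0))

namespace FundSys

theorem isJumpSol_weylSol (h : FundSys P c c' s s') (n : ℕ) (ρ : ℂ) :
    IsJumpSol P ρ (weylSol b n c s c s ρ) (weylSol b n c s c' s' ρ) := by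
  have := ((h.hs ρ).const_mul (c ρ n (b (n + 1)))).add
    ((h.hc ρ).const_mul (-s ρ n (b (n + 1))))
  convert this using 3 <;> simp [weylSol, sub_eq_add_neg]

theorem weylSol_init (h : FundSys P c c' s s') (n : ℕ) (ρ : ℂ) :
    weylSol b n c s c s ρ 0 (b 0) = -s ρ n (b (n + 1)) ∧
      weylSol b n c s c' s' ρ 0 (b 0) = c ρ n (b (n + 1)) := by
  simp [weylSol, h.c_init, h.c_init', h.s_init, h.s_init']

/-- Estimates for the fundamental system along a ray that is mapped to the ray `τ e₁` in the
upper half plane of a pencil `P₁`. -/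
theorem ray_estimates (h : FundSys P c c' s s') (hn : n + 1 = N) {P₁ : JumpPencil N b γ}
    {e e₁ : ℂ} (he₁ : 0 < e₁.im)
    (hP : ∀ (τ : ℝ) y y', IsJumpSol P (τ * e) y y' → IsJumpSol P₁ (τ * e₁) y y') :
    (∀ j < N, WeylDecay P₁.p e₁ (fun τ => weylSol b n c s c s (τ * e) j)
      (fun τ => weylSol b n c s c' s' (τ * e) j) (b j) (b (j + 1))) ∧
    (∀ j < N, ∃ K, 0 < K ∧ ∀ᶠ τ : ℝ in atTop, ∀ x ∈ Icc (b j) (b (j + 1)),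
      ‖weylSol b n c s c s (τ * e) j x‖ ≤
        K * ‖s (τ * e) n (b (n + 1))‖ * Real.exp (-(τ * e₁.im * (x - b 0)))) ∧
    ∀ j < N, ∃ K, 0 < K ∧ ∀ᶠ τ : ℝ in atTop, ∀ x ∈ Icc (b j) (b (j + 1)),
      τ * ‖s (τ * e) j x‖ ≤ K * Real.exp (τ * e₁.im * (x - b 0)) := by
  have hψ : ∀ τ : ℝ, IsJumpSol P₁ (τ * e₁) (weylSol b n c s c s (τ * e))
      (weylSol b n c s c' s' (τ * e)) := fun τ => hP τ _ _ (h.isJumpSol_weylSol n _)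
  have hend : ∀ ρ, weylSol b n c s c s ρ n (b (n + 1)) = 0 ∧
      weylSol b n c s c' s' ρ n (b (n + 1)) = 1 := fun ρ => by
    have := h.wronskian ρ (show n < N by lia) (P.right_mem (by lia))
    simp only [weylSol]
    exact ⟨by ring, by linear_combination this⟩
  have ho : Outgoing e₁ (fun τ => weylSol b n c s c s (τ * e) n (b (n + 1)))
      (fun τ => weylSol b n c s c' s' (τ * e) n (b (n + 1))) := by
    refine ⟨Eventually.of_forall fun τ => ?_, 1, Eventually.of_forall fun τ => ?_⟩ <;>
      simp [(hend _).1, (hend _).2]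
  have hw : ∀ j < N, WeylDecay P₁.p e₁ (fun τ => weylSol b n c s c s (τ * e) j)
      (fun τ => weylSol b n c s c' s' (τ * e) j) (b j) (b (j + 1)) := fun j hj =>
    IsJumpSol.weylDecay he₁ hψ hn ho hj
  refine ⟨hw, fun j hj => ?_, fun j hj => ?_⟩
  · obtain ⟨K, hK0, hK⟩ := IsJumpSol.eventually_decay hψ hw hj
    refine ⟨K, hK0, hK.mono fun τ h1 x hx => ?_⟩
    have := h1 x hx
    rwa [(h.weylSol_init n _).1, norm_neg] at this
  · obtain ⟨K, hK0, hK⟩ := IsJumpSol.eventually_growth he₁ (fun τ => hP τ _ _ (h.hs _)) hj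
    refine ⟨K, hK0, hK.mono fun τ h1 x hx => ?_⟩
    have := h1 x hx
    rw [h.s_init, h.s_init', norm_zero, mul_zero, zero_add, norm_one, mul_one] at this
    exact (le_add_of_nonneg_right (norm_nonneg _)).trans this

theorem rayAsymp_of_pos (h : FundSys P c c' s s') (hn : n + 1 = N) {e : ℂ} (he : 0 < e.im) :
    RayAsymp P c c' s s' n e 1 := by
  obtain ⟨h1, h2, h3⟩ := h.ray_estimates hn he (e := e) fun _ _ _ => id
  rw [← abs_of_pos he] at h2 h3
  exact ⟨fun j hj => (h1 j hj).ne, fun j hj => by simpa using (h1 j hj).lim, h2, h3⟩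

theorem rayAsymp_of_neg (h : FundSys P c c' s s') (hn : n + 1 = N) {e : ℂ} (he : e.im < 0) :
    RayAsymp P c c' s s' n e (-1) := by
  have he₁ : 0 < (-e).im := by simpa using he
  obtain ⟨h1, h2, h3⟩ := h.ray_estimates hn he₁ (e := e) (P₁ := P.neg) fun τ y y' hy => by
    rw [mul_neg]; exact hy.neg
  rw [neg_im, ← abs_of_neg he] at h2 h3
  refine ⟨fun j hj => (h1 j hj).ne, fun j hj => ?_, h2, h3⟩
  have := (h1 j hj).lim
  simpa [JumpPencil.neg] using this

theorem exists_rayAsymp (h : FundSys P c c' s s') (hn : n + 1 = N) {e : ℂ} (he : e.im ≠ 0) :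
    ∃ ε, RayAsymp P c c' s s' n e ε := by
  rcases he.lt_or_gt with he | he
  exacts [⟨_, h.rayAsymp_of_neg hn he⟩, ⟨_, h.rayAsymp_of_pos hn he⟩]

end FundSys

end

section

theorem eq_of_sq_eq_of_omegaSign_eq {z w : ℂ} (h : z ^ 2 = w ^ 2)
    (ho : omegaSign z = omegaSign w) : z = w := by
  rcases sq_eq_sq_iff_eq_or_eq_neg.1 h with h1 | h1
  · exact h1
  by_cases hw : w = 0
  · simp [h1, hw]
  exfalso
  have hne : w.re ≠ 0 ∨ w.im ≠ 0 := by
    by_contra hcon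
    push Not at hcon
    exact hw (Complex.ext hcon.1 hcon.2)
  simp only [h1, omegaSign, neg_eq_zero, hw, if_false, arg_nonneg_iff, arg_lt_pi_iff, neg_im,
    neg_re] at ho
  split_ifs at ho with h2 h3 h3
  · rcases hne with hne | hne
    · rcases lt_trichotomy w.im 0 with h4 | h4 | h4
      · linarith [h3.1]
      · rcases h2.2 with h5 | h5
        · rcases h3.2 with h6 | h6
          · exact hne (by linarith)
          · exact h6 h4
        · simp [h4] at h5
      · linarith [h2.1]
    · exact hne (by linarith [h2.1, h3.1])
  · rcases hne with hne | hne
    · grind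
    · grind

/-- The order of vanishing of `C(T) - C̃(T)` at every point is at least that of `S(T)`, once the
characteristic functions and the sign data agree. -/
theorem analyticOrderAt_le_of_omegaSign_eq {S C C' S' Ct Ct' St' l lt : ℂ → ℂ} {α β ν : ℂ}
    (hα : α ≠ 0) (hS : Differentiable ℂ S) (hC : Differentiable ℂ C) (hC' : Differentiable ℂ C')
    (hS' : Differentiable ℂ S') (hCt : Differentiable ℂ Ct) (hCt' : Differentiable ℂ Ct')
    (hSt' : Differentiable ℂ St') (hl : Differentiable ℂ l) (hlt : Differentiable ℂ lt)
    (hW : ∀ ρ, C ρ * S' ρ - C' ρ * S ρ = 1) (hWt : ∀ ρ, Ct ρ * St' ρ - Ct' ρ * S ρ = 1)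
    (ha : ∀ ρ, α * (C ρ + l ρ * S ρ) + β * S' ρ = α * (Ct ρ + lt ρ * S ρ) + β * St' ρ)
    (hΩ : S ν = 0 → omegaSign (α * (C ν + l ν * S ν) - β * S' ν) =
      omegaSign (α * (Ct ν + lt ν * S ν) - β * St' ν))
    (hm : ∀ m : ℕ, 1 < m → (∀ j < m, iteratedDeriv j S ν = 0) → iteratedDeriv m S ν ≠ 0 →
      α * (C ν + l ν * S ν) - β * S' ν = 0 →
      ∀ j, 1 ≤ j → j < m → iteratedDeriv j C ν = iteratedDeriv j Ct ν)
    (htop : analyticOrderAt S ν ≠ ⊤) :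
    analyticOrderAt S ν ≤ analyticOrderAt (fun ρ => C ρ - Ct ρ) ν := by
  by_cases hSν : S ν ≠ 0
  · rw [(hS.analyticAt ν).analyticOrderAt_eq_zero.2 hSν]; exact zero_le
  push Not at hSν
  set Q : ℂ → ℂ := fun ρ => α * (C ρ + l ρ * S ρ) - β * S' ρ with hQ
  set Qt : ℂ → ℂ := fun ρ => α * (Ct ρ + lt ρ * S ρ) - β * St' ρ with hQt
  set R : ℂ → ℂ := fun ρ =>
    -4 * α * β * (C' ρ + l ρ * S' ρ - (Ct' ρ + lt ρ * St' ρ)) with hR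
  have hfac : ∀ ρ, (Q ρ - Qt ρ) * (Q ρ + Qt ρ) = S ρ * R ρ := by
    intro ρ
    simp only [hQ, hQt, hR]
    linear_combination (α * (C ρ + l ρ * S ρ) + β * S' ρ + α * (Ct ρ + lt ρ * S ρ) +
      β * St' ρ) * ha ρ - 4 * α * β * hW ρ + 4 * α * β * hWt ρ
  have hQν : Q ν = Qt ν := by
    refine eq_of_sq_eq_of_omegaSign_eq ?_ (hΩ hSν)
    have := hfac ν
    rw [hSν, zero_mul] at this
    linear_combination this
  have hQd : Differentiable ℂ Q := by fun_prop
  have hQtd : Differentiable ℂ Qt := by fun_prop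
  have hRd : Differentiable ℂ R := by fun_prop
  by_cases hQ0 : Q ν = 0
  · have hCν : C ν = Ct ν := by
      have h1 := ha ν
      have h2 : α * (C ν + l ν * S ν) - β * S' ν = 0 := hQ0
      have h3 : α * (Ct ν + lt ν * S ν) - β * St' ν = 0 := hQν.symm.trans hQ0
      rw [hSν] at h1 h2 h3
      refine mul_left_cancel₀ (mul_ne_zero two_ne_zero hα) ?_
      linear_combination h1 + h2 - h3
    obtain ⟨m, hmS⟩ := ENat.ne_top_iff_exists.1 htop
    rw [← hmS, natCast_le_analyticOrderAt_iff_iteratedDeriv_eq_zero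
      ((hC.fun_sub hCt).analyticAt ν)]
    intro i hi
    rw [iteratedDeriv_fun_sub (hC.contDiff.contDiffAt) (hCt.contDiff.contDiffAt), sub_eq_zero]
    rcases Nat.eq_zero_or_pos i with rfl | hi0
    · simpa using hCν
    · have h1 : ∀ j < m, iteratedDeriv j S ν = 0 :=
        (natCast_le_analyticOrderAt_iff_iteratedDeriv_eq_zero (hS.analyticAt ν)).1 hmS.le
      refine hm m (by lia) h1 (fun h2 => ?_) hQ0 i hi0 hi
      have h3 : ((m + 1 : ℕ) : ℕ∞) ≤ analyticOrderAt S ν := by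
        rw [natCast_le_analyticOrderAt_iff_iteratedDeriv_eq_zero (hS.analyticAt ν)]
        intro j hj
        rcases Nat.lt_succ_iff_lt_or_eq.1 hj with h4 | rfl
        exacts [h1 j h4, h2]
      rw [← hmS, Nat.cast_le] at h3
      lia
  · have h1 : analyticOrderAt ((fun ρ => Q ρ - Qt ρ) * fun ρ => Q ρ + Qt ρ) ν =
        analyticOrderAt (S * R) ν := by congr 1; ext ρ; exact hfac ρ
    rw [analyticOrderAt_mul ((hQd.fun_sub hQtd).analyticAt ν) ((hQd.fun_add hQtd).analyticAt ν),
      analyticOrderAt_mul (hS.analyticAt ν) (hRd.analyticAt ν)] at h1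
    have h2 : analyticOrderAt (fun ρ => Q ρ + Qt ρ) ν = 0 := by
      refine ((hQd.fun_add hQtd).analyticAt ν).analyticOrderAt_eq_zero.2 ?_
      simp only [← hQν]
      exact fun h => hQ0 (by linear_combination h / 2)
    rw [h2, add_zero] at h1
    have h3 : analyticOrderAt S ν ≤ analyticOrderAt (fun ρ => Q ρ - Qt ρ) ν := by
      rw [h1]; exact le_self_add
    have h4 : (fun ρ => C ρ - Ct ρ) = (fun _ => (2 * α)⁻¹) * (fun ρ => Q ρ - Qt ρ) +
        (fun ρ => lt ρ - l ρ) * S := by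
      ext ρ
      simp only [Pi.add_apply, Pi.mul_apply, hQ, hQt]
      field_simp
      linear_combination ha ρ
    rw [h4]
    refine le_trans (le_min ?_ ?_) le_analyticOrderAt_add
    · rw [analyticOrderAt_mul analyticAt_const ((hQd.fun_sub hQtd).analyticAt ν)]
      exact h3.trans le_add_self
    · rw [analyticOrderAt_mul ((hlt.fun_sub hl).analyticAt ν) (hS.analyticAt ν)]
      exact le_add_self

variable {N : ℕ} {b : ℕ → ℝ} {γ : ℕ → ℂ} {P Pt : JumpPencil N b γ}
  {c c' s s' ct ct' st st' : ℂ → ℕ → ℝ → ℂ} {n : ℕ}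

namespace FundSys

theorem exists_s_ne_zero (h : FundSys P c c' s s') (hn : n + 1 = N) :
    ∃ ρ, ρ ≠ 0 ∧ s ρ n (b (n + 1)) ≠ 0 := by
  have h1 := (h.rayAsymp_of_pos hn (e := I) (by simp)).ne 0 (by lia)
  obtain ⟨τ, h2, h3⟩ := (h1.and (eventually_gt_atTop 0)).exists
  rw [(h.weylSol_init n _).1, neg_ne_zero] at h2
  exact ⟨_, mul_ne_zero (by exact_mod_cast h3.ne') I_ne_zero, h2⟩

/-- Along every ray the quotient `(C(T) - C̃(T)) / S(T)` has a limit. -/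
theorem tendsto_quotient (h : FundSys P c c' s s') (ht : FundSys Pt ct ct' st st')
    (hn : n + 1 = N) (hs : ∀ ρ, s ρ n (b (n + 1)) = st ρ n (b (n + 1))) {F : ℂ → ℂ}
    (hF : ∀ ρ, F ρ * s ρ n (b (n + 1)) = c ρ n (b (n + 1)) - ct ρ n (b (n + 1))) {e ε : ℂ}
    (hr : RayAsymp P c c' s s' n e ε) (hrt : RayAsymp Pt ct ct' st st' n e ε) :
    Tendsto (fun τ : ℝ => F (τ * e)) atTop (𝓝 (ε * I * (Pt.p (b 0) - P.p (b 0)) / 2)) := by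
  have h1 := (hrt.lim 0 (by lia)).sub (hr.lim 0 (by lia))
  have h2 : ε * I * Pt.p (b 0) / 2 - ε * I * P.p (b 0) / 2 =
      ε * I * (Pt.p (b 0) - P.p (b 0)) / 2 := by ring
  rw [h2] at h1
  refine h1.congr' ?_
  filter_upwards [hr.ne 0 (by lia)] with τ h3
  rw [(h.weylSol_init n _).1, neg_ne_zero] at h3
  rw [(h.weylSol_init n _).1, (h.weylSol_init n _).2, (ht.weylSol_init n _).1,
    (ht.weylSol_init n _).2, ← hs]
  have h4 := hF (τ * e)
  field_simp
  linear_combination -h4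

/-- If `S(T) = S̃(T)` divides `C(T) - C̃(T)`, then `C(T) = C̃(T)`. -/
theorem c_end_eq (h : FundSys P c c' s s') (ht : FundSys Pt ct ct' st st')
    (hn : n + 1 = N) (hs : ∀ ρ, s ρ n (b (n + 1)) = st ρ n (b (n + 1)))
    (hord : ∀ z, analyticOrderAt (fun ρ => s ρ n (b (n + 1))) z ≤
      analyticOrderAt (fun ρ => c ρ n (b (n + 1)) - ct ρ n (b (n + 1))) z) (ρ : ℂ) :
    c ρ n (b (n + 1)) = ct ρ n (b (n + 1)) := by
  have hnN : n < N := by lia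
  have hx := P.right_mem hnN
  obtain ⟨ρ₀, -, hρ₀⟩ := h.exists_s_ne_zero hn
  have hcd := (h.differentiable_c hnN hx).1
  have hctd := (ht.differentiable_c hnN hx).1
  have hsd := (h.differentiable_s hnN hx).1
  obtain ⟨F, hFd, hF⟩ := exists_entire_mul_eq (hcd.fun_sub hctd) hsd hρ₀ hord
  have hFe : ExpType F := by
    refine ExpType.of_mul hFd hsd (h.expType_s hnN hx).1 ?_ hρ₀
    have := (h.expType_c hnN hx).1.sub (ht.expType_c hnN hx).1
    simpa only [hF] using this
  have hup := fun {e : ℂ} (he : 0 < e.im) => h.tendsto_quotient ht hn hs hF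
    (h.rayAsymp_of_pos hn he) (ht.rayAsymp_of_pos hn he)
  have hlow := fun {e : ℂ} (he : e.im < 0) => h.tendsto_quotient ht hn hs hF
    (h.rayAsymp_of_neg hn he) (ht.rayAsymp_of_neg hn he)
  have hconst := ExpType.eq_of_bounded_on_rays hFd hFe fun e he => by
    obtain ⟨L, hL⟩ : ∃ L, Tendsto (fun τ : ℝ => F (τ * e)) atTop (𝓝 L) := by
      rcases he.lt_or_gt with he | he
      exacts [⟨_, hlow he⟩, ⟨_, hup he⟩]
    exact ⟨‖L‖ + 1, hL.norm.eventually_le_const (lt_add_one _)⟩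
  have h1 := hup (e := I) (by simp)
  have h2 := hlow (e := -I) (by simp)
  simp_rw [hconst _ ρ] at h1 h2
  have h3 := tendsto_nhds_unique tendsto_const_nhds h1
  have h4 := tendsto_nhds_unique tendsto_const_nhds h2
  have h5 : F ρ = 0 := by linear_combination h3 / 2 + h4 / 2
  have h6 := hF ρ
  rw [h5, zero_mul] at h6
  exact (sub_eq_zero.1 h6.symm)

end FundSys

end

section

theorem IsPrimitiveOn.hasDerivAt {f f' : ℝ → ℂ} {c d x : ℝ} (h : IsPrimitiveOn f f' c d)
    (hf' : ContinuousOn f' (Icc c d)) (hx : x ∈ Ioo c d) : HasDerivAt f (f' x) x := by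
  have hnhds : Icc c d ∈ 𝓝 x := Icc_mem_nhds hx.1 hx.2
  have h1 : HasDerivAt (fun u => ∫ t in c..u, f' t) (f' x) x :=
    intervalIntegral.integral_hasDerivAt_right
      (h.integrable_sub (left_mem_Icc.2 (hx.1.trans hx.2).le) (Ioo_subset_Icc_self hx))
      (hf'.stronglyMeasurableAtFilter_nhdsWithin measurableSet_Icc x |>.filter_mono
        (nhdsWithin_eq_nhds.2 hnhds).ge)
      (hf'.continuousAt hnhds)
  refine (h1.const_add (f c)).congr_of_eventuallyEq ?_
  filter_upwards [hnhds] with u hu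
  exact h.eq_add_integral u hu

namespace IsSol

variable {p q pt qt : ℝ → ℂ} {ρ : ℂ} {y y' z z' yt yt' zt zt' : ℝ → ℂ} {c d x : ℝ}

theorem hasDerivAt (h : IsSol p q ρ y y' c d) (hx : x ∈ Ioo c d) : HasDerivAt y (y' x) x :=
  h.prim.hasDerivAt h.prim'.continuousOn hx

/-- If the squares of two solutions agree, then the potentials agree off the zeros. -/
theorem ae_potential_eq_of_sq_eq (h : IsSol p q ρ y y' c d) (ht : IsSol pt qt ρ yt yt' c d)
    (hsq : ∀ x ∈ Ioo c d, y x ^ 2 = yt x ^ 2) :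
    ∀ᵐ x, x ∈ Ioo c d → (ρ * (p x - pt x) + (q x - qt x)) * y x ^ 4 = 0 := by
  have hmul : ∀ x ∈ Ioo c d, y x * y' x = yt x * yt' x := fun x hx => by
    have h1 := (h.hasDerivAt hx).fun_pow 2
    have h2 := ((ht.hasDerivAt hx).fun_pow 2).congr_of_eventuallyEq
      (f₁ := fun x => y x ^ 2) (by
        filter_upwards [Ioo_mem_nhds hx.1 hx.2] with u hu using hsq u hu)
    have h3 := h1.unique h2
    norm_num at h3
    linear_combination h3 / 2
  filter_upwards [h.prim'.ae_hasDerivAt, ht.prim'.ae_hasDerivAt] with x h1 h2 hx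
  have h3 := (h.hasDerivAt hx).fun_mul (h1 hx)
  have h4 := ((ht.hasDerivAt hx).fun_mul (h2 hx)).congr_of_eventuallyEq
      (f₁ := fun x => y x * y' x) (by
        filter_upwards [Ioo_mem_nhds hx.1 hx.2] with u hu using hmul u hu)
  have h5 := h3.unique h4
  have h6 := hsq x hx
  have h7 := hmul x hx
  linear_combination (-(y x ^ 2)) * h5 + (y x * y' x + yt x * yt' x) * h7
    - ((ρ ^ 2 + ρ * pt x + qt x) * y x ^ 2 + yt' x ^ 2) * h6

/-- Two fundamental systems with vanishing cross product have the same potentials. -/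
theorem ae_potential_eq_of_cross_eq_zero (hy : IsSol p q ρ y y' c d) (hz : IsSol p q ρ z z' c d)
    (hyt : IsSol pt qt ρ yt yt' c d) (hzt : IsSol pt qt ρ zt zt' c d)
    (hW : ∀ x ∈ Ioo c d, y x * z' x - y' x * z x = 1)
    (hWt : ∀ x ∈ Ioo c d, yt x * zt' x - yt' x * zt x = 1)
    (hX : ∀ x ∈ Ioo c d, y x * zt x - z x * yt x = 0) :
    ∀ᵐ x, x ∈ Ioo c d → ρ * (p x - pt x) + (q x - qt x) = 0 := by
  have hX' : ∀ x ∈ Ioo c d,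
      y' x * zt x + y x * zt' x - (z' x * yt x + z x * yt' x) = 0 := fun x hx => by
    have h1 := ((hy.hasDerivAt hx).fun_mul (hzt.hasDerivAt hx)).fun_sub
      ((hz.hasDerivAt hx).fun_mul (hyt.hasDerivAt hx))
    refine h1.unique ((hasDerivAt_const x (0 : ℂ)).congr_of_eventuallyEq ?_)
    filter_upwards [Ioo_mem_nhds hx.1 hx.2] with u hu using hX u hu
  have hysq : ∀ x ∈ Ioo c d, y x ^ 2 = yt x ^ 2 := fun x hx => by
    linear_combination y x * yt x * hX' x hx - y x ^ 2 * hWt x hx + yt x ^ 2 * hW x hx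
      - (y x * yt' x + yt x * y' x) * hX x hx
  have hzsq : ∀ x ∈ Ioo c d, z x ^ 2 = zt x ^ 2 := fun x hx => by
    linear_combination z x * zt x * hX' x hx - z x ^ 2 * hWt x hx + zt x ^ 2 * hW x hx
      - (z x * zt' x + zt x * z' x) * hX x hx
  filter_upwards [hy.ae_potential_eq_of_sq_eq hyt hysq, hz.ae_potential_eq_of_sq_eq hzt hzsq]
    with x h1 h2 hx
  by_contra hE
  have h3 : y x = 0 := by simpa [hE] using h1 hx
  have h4 : z x = 0 := by simpa [hE] using h2 hx
  have h5 := hW x hx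
  simp [h3, h4] at h5

theorem congr_ae (h : IsSol p q ρ y y' c d) (hcd : c ≤ d)
    (he : ∀ᵐ x, x ∈ Ioo c d → p x = pt x ∧ q x = qt x) : IsSol pt qt ρ y y' c d := by
  refine ⟨h.prim, ?_⟩
  set F := fun t => -((ρ ^ 2 + ρ * p t + q t) * y t)
  set G := fun t => -((ρ ^ 2 + ρ * pt t + qt t) * y t)
  have hFG : ∀ᵐ t, t ∈ uIoc c d → F t = G t := by
    rw [uIoc_of_le hcd]
    filter_upwards [he, Measure.ae_ne volume d] with t h1 h2 ht
    obtain ⟨h3, h4⟩ := h1 ⟨ht.1, lt_of_le_of_ne ht.2 h2⟩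
    simp only [F, G, h3, h4]
  refine ⟨h.prim'.integrable.congr_ae ((ae_restrict_iff' measurableSet_uIoc).2 hFG),
    fun x hx => ?_⟩
  rw [h.prim'.eq_add_integral x hx]
  congr 1
  refine intervalIntegral.integral_congr_ae ?_
  filter_upwards [hFG] with t h1 ht
  rw [uIoc_of_le hx.1] at ht
  rw [uIoc_of_le hcd] at h1
  exact h1 ⟨ht.1, ht.2.trans hx.2⟩

/-- Two solutions with the same initial data agree. -/
theorem eq_of_init (h : IsSol p q ρ y y' c d) (hz : IsSol p q ρ z z' c d)
    (hp : IntervalIntegrable p volume c d) (hq : IntervalIntegrable q volume c d)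
    (h0 : y c = z c) (h0' : y' c = z' c) (hx : x ∈ Icc c d) : y x = z x ∧ y' x = z' x := by
  have h1 := (h.add (hz.const_mul (-1))).norm_le hp hq hx
  have h2 : y c + -1 * z c = 0 := by rw [h0]; ring
  have h3 : y' c + -1 * z' c = 0 := by rw [h0']; ring
  simp only [h2, h3, norm_zero, mul_zero, add_zero, zero_mul] at h1
  have h4 := norm_nonneg (y x + -1 * z x)
  have h5 := norm_nonneg (y' x + -1 * z' x)
  have h6 := mul_nonneg (norm_nonneg ρ) h4
  have h7 : ‖y x + -1 * z x‖ = 0 := by nlinarith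
  have h8 : ‖y' x + -1 * z' x‖ = 0 := by nlinarith
  rw [norm_eq_zero] at h7 h8
  exact ⟨by linear_combination h7, by linear_combination h8⟩

end IsSol

end

section

variable {N : ℕ} {b : ℕ → ℝ} {γ : ℕ → ℂ} {P Pt : JumpPencil N b γ}
  {c c' s s' ct ct' st st' : ℂ → ℕ → ℝ → ℂ} {n k : ℕ} {x : ℝ}

theorem eq_zero_of_tendsto_affine {u v : ℂ}
    (h : Tendsto (fun τ : ℝ => (τ : ℂ) * u + v) atTop (𝓝 0)) : u = 0 ∧ v = 0 := by
  have hu : u = 0 := by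
    have h1 : Tendsto (fun τ : ℝ => ((τ : ℂ))⁻¹) atTop (𝓝 0) := by
      have := (continuous_ofReal.tendsto 0).comp tendsto_inv_atTop_zero
      simpa [Function.comp_def] using this
    have h2 := (h.mul h1).sub (h1.const_mul v)
    simp only [mul_zero, sub_zero] at h2
    refine tendsto_nhds_unique (tendsto_const_nhds.congr' ?_) h2
    filter_upwards [eventually_gt_atTop 0] with τ hτ
    have : (τ : ℂ) ≠ 0 := by exact_mod_cast hτ.ne'
    field_simp
    ring
  subst hu
  simp only [mul_zero, zero_add] at h
  exact ⟨rfl, tendsto_nhds_unique tendsto_const_nhds h⟩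

namespace FundSys

theorem eventually_s_end_ne_zero (h : FundSys P c c' s s') (hn : n + 1 = N) {e : ℂ}
    (he : e.im ≠ 0) : ∀ᶠ τ : ℝ in atTop, s (τ * e) n (b (n + 1)) ≠ 0 := by
  obtain ⟨ε, hr⟩ := h.exists_rayAsymp hn he
  filter_upwards [hr.ne 0 (by lia)] with τ h1
  rwa [(h.weylSol_init n _).1, neg_ne_zero] at h1

/-- If the right end values of two fundamental systems agree, then their cross product
vanishes. -/
theorem cross_eq_zero (h : FundSys P c c' s s') (ht : FundSys Pt ct ct' st st')
    (hn : n + 1 = N) (hs : ∀ ρ, s ρ n (b (n + 1)) = st ρ n (b (n + 1)))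
    (hc : ∀ ρ, c ρ n (b (n + 1)) = ct ρ n (b (n + 1))) (hk : k < N)
    (hx : x ∈ Icc (b k) (b (k + 1))) (ρ : ℂ) :
    c ρ k x * st ρ k x - s ρ k x * ct ρ k x = 0 := by
  refine ExpType.eq_zero_of_tendsto_on_rays
    (f := fun ρ => c ρ k x * st ρ k x - s ρ k x * ct ρ k x)
    (((h.differentiable_c hk hx).1.fun_mul (ht.differentiable_s hk hx).1).fun_sub
      ((h.differentiable_s hk hx).1.fun_mul (ht.differentiable_c hk hx).1))
    (((h.expType_c hk hx).1.mul (ht.expType_s hk hx).1).sub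
      ((h.expType_s hk hx).1.mul (ht.expType_c hk hx).1)) (fun e he => ?_) ρ
  obtain ⟨ε, hr⟩ := h.exists_rayAsymp hn he
  obtain ⟨εt, hrt⟩ := ht.exists_rayAsymp hn he
  obtain ⟨K, hK, hdec⟩ := hr.decay k hk
  obtain ⟨Kt, hKt, hdect⟩ := hrt.decay k hk
  obtain ⟨M, hM, hgr⟩ := hr.growth k hk
  obtain ⟨Mt, hMt, hgrt⟩ := hrt.growth k hk
  have hlim : Tendsto (fun τ : ℝ => (K * Mt + M * Kt) * τ⁻¹) atTop (𝓝 0) := by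
    simpa using tendsto_inv_atTop_zero.const_mul (K * Mt + M * Kt)
  refine squeeze_zero_norm' ?_ hlim
  filter_upwards [hdec, hdect, hgr, hgrt, h.eventually_s_end_ne_zero hn he,
    eventually_gt_atTop 0] with τ h1 h2 h3 h4 h5 hτ
  replace h1 := h1 x hx
  replace h2 := h2 x hx
  replace h3 := h3 x hx
  replace h4 := h4 x hx
  set r : ℂ := τ * e
  set w := τ * |e.im| * (x - b 0)
  rw [← hs] at h2
  have hid : s r n (b (n + 1)) * (c r k x * st r k x - s r k x * ct r k x) =
      s r k x * weylSol b n ct st ct st r k x - weylSol b n c s c s r k x * st r k x := by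
    simp only [weylSol, ← hs, ← hc]
    ring
  have hexp : Real.exp (-w) * Real.exp w = 1 := by rw [← Real.exp_add]; simp
  have hpos : 0 < ‖s r n (b (n + 1))‖ := norm_pos_iff.2 h5
  have h6 : ‖s r n (b (n + 1))‖ * (τ * ‖c r k x * st r k x - s r k x * ct r k x‖) ≤
      ‖s r n (b (n + 1))‖ * (K * Mt + M * Kt) := by
    calc _ = τ * ‖s r n (b (n + 1)) * (c r k x * st r k x - s r k x * ct r k x)‖ := by
          rw [norm_mul]; ring
      _ ≤ (τ * ‖s r k x‖) * ‖weylSol b n ct st ct st r k x‖ +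
          ‖weylSol b n c s c s r k x‖ * (τ * ‖st r k x‖) := by
          rw [hid]
          refine (mul_le_mul_of_nonneg_left (norm_sub_le _ _) hτ.le).trans_eq ?_
          rw [norm_mul, norm_mul]; ring
      _ ≤ (M * Real.exp w) * (Kt * ‖s r n (b (n + 1))‖ * Real.exp (-w)) +
          (K * ‖s r n (b (n + 1))‖ * Real.exp (-w)) * (Mt * Real.exp w) := by
          gcongr
      _ = _ := by linear_combination ‖s r n (b (n + 1))‖ * (K * Mt + M * Kt) * hexp
  have h7 := le_of_mul_le_mul_left h6 hpos
  rw [← div_eq_mul_inv, le_div_iff₀ hτ]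
  linarith

theorem ae_potential_eq (h : FundSys P c c' s s') (ht : FundSys Pt ct ct' st st')
    (hn : n + 1 = N) (hs : ∀ ρ, s ρ n (b (n + 1)) = st ρ n (b (n + 1)))
    (hc : ∀ ρ, c ρ n (b (n + 1)) = ct ρ n (b (n + 1))) (hk : k < N) :
    ∀ᵐ x, x ∈ Ioo (b k) (b (k + 1)) → P.p x = Pt.p x ∧ P.q x = Pt.q x := by
  have hE := fun ρ => IsSol.ae_potential_eq_of_cross_eq_zero ((h.hc ρ).sol k hk)
    ((h.hs ρ).sol k hk) ((ht.hc ρ).sol k hk) ((ht.hs ρ).sol k hk)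
    (fun x hx => h.wronskian ρ hk (Ioo_subset_Icc_self hx))
    (fun x hx => ht.wronskian ρ hk (Ioo_subset_Icc_self hx))
    (fun x hx => h.cross_eq_zero ht hn hs hc hk (Ioo_subset_Icc_self hx) ρ)
  filter_upwards [hE 0, hE 1] with x h0 h1 hx
  exact ⟨by linear_combination h1 hx - h0 hx, by linear_combination h0 hx⟩

theorem p_eq (h : FundSys P c c' s s') (ht : FundSys Pt ct ct' st st')
    (hn : n + 1 = N) (hs : ∀ ρ, s ρ n (b (n + 1)) = st ρ n (b (n + 1)))
    (hc : ∀ ρ, c ρ n (b (n + 1)) = ct ρ n (b (n + 1))) (hk : k < N) :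
    P.p (b k) = Pt.p (b k) := by
  have h1 : EqOn P.p Pt.p (Icc (b k) (b (k + 1))) := by
    refine Measure.eqOn_Icc_of_ae_eq volume (P.b_lt k hk).ne ?_ (P.p_cont hk) (Pt.p_cont hk)
    rw [Filter.EventuallyEq, ← restrict_Ioo_eq_restrict_Icc, ae_restrict_iff' measurableSet_Ioo]
    filter_upwards [h.ae_potential_eq ht hn hs hc hk] with x h2 hx using (h2 hx).1
  exact h1 (P.left_mem hk)

/-- The jump coefficients at `b (k + 1)` agree if the solutions agree to the left of it. -/
theorem jump_eq (h : FundSys P c c' s s') (ht : FundSys Pt ct ct' st st')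
    (hn : n + 1 = N) (hs : ∀ ρ, s ρ n (b (n + 1)) = st ρ n (b (n + 1)))
    (hc : ∀ ρ, c ρ n (b (n + 1)) = ct ρ n (b (n + 1))) (hk : k + 1 < N)
    (heqc : ∀ ρ, c ρ k (b (k + 1)) = ct ρ k (b (k + 1)) ∧ c' ρ k (b (k + 1)) = ct' ρ k (b (k + 1)))
    (heqs : ∀ ρ, s ρ k (b (k + 1)) = st ρ k (b (k + 1)) ∧
      s' ρ k (b (k + 1)) = st' ρ k (b (k + 1))) :
    P.η' (k + 1) = Pt.η' (k + 1) ∧ P.η (k + 1) = Pt.η (k + 1) := by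
  have hI : 0 < I.im := by simp
  have hr := h.rayAsymp_of_pos hn hI
  have hrt := ht.rayAsymp_of_pos hn hI
  have h1 := (hr.lim (k + 1) hk).sub (hrt.lim (k + 1) hk)
  rw [h.p_eq ht hn hs hc hk, sub_self] at h1
  have hγ := P.γ_ne k hk
  have h2 : Tendsto (fun τ : ℝ => (τ : ℂ) * (-(P.η' (k + 1) - Pt.η' (k + 1))) +
      (P.η (k + 1) - Pt.η (k + 1))) atTop (𝓝 0) := by
    have h3 := h1.const_mul (γ (k + 1))
    rw [mul_zero] at h3
    refine h3.congr' ?_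
    filter_upwards [hr.ne (k + 1) hk] with τ h4
    have h5 := h.isJumpSol_weylSol n (τ * I)
    have h6 := ht.isJumpSol_weylSol n (τ * I)
    rw [h5.jump k hk] at h4
    rw [h5.jump k hk, h5.jump' k hk, h6.jump k hk, h6.jump' k hk]
    have e1 : weylSol b n ct st ct st (τ * I) k (b (k + 1)) =
        weylSol b n c s c s (τ * I) k (b (k + 1)) := by
      simp only [weylSol, hs, hc, (heqc _).1, (heqs _).1]
    have e2 : weylSol b n ct st ct' st' (τ * I) k (b (k + 1)) =
        weylSol b n c s c' s' (τ * I) k (b (k + 1)) := by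
      simp only [weylSol, hs, hc, (heqc _).2, (heqs _).2]
    rw [e1, e2]
    have h7 := right_ne_zero_of_mul h4
    field_simp
    linear_combination γ (k + 1) * weylSol b n c s c s (τ * I) k (b (k + 1)) * τ *
      (P.η' (k + 1) - Pt.η' (k + 1)) * I_sq
  obtain ⟨h3, h4⟩ := eq_zero_of_tendsto_affine h2
  exact ⟨sub_eq_zero.1 (neg_eq_zero.1 h3), sub_eq_zero.1 h4⟩

/-- Two fundamental systems with the same right end values agree. -/
theorem eq_of_end_eq (h : FundSys P c c' s s') (ht : FundSys Pt ct ct' st st')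
    (hn : n + 1 = N) (hs : ∀ ρ, s ρ n (b (n + 1)) = st ρ n (b (n + 1)))
    (hc : ∀ ρ, c ρ n (b (n + 1)) = ct ρ n (b (n + 1))) (hk : k < N) :
    (∀ ρ, c ρ k (b (k + 1)) = ct ρ k (b (k + 1)) ∧ c' ρ k (b (k + 1)) = ct' ρ k (b (k + 1))) ∧
    (∀ ρ, s ρ k (b (k + 1)) = st ρ k (b (k + 1)) ∧ s' ρ k (b (k + 1)) = st' ρ k (b (k + 1))) := by
  have step : ∀ {y y' yt yt' : ℂ → ℕ → ℝ → ℂ} {k : ℕ}, k < N →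
      (∀ ρ, IsJumpSol P ρ (y ρ) (y' ρ)) → (∀ ρ, IsJumpSol Pt ρ (yt ρ) (yt' ρ)) →
      (∀ ρ, y ρ k (b k) = yt ρ k (b k) ∧ y' ρ k (b k) = yt' ρ k (b k)) → ∀ ρ,
      y ρ k (b (k + 1)) = yt ρ k (b (k + 1)) ∧ y' ρ k (b (k + 1)) = yt' ρ k (b (k + 1)) := by
    intro y y' yt yt' k hk hy hyt h0 ρ
    exact (((hy ρ).sol k hk).congr_ae (P.b_lt k hk).le
      (h.ae_potential_eq ht hn hs hc hk)).eq_of_init ((hyt ρ).sol k hk) (Pt.p_int hk)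
      (Pt.q_int k hk) (h0 ρ).1 (h0 ρ).2 (P.right_mem hk)
  induction k with
  | zero =>
    exact ⟨step hk h.hc ht.hc fun ρ => ⟨by rw [h.c_init, ht.c_init], by
      rw [h.c_init', ht.c_init']⟩, step hk h.hs ht.hs fun ρ => ⟨by rw [h.s_init, ht.s_init], by
      rw [h.s_init', ht.s_init']⟩⟩
  | succ k ih =>
    obtain ⟨ihc, ihs⟩ := ih (by lia)
    obtain ⟨e1, e2⟩ := h.jump_eq ht hn hs hc hk ihc ihs
    exact ⟨step hk h.hc ht.hc fun ρ => ⟨by rw [(h.hc ρ).jump k hk, (ht.hc ρ).jump k hk, (ihc ρ).1],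
        by rw [(h.hc ρ).jump' k hk, (ht.hc ρ).jump' k hk, (ihc ρ).1, (ihc ρ).2, e1, e2]⟩,
      step hk h.hs ht.hs fun ρ => ⟨by rw [(h.hs ρ).jump k hk, (ht.hs ρ).jump k hk, (ihs ρ).1],
        by rw [(h.hs ρ).jump' k hk, (ht.hs ρ).jump' k hk, (ihs ρ).1, (ihs ρ).2, e1, e2]⟩⟩

end FundSys

end

section

variable {N : ℕ} {b : ℕ → ℝ} {γ : ℕ → ℂ}

theorem node_mem_Icc (hb : ∀ j, j < N → b j < b (j + 1)) {j : ℕ} (hj : j ≤ N) :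
    b j ∈ Icc (b 0) (b N) := by
  have hmono : ∀ {i k : ℕ}, i ≤ k → k ≤ N → b i ≤ b k := by
    intro i k hik
    induction k, hik using Nat.le_induction with
    | base => exact fun _ => le_rfl
    | succ k _ ih => exact fun hk => (ih (by lia)).trans (hb k hk).le
  exact ⟨hmono (Nat.zero_le j) hj, hmono hj le_rfl⟩

theorem exists_jumpPencil {p q : ℝ → ℂ} {η' η : ℕ → ℂ} (hb : ∀ j, j < N → b j < b (j + 1))
    (hγ : ∀ j, 1 ≤ j → j + 1 ≤ N → γ j ≠ 0) (hp : AbsCont p (b 0) (b N))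
    (hq : IntegrableOn q (Icc (b 0) (b N)))
    (hξ : ∀ j, 1 ≤ j → j + 1 ≤ N →
      (γ j + (γ j)⁻¹) / 2 - η' j / 2 ≠ 0 ∧ (γ j + (γ j)⁻¹) / 2 + η' j / 2 ≠ 0) :
    ∃ P : JumpPencil N b γ, P.p = p ∧ P.q = q ∧ P.η' = η' ∧ P.η = η := by
  obtain ⟨dp, hdp, hpeq⟩ := hp
  have hle : b 0 ≤ b N := (node_mem_Icc hb (Nat.zero_le N)).2
  have hp' : IsPrimitiveOn p dp (b 0) (b N) :=
    ⟨(intervalIntegrable_iff_integrableOn_Icc_of_le hle).2 hdp, hpeq⟩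
  have hq' : ∀ j < N, IntervalIntegrable q volume (b j) (b (j + 1)) := fun j hj =>
    (intervalIntegrable_iff_integrableOn_Icc_of_le (hb j hj).le).2
      (hq.mono_set (Icc_subset_Icc (node_mem_Icc hb hj.le).1 (node_mem_Icc hb hj).2))
  exact ⟨{ p := p, dp := dp, q := q, η' := η', η := η, b_lt := hb
           p_prim := fun j hj => hp'.mono (node_mem_Icc hb hj.le) (node_mem_Icc hb hj)
           q_int := hq'
           γ_ne := fun j hj => hγ (j + 1) (by lia) hj
           ξ_ne := fun j hj => hξ (j + 1) (by lia) hj }, rfl, rfl, rfl, rfl⟩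

/-- Almost everywhere statements on `(b 0, b N)` may be checked between the nodes. -/
theorem ae_Ioo_of_ae_nodes {Q : ℝ → Prop}
    (h : ∀ k < N, ∀ᵐ x, x ∈ Ioo (b k) (b (k + 1)) → Q x) :
    ∀ᵐ x, x ∈ Ioo (b 0) (b N) → Q x := by
  induction N with
  | zero => simp
  | succ n ih =>
    filter_upwards [ih fun k hk => h k (by lia), h n (by lia), Measure.ae_ne volume (b n)]
      with x h1 h2 h3 hx
    rcases h3.lt_or_gt with h4 | h4
    exacts [h1 ⟨hx.1, h4⟩, h2 ⟨h4, hx.2⟩]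

namespace JumpSolution

variable {p q : ℝ → ℂ} {η' η : ℕ → ℂ} {ρ : ℂ}

/-- The branch of a solution with jumps on `[b j, b (j + 1)]`. -/
def branch (Y : JumpSolution N b p q γ η' η ρ) (j : ℕ) : ℝ → ℂ :=
  extendByLimits Y.y (Y.yR j) (Y.yL (j + 1)) (b j) (b (j + 1))

/-- The derivative of `JumpSolution.branch`. -/
def branch' (Y : JumpSolution N b p q γ η' η ρ) (j : ℕ) : ℝ → ℂ :=
  extendByLimits Y.y' (Y.yR' j) (Y.yL' (j + 1)) (b j) (b (j + 1))

theorem branch_left (Y : JumpSolution N b p q γ η' η ρ) (j : ℕ) :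
    Y.branch j (b j) = Y.yR j ∧ Y.branch' j (b j) = Y.yR' j :=
  ⟨extendByLimits_left, extendByLimits_left⟩

theorem branch_right (Y : JumpSolution N b p q γ η' η ρ) {j : ℕ} (hj : b j < b (j + 1)) :
    Y.branch j (b (j + 1)) = Y.yL (j + 1) ∧ Y.branch' j (b (j + 1)) = Y.yL' (j + 1) :=
  ⟨extendByLimits_right hj, extendByLimits_right hj⟩

theorem isJumpSol {P : JumpPencil N b γ} (Y : JumpSolution N b P.p P.q γ P.η' P.η ρ) :
    IsJumpSol P ρ Y.branch Y.branch' where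
  sol := fun j hj => by
    have h1 := Y.solves (j + 1) (by lia) hj
    rw [Nat.add_sub_cancel] at h1
    have h2 := Y.limR j hj
    have h3 := Y.limL (j + 1) (by lia) hj
    exact h1.isSol (P.b_lt j hj) (P.p_cont hj) (P.q_int j hj) h2.1 h2.2 h3.1 h3.2
  jump := fun j hj => by
    rw [(Y.branch_left _).1, (Y.branch_right (P.b_lt j (by lia))).1]
    exact (Y.jump (j + 1) (by lia) hj).1
  jump' := fun j hj => by
    have h1 := Y.branch_right (P.b_lt j (by lia))
    rw [(Y.branch_left _).2, h1.1, h1.2]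
    exact (Y.jump (j + 1) (by lia) hj).2

theorem fundSys {P : JumpPencil N b γ} (CC SS : ∀ ρ, JumpSolution N b P.p P.q γ P.η' P.η ρ)
    (hS : ∀ ρ, (SS ρ).yR 0 = 0 ∧ (SS ρ).yR' 0 = 1)
    (hC : ∀ ρ, (CC ρ).yR 0 = 1 ∧ (CC ρ).yR' 0 = 0) :
    FundSys P (fun ρ => (CC ρ).branch) (fun ρ => (CC ρ).branch') (fun ρ => (SS ρ).branch)
      (fun ρ => (SS ρ).branch') where
  hc := fun ρ => (CC ρ).isJumpSol
  hs := fun ρ => (SS ρ).isJumpSol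
  c_init := fun ρ => by rw [((CC ρ).branch_left 0).1, (hC ρ).1]
  c_init' := fun ρ => by rw [((CC ρ).branch_left 0).2, (hC ρ).2]
  s_init := fun ρ => by rw [((SS ρ).branch_left 0).1, (hS ρ).1]
  s_init' := fun ρ => by rw [((SS ρ).branch_left 0).2, (hS ρ).2]

end JumpSolution

/-- The data entering the boundary value problem are determined by the characteristic functions
and the sign data, in terms of the fundamental systems. -/
theorem FundSys.uniqueness {P Pt : JumpPencil N b γ} {c c' s s' ct ct' st st' : ℂ → ℕ → ℝ → ℂ}
    (H : FundSys P c c' s s') (Ht : FundSys Pt ct ct' st st') {n : ℕ} (hn : n + 1 = N)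
    {α β h' h h't ht : ℂ} (hα : α ≠ 0) {C C' S S' Ct Ct' St St' : ℂ → ℂ}
    (hC : ∀ ρ, c ρ n (b (n + 1)) = C ρ) (hC' : ∀ ρ, c' ρ n (b (n + 1)) = C' ρ)
    (hS : ∀ ρ, s ρ n (b (n + 1)) = S ρ) (hS' : ∀ ρ, s' ρ n (b (n + 1)) = S' ρ)
    (hCt : ∀ ρ, ct ρ n (b (n + 1)) = Ct ρ) (hCt' : ∀ ρ, ct' ρ n (b (n + 1)) = Ct' ρ)
    (hSt : ∀ ρ, st ρ n (b (n + 1)) = St ρ) (hSt' : ∀ ρ, st' ρ n (b (n + 1)) = St' ρ)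
    (ha : ∀ ρ, α * (C ρ + (I * ρ * h' + h) * S ρ) + β * S' ρ =
      α * (Ct ρ + (I * ρ * h't + ht) * St ρ) + β * St' ρ)
    (hd : ∀ ρ, S ρ = St ρ)
    (hΩ : ∀ ν, S ν = 0 → omegaSign (α * (C ν + (I * ν * h' + h) * S ν) - β * S' ν) =
      omegaSign (α * (Ct ν + (I * ν * h't + ht) * St ν) - β * St' ν))
    (hm : ∀ ν, ∀ m : ℕ, 1 < m → (∀ j < m, iteratedDeriv j S ν = 0) → iteratedDeriv m S ν ≠ 0 →
      α * (C ν + (I * ν * h' + h) * S ν) - β * S' ν = 0 →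
      ∀ j, 1 ≤ j → j < m → iteratedDeriv j C ν = iteratedDeriv j Ct ν) :
    h' = h't ∧ h = ht ∧
      (∀ k < N, ∀ᵐ x, x ∈ Ioo (b k) (b (k + 1)) → P.p x = Pt.p x ∧ P.q x = Pt.q x) ∧
      ∀ k, k + 1 < N → P.η' (k + 1) = Pt.η' (k + 1) ∧ P.η (k + 1) = Pt.η (k + 1) := by
  have hnN : n < N := by lia
  have hx := P.right_mem hnN
  obtain rfl : S = St := funext hd
  have dc := H.differentiable_c hnN hx
  have ds := H.differentiable_s hnN hx
  have dct := Ht.differentiable_c hnN hx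
  have dst := Ht.differentiable_s hnN hx
  simp only [hC, hC', hS, hS', hCt, hCt', hSt'] at dc ds dct dst
  have hW := fun ρ => H.wronskian ρ hnN hx
  have hWt := fun ρ => Ht.wronskian ρ hnN hx
  simp only [hC, hC', hS, hS', hCt, hCt', hSt, hSt'] at hW hWt
  obtain ⟨ρ₀, -, hρ₀⟩ := H.exists_s_ne_zero hn
  rw [hS] at hρ₀
  have htop : ∀ z, analyticOrderAt S z ≠ ⊤ := fun z hz => by
    have h2 : AnalyticOnNhd ℂ S univ := fun w _ => ds.1.analyticAt w
    exact hρ₀ (h2.eqOn_zero_of_preconnected_of_eventuallyEq_zero isPreconnected_univ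
      (mem_univ z) (analyticOrderAt_eq_top.1 hz) (mem_univ ρ₀))
  have hl : ∀ k k' : ℂ, Differentiable ℂ fun ρ => I * ρ * k' + k := fun k k' => by fun_prop
  have hord : ∀ z, analyticOrderAt S z ≤ analyticOrderAt (fun ρ => C ρ - Ct ρ) z := fun z =>
    analyticOrderAt_le_of_omegaSign_eq hα ds.1 dc.1 dc.2 ds.2 dct.1 dct.2 dst.2
      (hl h h') (hl ht h't) hW hWt ha (hΩ z) (hm z) (htop z)
  have hs_end : ∀ ρ, s ρ n (b (n + 1)) = st ρ n (b (n + 1)) := fun ρ => by rw [hS, hSt]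
  have hc_end := H.c_end_eq Ht hn hs_end (by simpa only [hC, hS, hCt] using hord)
  obtain ⟨hce, hse⟩ := H.eq_of_end_eq Ht hn hs_end hc_end hnN
  have hh : ∀ᶠ τ : ℝ in atTop, (τ : ℂ) * (-(h' - h't)) + (h - ht) = 0 := by
    filter_upwards [H.eventually_s_end_ne_zero hn (e := I) (by simp)] with τ h1
    rw [hS] at h1
    have h2 := (hce (τ * I)).1
    have h3 := (hse (τ * I)).2
    rw [hC, hCt] at h2
    rw [hS', hSt'] at h3
    have h4 := ha (τ * I)
    rw [h2, h3] at h4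
    refine (mul_eq_zero.1 ?_).resolve_left (mul_ne_zero hα h1)
    linear_combination h4 - α * S (τ * I) * τ * (h' - h't) * I_sq
  obtain ⟨h1, h2⟩ := eq_zero_of_tendsto_affine
    (tendsto_const_nhds.congr' (hh.mono fun _ h => h.symm))
  refine ⟨sub_eq_zero.1 (neg_eq_zero.1 h1), sub_eq_zero.1 h2,
    fun k hk => H.ae_potential_eq Ht hn hs_end hc_end hk, fun k hk => ?_⟩
  obtain ⟨h3, h4⟩ := H.eq_of_end_eq Ht hn hs_end hc_end (k := k) (by lia)
  exact H.jump_eq Ht hn hs_end hc_end hk h3 h4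

end

/-- **Theorem 2, uniqueness for Inverse problem 1.** Two boundary
value problems `B` and `Bt` with the same `T, N, b j, α, β, γ j` (`αβγ_j ≠ 0`,
`z_0^± ≠ 0`, `ξ_j^± ≠ 0` for both) that have the same characteristic functions
`a = at`, `d = dt` and the same `Ω`-sequences coincide:
`h' = h't`, `h = ht`, `p = pt` a.e., `q = qt` a.e., `η' = η't`, `η = ηt`. -/
theorem inverse_problem_1_uniqueness
    (T : ℝ) (N : ℕ) (b : ℕ → ℝ) (γ : ℕ → ℂ) (α β : ℂ)
    (p q pt qt : ℝ → ℂ) (η' η η't ηt : ℕ → ℂ) (h' h h't ht : ℂ)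
    (hT : 0 < T) (hN : 1 ≤ N) (hb0 : b 0 = 0) (hbN : b N = T)
    (hb : ∀ j, j < N → b j < b (j + 1))
    (hαβ : α * β ≠ 0)
    (hγ : ∀ j, 1 ≤ j → j + 1 ≤ N → γ j ≠ 0)
    (hp : AbsCont p 0 T) (hq : MeasureTheory.IntegrableOn q (Set.Icc 0 T))
    (hpt : AbsCont pt 0 T) (hqt : MeasureTheory.IntegrableOn qt (Set.Icc 0 T))
    (hz0 : α * (1 - h') + β ≠ 0 ∧ α * (1 + h') + β ≠ 0)
    (hz0t : α * (1 - h't) + β ≠ 0 ∧ α * (1 + h't) + β ≠ 0)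
    (hξ : ∀ j, 1 ≤ j → j + 1 ≤ N →
      (γ j + (γ j)⁻¹) / 2 - η' j / 2 ≠ 0 ∧ (γ j + (γ j)⁻¹) / 2 + η' j / 2 ≠ 0)
    (hξt : ∀ j, 1 ≤ j → j + 1 ≤ N →
      (γ j + (γ j)⁻¹) / 2 - η't j / 2 ≠ 0 ∧ (γ j + (γ j)⁻¹) / 2 + η't j / 2 ≠ 0)
    (SS CC : ∀ ρ : ℂ, JumpSolution N b p q γ η' η ρ)
    (SSt CCt : ∀ ρ : ℂ, JumpSolution N b pt qt γ η't ηt ρ)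
    (hS : ∀ ρ, (SS ρ).yR 0 = 0 ∧ (SS ρ).yR' 0 = 1)
    (hC : ∀ ρ, (CC ρ).yR 0 = 1 ∧ (CC ρ).yR' 0 = 0)
    (hSt : ∀ ρ, (SSt ρ).yR 0 = 0 ∧ (SSt ρ).yR' 0 = 1)
    (hCt : ∀ ρ, (CCt ρ).yR 0 = 1 ∧ (CCt ρ).yR' 0 = 0)
    -- (1) the characteristic functions `a` coincide:
    (ha : ∀ ρ : ℂ,
      α * ((CC ρ).yL N + (Complex.I * ρ * h' + h) * (SS ρ).yL N)
          + β * (SS ρ).yL' N - (1 + α * β) =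
      α * ((CCt ρ).yL N + (Complex.I * ρ * h't + ht) * (SSt ρ).yL N)
          + β * (SSt ρ).yL' N - (1 + α * β))
    -- (2) the characteristic functions `d` coincide:
    (hd : ∀ ρ : ℂ, (SS ρ).yL N = (SSt ρ).yL N)
    -- (3a) the sign data `ω(ν)` coincide at every zero `ν` of `d`:
    (hΩ₁ : ∀ ν : ℂ, (SS ν).yL N = 0 →
      omegaSign (α * ((CC ν).yL N + (Complex.I * ν * h' + h) * (SS ν).yL N)
          - β * (SS ν).yL' N) =
      omegaSign (α * ((CCt ν).yL N + (Complex.I * ν * h't + ht) * (SSt ν).yL N)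
          - β * (SSt ν).yL' N))
    -- (3b) at every zero `ν` of `d` of multiplicity `m > 1` with `Q(ν) = 0`,
    -- the derivatives `d₁⁽ʲ⁾(ν)`, `j = 1, …, m-1`, coincide:
    (hΩ₂ : ∀ ν : ℂ, ∀ m : ℕ, 1 < m →
      (∀ j < m, iteratedDeriv j (fun ρ => (SS ρ).yL N) ν = 0) →
      iteratedDeriv m (fun ρ => (SS ρ).yL N) ν ≠ 0 →
      α * ((CC ν).yL N + (Complex.I * ν * h' + h) * (SS ν).yL N)
          - β * (SS ν).yL' N = 0 →
      ∀ j, 1 ≤ j → j < m →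
        iteratedDeriv j (fun ρ => (CC ρ).yL N) ν =
        iteratedDeriv j (fun ρ => (CCt ρ).yL N) ν) :
    h' = h't ∧ h = ht ∧
    (∀ᵐ x ∂(volume.restrict (Set.Ioo (0 : ℝ) T)), p x = pt x ∧ q x = qt x) ∧
    (∀ j, 1 ≤ j → j + 1 ≤ N → η' j = η't j ∧ η j = ηt j) := by
  subst hbN
  rw [← hb0] at hp hq hpt hqt ⊢
  obtain ⟨P, rfl, rfl, rfl, rfl⟩ := exists_jumpPencil (η := η) hb hγ hp hq hξ
  obtain ⟨Pt, rfl, rfl, rfl, rfl⟩ := exists_jumpPencil (η := ηt) hb hγ hpt hqt hξt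
  obtain ⟨n, rfl⟩ : ∃ n, N = n + 1 := ⟨N - 1, by lia⟩
  have hr := fun {p q η' η ρ} (Y : JumpSolution (n + 1) b p q γ η' η ρ) =>
    Y.branch_right (hb n (Nat.lt_succ_self n))
  obtain ⟨e1, e2, e3, e4⟩ := (JumpSolution.fundSys CC SS hS hC).uniqueness
    (JumpSolution.fundSys CCt SSt hSt hCt) rfl (left_ne_zero_of_mul hαβ)
    (fun ρ => (hr (CC ρ)).1) (fun ρ => (hr (CC ρ)).2)
    (fun ρ => (hr (SS ρ)).1) (fun ρ => (hr (SS ρ)).2)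
    (fun ρ => (hr (CCt ρ)).1) (fun ρ => (hr (CCt ρ)).2)
    (fun ρ => (hr (SSt ρ)).1) (fun ρ => (hr (SSt ρ)).2)
    (fun ρ => sub_left_injective (ha ρ)) hd hΩ₁ hΩ₂
  refine ⟨e1, e2, (ae_restrict_iff' measurableSet_Ioo).2 (ae_Ioo_of_ae_nodes e3),
    fun j hj hjN => ?_⟩
  obtain ⟨k, rfl⟩ : ∃ k, j = k + 1 := ⟨j - 1, by lia⟩
  exact e4 k hjN
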